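/- Let F be a totally real number field, L a positive definite integral O_F-lattice, and n a positive integer with rank L ≥ n+3 ≥ 4. Then the following are equivalent: (1) L is globally n-ADC; (2) L is n-regular and locally n-universal; (3) L is globally n-universal. -/

import Mathlib

/-
Quadratic lattices over (local and global) fields, following
"On n-ADC integral quadratic lattices over totally real number fields".

A non-archimedean local field of characteristic ≠ 2 is formalized as a field `K`
together with a valuation subring `O` of `K` which is a complete discrete valuation
ring with finite residue field (completeness is expressed as adic completeness with
respect to the maximal ideal); `K` is automatically the fraction field of `O`.
-/

noncomputable section

namespace QLat

variable {K : Type} [Field K]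

/-- The bilinear form associated to a quadratic form `Q`, i.e. `B x y = (Q(x+y)-Q(x)-Q(y))/2`,
so that `B x x = Q x`. -/
def bil {V : Type} [AddCommGroup V] [Module K V] (Q : QuadraticForm K V) (x y : V) : K :=
  (2 : K)⁻¹ * QuadraticMap.polar (⇑Q) x y

/-- A quadratic form (space) is nondegenerate. -/
def Nondeg {V : Type} [AddCommGroup V] [Module K V] (Q : QuadraticForm K V) : Prop :=
  ∀ x : V, (∀ y : V, QuadraticMap.polar (⇑Q) x y = 0) → x = 0

/-- The `O`-span of a subset `t` of a `K`-vector space: all finite `O`-linear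
combinations of elements of `t`. -/
def ospan (O : Subring K) {V : Type} [AddCommGroup V] [Module K V] (t : Set V) : Set V :=
  {x | ∃ (m : ℕ) (c : Fin m → K) (g : Fin m → V),
    (∀ i, c i ∈ O) ∧ (∀ i, g i ∈ t) ∧ x = ∑ i, c i • g i}

/-- An `O`-lattice in `V`: a finitely generated `O`-submodule of `V`. -/
def IsLattice (O : Subring K) {V : Type} [AddCommGroup V] [Module K V] (L : Set V) : Prop :=
  ∃ t : Finset V, L = ospan O (t : Set V)

/-- An `O`-lattice on `V`: a finitely generated `O`-submodule of `V` spanning `V` over `K`. -/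
def IsLatticeOn (O : Subring K) {V : Type} [AddCommGroup V] [Module K V] (L : Set V) : Prop :=
  IsLattice O L ∧ Submodule.span K L = ⊤

/-- The lattice `L` is integral: `𝔫(L) ⊆ O`, i.e. all values of `Q` on `L` lie in `O`. -/
def IsIntegral (O : Subring K) {V : Type} [AddCommGroup V] [Module K V]
    (Q : QuadraticForm K V) (L : Set V) : Prop :=
  ∀ x ∈ L, Q x ∈ O

/-- The quadratic space `(V,Q)` represents the quadratic space `(W,Q')`. -/
def SpaceRep {W V : Type} [AddCommGroup W] [Module K W] [AddCommGroup V] [Module K V]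
    (Q' : QuadraticForm K W) (Q : QuadraticForm K V) : Prop :=
  ∃ σ : W →ₗ[K] V, Function.Injective σ ∧ ∀ x, Q (σ x) = Q' x

/-- The quadratic spaces `(W,Q')` and `(V,Q)` are isometric. -/
def SpaceIsom {W V : Type} [AddCommGroup W] [Module K W] [AddCommGroup V] [Module K V]
    (Q' : QuadraticForm K W) (Q : QuadraticForm K V) : Prop :=
  ∃ σ : W ≃ₗ[K] V, ∀ x, Q (σ x) = Q' x

/-- The lattice `M` (in `(V,Q)`) represents the lattice `N` (a full lattice in `(W,Q')`):
there is an injective form-preserving `K`-linear map carrying `N` into `M`.  (For a full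
lattice `N` this is equivalent to the existence of an injective form-preserving
`O`-linear map `N → M`, since `K` is the fraction field of `O`.) -/
def LatRep {W V : Type} [AddCommGroup W] [Module K W] [AddCommGroup V] [Module K V]
    (Q' : QuadraticForm K W) (Q : QuadraticForm K V) (N : Set W) (M : Set V) : Prop :=
  ∃ σ : W →ₗ[K] V, Function.Injective σ ∧ (∀ x, Q (σ x) = Q' x) ∧ σ '' N ⊆ M

/-- The lattices `N` (full in `(W,Q')`) and `M` (in `(V,Q)`) are isometric. -/
def LatIsom {W V : Type} [AddCommGroup W] [Module K W] [AddCommGroup V] [Module K V]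
    (Q' : QuadraticForm K W) (Q : QuadraticForm K V) (N : Set W) (M : Set V) : Prop :=
  ∃ σ : W →ₗ[K] V, Function.Injective σ ∧ (∀ x, Q (σ x) = Q' x) ∧ σ '' N = M

/-- The lattice `L` is `O`-maximal: it is integral and is not properly contained in any
(finitely generated) lattice on the same subspace with integral norm. -/
def IsMaximal (O : Subring K) {V : Type} [AddCommGroup V] [Module K V]
    (Q : QuadraticForm K V) (L : Set V) : Prop :=
  IsIntegral O Q L ∧
    ∀ L' : Set V, IsLattice O L' → Submodule.span K L' = Submodule.span K L →
      L ⊆ L' → IsIntegral O Q L' → L' = L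

/-- The lattice `L` is `n`-ADC: every integral `O`-lattice `N` of rank `n` (on a
nondegenerate quadratic space `W` of dimension `n`) whose ambient space is represented by
the space `(V,Q) = K·L` is represented by `L`. -/
def IsADC (O : Subring K) {V : Type} [AddCommGroup V] [Module K V]
    (Q : QuadraticForm K V) (L : Set V) (n : ℕ) : Prop :=
  ∀ (W : Type) [AddCommGroup W] [Module K W] (Q' : QuadraticForm K W),
    Nondeg Q' → Module.finrank K W = n →
    ∀ N : Set W, IsLatticeOn O N → IsIntegral O Q' N →
      SpaceRep Q' Q → LatRep Q' Q N L

/-- The lattice `L` is `n`-universal: it represents every integral `O`-lattice of rank `n`. -/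
def IsUniversal (O : Subring K) {V : Type} [AddCommGroup V] [Module K V]
    (Q : QuadraticForm K V) (L : Set V) (n : ℕ) : Prop :=
  ∀ (W : Type) [AddCommGroup W] [Module K W] (Q' : QuadraticForm K W),
    Nondeg Q' → Module.finrank K W = n →
    ∀ N : Set W, IsLatticeOn O N → IsIntegral O Q' N → LatRep Q' Q N L

end QLat

open scoped TensorProduct
open IsDedekindDomain

namespace QGlob

/-- Scalar-commutation instance for the completed field, registered to help instance
search for modules over `F_v`. -/
noncomputable instance (F : Type) [Field F] [NumberField F]
    (v : HeightOneSpectrum (NumberField.RingOfIntegers F)) :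
    SMulCommClass F (v.adicCompletion F) (v.adicCompletion F) :=
  Algebra.to_smulCommClass


variable (F : Type) [Field F] [NumberField F]

/-- `F` is totally real: every infinite place of `F` is real. -/
def TotallyReal : Prop := ∀ v : NumberField.InfinitePlace F, v.IsReal

/-- The ring of integers `O_F` of `F`, as a subring of `F`. -/
def OF : Subring F := (integralClosure ℤ F).toSubring

/-- A quadratic form over the totally real field `F` is positive definite if its values
at nonzero vectors are positive under every real embedding of `F`. -/
def PosDef {V : Type} [AddCommGroup V] [Module F V] (Q : QuadraticForm F V) : Prop :=
  ∀ (φ : F →+* ℝ) (x : V), x ≠ 0 → 0 < φ (Q x)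

/-- The completion `F_v` of `F` at a finite place `v`. -/
abbrev Fv (v : HeightOneSpectrum (NumberField.RingOfIntegers F)) : Type :=
  v.adicCompletion F

/-- The ring of integers of `F_v`, as a subring of `F_v`. -/
def Ov (v : HeightOneSpectrum (NumberField.RingOfIntegers F)) : Subring (Fv F v) :=
  (v.adicCompletionIntegers F).toSubring

/-- The completion `V_v = F_v ⊗_F V` of a quadratic space `V` over `F` at `v`. -/
abbrev Vv (V : Type) [AddCommGroup V] [Module F V]
    (v : HeightOneSpectrum (NumberField.RingOfIntegers F)) : Type :=
  (Fv F v) ⊗[F] V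

/-- The extension of a quadratic form `Q` on `V` to `V_v`. -/
noncomputable def Qv {V : Type} [AddCommGroup V] [Module F V] (Q : QuadraticForm F V)
    (v : HeightOneSpectrum (NumberField.RingOfIntegers F)) :
    QuadraticForm (Fv F v) (Vv F V v) :=
  letI : Invertible (2 : F) := invertibleOfNonzero two_ne_zero
  Q.baseChange (Fv F v)

/-- The canonical map `V → V_v`. -/
noncomputable def toVv {V : Type} [AddCommGroup V] [Module F V]
    (v : HeightOneSpectrum (NumberField.RingOfIntegers F)) : V → Vv F V v :=
  fun x => (1 : Fv F v) ⊗ₜ[F] x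

/-- The completion `L_v = O_{F_v} ⊗ L` of a lattice `L ⊆ V` at `v`, i.e. the
`O_{F_v}`-span of the image of `L` in `V_v`. -/
noncomputable def Lv {V : Type} [AddCommGroup V] [Module F V] (L : Set V)
    (v : HeightOneSpectrum (NumberField.RingOfIntegers F)) : Set (Vv F V v) :=
  QLat.ospan (Ov F v) (toVv F v '' L)

variable {V : Type} [AddCommGroup V] [Module F V]

/-- `L` is globally `n`-ADC: every positive definite integral `O_F`-lattice `N` of rank
`n` whose ambient space `F·N` is represented by `F·L` is represented by `L`. -/
def IsGlobADC (Q : QuadraticForm F V) (L : Set V) (n : ℕ) : Prop :=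
  ∀ (W : Type) [AddCommGroup W] [Module F W] (Q' : QuadraticForm F W),
    QLat.Nondeg Q' → PosDef F Q' → Module.finrank F W = n →
    ∀ N : Set W, QLat.IsLatticeOn (OF F) N → QLat.IsIntegral (OF F) Q' N →
      QLat.SpaceRep Q' Q → QLat.LatRep Q' Q N L

/-- `L` is globally `n`-universal: it represents every positive definite integral
`O_F`-lattice of rank `n`. -/
def IsGlobUniversal (Q : QuadraticForm F V) (L : Set V) (n : ℕ) : Prop :=
  ∀ (W : Type) [AddCommGroup W] [Module F W] (Q' : QuadraticForm F W),
    QLat.Nondeg Q' → PosDef F Q' → Module.finrank F W = n →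
    ∀ N : Set W, QLat.IsLatticeOn (OF F) N → QLat.IsIntegral (OF F) Q' N →
      QLat.LatRep Q' Q N L

/-- `L` is `n`-regular: it represents every positive definite integral `O_F`-lattice `N`
of rank `n` which is represented by `L` locally at every finite place. -/
def IsNRegular (Q : QuadraticForm F V) (L : Set V) (n : ℕ) : Prop :=
  ∀ (W : Type) [AddCommGroup W] [Module F W] (Q' : QuadraticForm F W),
    QLat.Nondeg Q' → PosDef F Q' → Module.finrank F W = n →
    ∀ N : Set W, QLat.IsLatticeOn (OF F) N → QLat.IsIntegral (OF F) Q' N →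
      (∀ v : HeightOneSpectrum (NumberField.RingOfIntegers F),
        QLat.LatRep (Qv F Q' v) (Qv F Q v) (Lv F N v) (Lv F L v)) →
      QLat.LatRep Q' Q N L

/-- `L` is locally `n`-ADC: `L_v` is `n`-ADC for every finite place `v`. -/
def IsLocADC (Q : QuadraticForm F V) (L : Set V) (n : ℕ) : Prop :=
  ∀ v : HeightOneSpectrum (NumberField.RingOfIntegers F),
    QLat.IsADC (Ov F v) (Qv F Q v) (Lv F L v) n

/-- `L` is locally `n`-universal: `L_v` is `n`-universal for every finite place `v`. -/
def IsLocUniversal (Q : QuadraticForm F V) (L : Set V) (n : ℕ) : Prop :=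
  ∀ v : HeightOneSpectrum (NumberField.RingOfIntegers F),
    QLat.IsUniversal (Ov F v) (Qv F Q v) (Lv F L v) n

/-- `L` has class number one: every `O_F`-lattice in the genus of `L` (i.e. every lattice
on a space isometric to `F·L` which is isometric to `L` at every finite place) is
isometric to `L`. -/
def ClassNumberOne (Q : QuadraticForm F V) (L : Set V) : Prop :=
  ∀ (W : Type) [AddCommGroup W] [Module F W] (Q' : QuadraticForm F W),
    QLat.Nondeg Q' →
    ∀ N : Set W, QLat.IsLatticeOn (OF F) N →
      QLat.SpaceIsom Q' Q →
      (∀ v : HeightOneSpectrum (NumberField.RingOfIntegers F),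
        QLat.LatIsom (Qv F Q' v) (Qv F Q v) (Lv F N v) (Lv F L v)) →
      QLat.LatIsom Q' Q N L

end QGlob

open QLat QGlob


section
namespace QH
open IsDedekindDomain NumberField WithZero

/-- group of norms `a² - ε b²`. -/
def normGrp {K : Type*} [Field K] (ε : K) : Subgroup Kˣ where
  carrier := {x | ∃ a b : K, (x : K) = a ^ 2 - ε * b ^ 2}
  one_mem' := ⟨1, 0, by simp⟩
  mul_mem' := by
    rintro x y ⟨a, b, h⟩ ⟨c, d, h'⟩
    exact ⟨a * c + ε * b * d, a * d + b * c, by rw [Units.val_mul, h, h']; ring⟩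
  inv_mem' := by
    rintro x ⟨a, b, h⟩
    refine ⟨a * (x : K)⁻¹, b * (x : K)⁻¹, ?_⟩
    have : (x : K) ≠ 0 := x.ne_zero
    have h2 : (a * (x : K)⁻¹) ^ 2 - ε * (b * (x : K)⁻¹) ^ 2 = (a ^ 2 - ε * b ^ 2) * ((x : K)⁻¹) ^ 2 := by ring
    rw [h2, ← h, Units.val_inv_eq_inv_val]
    field_simp

/-- group of approximate squares. -/
def locSq {K : Type*} [Field K] {Γ : Type*} [LinearOrderedCommGroupWithZero Γ] (v : Valuation K Γ) :
    Subgroup Kˣ where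
  carrier := {x | ∃ (y : Kˣ) (c : K), v c < 1 ∧ (x : K) = y ^ 2 * (1 + 4 * c)}
  one_mem' := ⟨1, 0, by simp, by simp⟩
  mul_mem' := by
    rintro x x' ⟨y, c, hc, h⟩ ⟨y', c', hc', h'⟩
    refine ⟨y * y', c + c' + 4 * (c * c'), ?_, by rw [Units.val_mul, h, h']; push_cast; ring⟩
    have h4 : v 4 ≤ 1 := by
      have h2 : v 2 ≤ 1 := by
        have := v.map_add 1 1
        rw [one_add_one_eq_two] at this; simpa using this
      have : (4 : K) = 2 * 2 := by norm_num
      rw [this, map_mul]; exact mul_le_one' h2 h2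
    refine v.map_add_lt (v.map_add_lt hc hc') ?_
    rw [map_mul, map_mul]
    exact lt_of_le_of_lt (mul_le_of_le_one_left' h4) (mul_lt_one_of_nonneg_of_lt_one_left zero_le' hc hc'.le)
  inv_mem' := by
    rintro x ⟨y, c, hc, h⟩
    refine ⟨y * x⁻¹, c, hc, ?_⟩
    have : (x : K) ≠ 0 := x.ne_zero
    push_cast
    rw [mul_pow, mul_right_comm, ← h]
    field_simp

section
variable {K : Type*} [Field K] {Γ : Type*} [LinearOrderedCommGroupWithZero Γ] (v : Valuation K Γ)

lemma v_two_le : v 2 ≤ 1 := by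
  have := v.map_add 1 1
  rw [one_add_one_eq_two] at this; simpa using this

lemma v_four : v 4 = v 2 * v 2 := by
  rw [← map_mul]; norm_num

lemma v_four_le : v 4 ≤ 1 := by
  rw [v_four]; exact mul_le_one' (v_two_le v) (v_two_le v)

lemma mem_locSq {x : Kˣ} : x ∈ locSq v ↔ ∃ (y : Kˣ) (c : K), v c < 1 ∧ (x : K) = y ^ 2 * (1 + 4 * c) := Iff.rfl

lemma mem_normGrp {ε : K} {x : Kˣ} : x ∈ normGrp ε ↔ ∃ a b : K, (x : K) = a ^ 2 - ε * b ^ 2 := Iff.rfl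

lemma sq_mem_locSq (x : Kˣ) : x ^ 2 ∈ locSq v := ⟨x, 0, by simp, by simp⟩

lemma mul_self_mem_locSq (x : Kˣ) : x * x ∈ locSq v := by rw [← sq]; exact sq_mem_locSq v x

lemma mul_mem_locSq_comm {x y : Kˣ} : x / y ∈ locSq v ↔ x * y ∈ locSq v := by
  have : x * y = x / y * y ^ 2 := by
    rw [sq, ← mul_assoc, div_mul_cancel]
  rw [this]
  exact (Subgroup.mul_mem_cancel_right _ (sq_mem_locSq v y)).symm

lemma mem_locSq_of_near {x z : Kˣ} (h : v ((x : K) - z) < v (4 * z)) : x / z ∈ locSq v := by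
  have h4 : (4 : K) ≠ 0 := by
    rintro h4; simp [h4] at h
  have hz := z.ne_zero
  refine ⟨1, ((x : K) - z) / (4 * z), ?_, ?_⟩
  · rw [map_div₀]
    exact (div_lt_one₀ (zero_lt_iff.mpr ((Valuation.ne_zero_iff _).mpr (by simp [h4])))).mpr h
  · push_cast; field_simp; ring

lemma v_one_add_four {c : K} (hc : v c < 1) : v (1 + 4 * c) = 1 := by
  have h : v (4 * c) < 1 := by
    rw [map_mul]; exact lt_of_le_of_lt (mul_le_of_le_one_left' (v_four_le v)) hc
  exact v.map_one_add_of_lt h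

lemma locSq_val {x : Kˣ} (hx : x ∈ locSq v) : ∃ y : Kˣ, v (x : K) = v (y : K) ^ 2 := by
  obtain ⟨y, c, hc, h⟩ := hx
  exact ⟨y, by rw [h, map_mul, v_one_add_four v hc]; simp⟩

lemma locSq_map {L : Type*} [Field L] {Γ' : Type*} [LinearOrderedCommGroupWithZero Γ']
    (w : Valuation L Γ') (f : K →+* L) (hf : ∀ x, v x < 1 → w (f x) < 1) {x : Kˣ} (hx : x ∈ locSq v) :
    Units.map (f : K →* L) x ∈ locSq w := by
  obtain ⟨y, c, hc, h⟩ := hx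
  refine ⟨Units.map (f : K →* L) y, f c, hf _ hc, ?_⟩
  simp [h, map_ofNat f 4]

lemma isSquare_mem_locSq {x : Kˣ} (h : IsSquare (x : K)) : x ∈ locSq v := by
  obtain ⟨r, hr⟩ := h
  have : r ≠ 0 := by rintro rfl; simp at hr
  exact ⟨Units.mk0 r this, 0, by simp, by simp [hr, sq]⟩

lemma normGrp_eq_top_of_sq [NeZero (2:K)] {ε : K} (h : IsSquare ε) (h0 : ε ≠ 0) : normGrp ε = ⊤ := by
  obtain ⟨r, rfl⟩ := h
  have hr : r ≠ 0 := by rintro rfl; simp at h0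
  have h2 : (2:K) ≠ 0 := NeZero.ne 2
  rw [eq_top_iff]
  rintro x -
  refine ⟨(x + 1) / 2, (x - 1) / 2 / r, ?_⟩
  field_simp; ring

/-- local norms -/
def locNorm (ε : K) : Subgroup Kˣ := normGrp ε ⊔ locSq v

lemma mem_locNorm {ε : K} {x : Kˣ} : x ∈ locNorm v ε ↔ ∃ y ∈ normGrp ε, ∃ z ∈ locSq v, y * z = x := by
  rw [locNorm, Subgroup.mem_sup]

lemma normGrp_le_locNorm {ε : K} : normGrp ε ≤ locNorm v ε := le_sup_left
lemma locSq_le_locNorm {ε : K} : locSq v ≤ locNorm v ε := le_sup_right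

lemma sq_mem_locNorm {ε : K} (x : Kˣ) : x ^ 2 ∈ locNorm v ε := locSq_le_locNorm v (sq_mem_locSq v x)
end
end QH

end

section
namespace QH
open IsDedekindDomain NumberField WithZero

section
variable {R : Type*} [CommRing R] [IsDedekindDomain R] {K : Type*} [Field K] [Algebra R K] [IsFractionRing R K]
  (v : HeightOneSpectrum R)

lemma val_ne (x : Kˣ) : v.valuation K (x : K) ≠ 0 := (Valuation.ne_zero_iff _).mpr x.ne_zero

/-- order homomorphism -/
noncomputable def ordv : Kˣ →* Multiplicative ℤ where
  toFun x := Multiplicative.ofAdd (log (v.valuation K (x : K)))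
  map_one' := by simp
  map_mul' x y := by
    rw [Units.val_mul, map_mul, log_mul (val_ne v x) (val_ne v y)]; rfl

/-- log of valuation -/
noncomputable def lg (x : Kˣ) : ℤ := log (v.valuation K (x : K))

lemma lg_mul (x y : Kˣ) : lg v (x * y) = lg v x + lg v y := by
  rw [lg, Units.val_mul, map_mul, log_mul (val_ne v x) (val_ne v y)]; rfl

lemma lg_one : lg v (1 : Kˣ) = 0 := by simp [lg]

lemma lg_inv (x : Kˣ) : lg v (x⁻¹) = - lg v x := by
  have := lg_mul v x x⁻¹
  rw [mul_inv_cancel, lg_one] at this; omega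

lemma lg_div (x y : Kˣ) : lg v (x / y) = lg v x - lg v y := by
  rw [div_eq_mul_inv, lg_mul, lg_inv]; omega

lemma lg_pow (x : Kˣ) (n : ℕ) : lg v (x ^ n) = n * lg v x := by
  induction n with
  | zero => simp [lg_one]
  | succ n ih => rw [pow_succ, lg_mul, ih]; push_cast; ring

lemma lg_zpow (x : Kˣ) (n : ℤ) : lg v (x ^ n) = n * lg v x := by
  cases n with
  | ofNat n => simpa using lg_pow v x n
  | negSucc n => rw [zpow_negSucc, lg_inv, lg_pow]; push_cast [Int.negSucc_eq]; ring

lemma val_eq_exp (x : Kˣ) : v.valuation K (x : K) = exp (lg v x) := (exp_log (val_ne v x)).symm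

lemma val_eq_val_iff (x y : Kˣ) : v.valuation K (x : K) = v.valuation K (y : K) ↔ lg v x = lg v y := by
  rw [val_eq_exp, val_eq_exp, exp_inj]

lemma val_lt_val_iff (x y : Kˣ) : v.valuation K (x : K) < v.valuation K (y : K) ↔ lg v x < lg v y := by
  rw [val_eq_exp, val_eq_exp, exp_lt_exp]

lemma val_eq_one_iff (x : Kˣ) : v.valuation K (x : K) = 1 ↔ lg v x = 0 := by
  rw [val_eq_exp, ← exp_zero, exp_inj]

lemma val_lt_one_iff (x : Kˣ) : v.valuation K (x : K) < 1 ↔ lg v x < 0 := by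
  rw [val_eq_exp, ← exp_zero, exp_lt_exp]

variable (K) in
lemma exists_lg (n : ℤ) : ∃ x : Kˣ, lg v x = n := by
  obtain ⟨π, hπ⟩ := v.valuation_exists_uniformizer K
  have h0 : π ≠ 0 := by rintro rfl; rw [map_zero] at hπ; exact (exp_ne_zero hπ.symm)
  refine ⟨(Units.mk0 π h0) ^ (-n), ?_⟩
  rw [lg_zpow]
  have : lg v (Units.mk0 π h0) = -1 := by simp [lg, hπ]
  rw [this]; ring

lemma locSq_even {x : Kˣ} (hx : x ∈ locSq (v.valuation K)) : Even (lg v x) := by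
  obtain ⟨y, hy⟩ := locSq_val _ hx
  rw [← map_pow, ← Units.val_pow_eq_pow_val, val_eq_val_iff, lg_pow] at hy
  exact ⟨lg v y, by rw [hy]; push_cast; ring⟩

lemma even_normalize {x : Kˣ} (hx : Even (lg v x)) : ∃ y z : Kˣ, x = y * z ^ 2 ∧ lg v y = 0 := by
  obtain ⟨n, hn⟩ := hx
  obtain ⟨z, hz⟩ := exists_lg K v n
  refine ⟨x / z ^ 2, z, by simp, ?_⟩
  rw [lg_div, lg_pow, hz, hn]; push_cast; ring

/-- parity trick -/
lemma norm_odd {ε : Kˣ} (hε : ¬ Even (lg v ε)) {a b : K} (h : a ^ 2 - (ε : K) * b ^ 2 ≠ 0) :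
    (a ≠ 0 ∧ v.valuation K ((ε : K) * b ^ 2) < v.valuation K (a ^ 2)) ∨
    (b ≠ 0 ∧ v.valuation K (a ^ 2) < v.valuation K ((ε : K) * b ^ 2)) := by
  by_cases ha : a = 0
  · right; subst ha
    have : b ≠ 0 := by rintro rfl; simp at h
    exact ⟨this, by simp [this, zero_lt_iff]⟩
  by_cases hb : b = 0
  · left; subst hb; exact ⟨ha, by simp [ha, zero_lt_iff]⟩
  have e1 : v.valuation K (a ^ 2) = exp (2 * lg v (Units.mk0 a ha)) := by
    have := val_eq_exp v (Units.mk0 a ha ^ 2); rw [lg_pow] at this; simpa using this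
  have e2 : v.valuation K ((ε : K) * b ^ 2) = exp (lg v ε + 2 * lg v (Units.mk0 b hb)) := by
    have := val_eq_exp v (ε * Units.mk0 b hb ^ 2); rw [lg_mul, lg_pow] at this; simpa using this
  rw [e1, e2, exp_lt_exp, exp_lt_exp]
  rcases lt_trichotomy (2 * lg v (Units.mk0 a ha)) (lg v ε + 2 * lg v (Units.mk0 b hb)) with h1 | h1 | h1
  · exact Or.inr ⟨hb, h1⟩
  · exfalso; apply hε; exact ⟨lg v (Units.mk0 a ha) - lg v (Units.mk0 b hb), by omega⟩
  · exact Or.inl ⟨ha, h1⟩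

/-- lift residues -/
lemma exists_residue {x : K} (hx : v.valuation K x ≤ 1) : ∃ r : R, v.valuation K (x - algebraMap R K r) < 1 := by
  obtain ⟨a, ha⟩ := v.exists_valuation_sub_lt_of_integer hx 1
  exact ⟨a, by rw [Valuation.map_sub_swap]; simpa using ha⟩

lemma val_alg_eq_one {r : R} : v.valuation K (algebraMap R K r) = 1 ↔ r ∉ v.asIdeal :=
  HeightOneSpectrum.valuation_eq_one_iff_notMem v

lemma val_alg_lt_one {r : R} : v.valuation K (algebraMap R K r) < 1 ↔ r ∈ v.asIdeal :=
  HeightOneSpectrum.valuation_lt_one_iff_mem v r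

lemma two_ne_zero_of_val (h2 : v.valuation K 2 = 1) : (2 : K) ≠ 0 := by
  intro h; rw [h] at h2; simp at h2

lemma four_val (h2 : v.valuation K 2 = 1) : v.valuation K 4 = 1 := by rw [v_four, h2, one_mul]

lemma near_locSq (h2 : v.valuation K 2 = 1) {x z : Kˣ}
    (h : v.valuation K ((x : K) - z) < v.valuation K (z : K)) : x / z ∈ locSq (v.valuation K) := by
  apply mem_locSq_of_near
  rwa [map_mul, four_val v h2, one_mul]

/-- nondyadic square criterion -/
lemma locSq_iff_residue (h2 : v.valuation K 2 = 1) {x : Kˣ} (hx : lg v x = 0) {r : R}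
    (hr : v.valuation K ((x : K) - algebraMap R K r) < 1) :
    x ∈ locSq (v.valuation K) ↔ IsSquare (Ideal.Quotient.mk v.asIdeal r) := by
  have vx : v.valuation K (x : K) = 1 := (val_eq_one_iff v x).mpr hx
  have vr : v.valuation K (algebraMap R K r) = 1 := by
    have : algebraMap R K r = x - (x - algebraMap R K r) := by ring
    rw [this, Valuation.map_sub_eq_of_lt_left]
    · exact vx
    · rwa [vx]
  constructor
  · rintro ⟨y, c, hc, h⟩
    have vy : v.valuation K (y : K) ≤ 1 := by
      rw [h, map_mul, v_one_add_four _ hc, mul_one, map_pow] at vx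
      exact (pow_le_one_iff (n := 2) (by norm_num)).mp vx.le
    obtain ⟨s, hs⟩ := exists_residue v vy
    refine ⟨Ideal.Quotient.mk _ s, ?_⟩
    rw [← map_mul, Ideal.Quotient.eq, ← val_alg_lt_one (K := K) v]
    have vs : v.valuation K (algebraMap R K s) ≤ 1 := HeightOneSpectrum.valuation_le_one v s
    have : algebraMap R K (r - s * s) = (-(x - algebraMap R K r)) +
      ((y - algebraMap R K s) * (y + algebraMap R K s) + y ^ 2 * (4 * c)) := by
      rw [h]; simp only [map_sub, map_mul]; ring
    rw [this]
    refine Valuation.map_add_lt _ (by rwa [Valuation.map_neg]) (Valuation.map_add_lt _ ?_ ?_)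
    · rw [map_mul]
      exact mul_lt_one_of_lt_of_le hs ((Valuation.map_add _ _ _).trans (max_le vy vs))
    · rw [map_mul, map_mul, mul_comm]
      refine mul_lt_one_of_lt_of_le ?_ ?_
      · rw [four_val v h2, one_mul]; exact hc
      · rw [map_pow]; exact pow_le_one' vy 2
  · rintro ⟨s, hs⟩
    obtain ⟨s, rfl⟩ := Ideal.Quotient.mk_surjective s
    rw [← map_mul, Ideal.Quotient.eq, ← val_alg_lt_one (K := K) v] at hs
    have e : v.valuation K ((x : K) - algebraMap R K s ^ 2) < 1 := by
      have : (x : K) - algebraMap R K s ^ 2 = (x - algebraMap R K r) + algebraMap R K (r - s * s) := by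
        simp only [map_sub, map_mul]; ring
      rw [this]; exact Valuation.map_add_lt _ hr hs
    have vs2 : v.valuation K (algebraMap R K s ^ 2) = 1 := by
      have : algebraMap R K s ^ 2 = x - (x - algebraMap R K s ^ 2) := by ring
      rw [this, Valuation.map_sub_eq_of_lt_left]
      · exact vx
      · rwa [vx]
    have hs0 : algebraMap R K s ≠ 0 := by intro h0; rw [h0] at vs2; simp at vs2
    have := near_locSq v h2 (x := x) (z := (Units.mk0 _ hs0) ^ 2) (by
      simp only [Units.val_pow_eq_pow_val, Units.val_mk0]; rwa [vs2])
    rw [mul_mem_locSq_comm] at this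
    exact (Subgroup.mul_mem_cancel_right _ (sq_mem_locSq _ _)).mp this

variable [Finite (R ⧸ v.asIdeal)]

lemma residue_char (h2 : v.valuation K 2 = 1) : letI := Ideal.Quotient.field v.asIdeal
    ringChar (R ⧸ v.asIdeal) ≠ 2 := by
  let _ := Ideal.Quotient.field v.asIdeal
  intro h
  have : (2 : R ⧸ v.asIdeal) = 0 := by
    have := (ringChar.spec (R ⧸ v.asIdeal) 2).mpr (by rw [h])
    simpa using this
  have h3 : (2 : R) ∈ v.asIdeal := by
    rw [← Ideal.Quotient.eq_zero_iff_mem]; exact this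
  rw [← val_alg_lt_one (K := K)] at h3
  rw [map_ofNat, h2] at h3; exact lt_irrefl _ h3

/-- product of two nonsquare units is a square -/
lemma mul_nonsq (h2 : v.valuation K 2 = 1) {x y : Kˣ} (hx : lg v x = 0) (hy : lg v y = 0)
    (hx' : x ∉ locSq (v.valuation K)) (hy' : y ∉ locSq (v.valuation K)) : x * y ∈ locSq (v.valuation K) := by
  let _ := Ideal.Quotient.field v.asIdeal
  let _ := Fintype.ofFinite (R ⧸ v.asIdeal)
  classical
  have vx := (val_eq_one_iff v x).mpr hx
  have vy := (val_eq_one_iff v y).mpr hy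
  obtain ⟨r, hr⟩ := exists_residue v vx.le
  obtain ⟨s, hs⟩ := exists_residue v vy.le
  have vs : v.valuation K (algebraMap R K s) ≤ 1 := HeightOneSpectrum.valuation_le_one v s
  have hrs : v.valuation K (((x * y : Kˣ) : K) - algebraMap R K (r * s)) < 1 := by
    have : ((x * y : Kˣ) : K) - algebraMap R K (r * s) = (x - algebraMap R K r) * algebraMap R K s +
      x * (y - algebraMap R K s) := by rw [map_mul, Units.val_mul]; ring
    rw [this]
    refine Valuation.map_add_lt _ ?_ ?_
    · rw [map_mul]; exact mul_lt_one_of_lt_of_le hr vs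
    · rw [map_mul, vx, one_mul]; exact hs
  rw [locSq_iff_residue v h2 hx hr] at hx'
  rw [locSq_iff_residue v h2 hy hs] at hy'
  rw [locSq_iff_residue v h2 (by rw [lg_mul, hx, hy, add_zero]) hrs, map_mul]
  have hc := residue_char v h2
  have h0 : ∀ a : R ⧸ v.asIdeal, ¬ IsSquare a → a ≠ 0 := by rintro a ha rfl; exact ha (by simp)
  rw [← quadraticChar_one_iff_isSquare (mul_ne_zero (h0 _ hx') (h0 _ hy')), map_mul,
    quadraticChar_neg_one_iff_not_isSquare.mpr hx', quadraticChar_neg_one_iff_not_isSquare.mpr hy']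
  norm_num

lemma exists_nonsq_unit (h2 : v.valuation K 2 = 1) : ∃ u : Kˣ, lg v u = 0 ∧ u ∉ locSq (v.valuation K) := by
  let _ := Ideal.Quotient.field v.asIdeal
  obtain ⟨a, ha⟩ := FiniteField.exists_nonsquare (residue_char v h2)
  obtain ⟨r, rfl⟩ := Ideal.Quotient.mk_surjective a
  have h0 : r ∉ v.asIdeal := by
    intro h; rw [← Ideal.Quotient.eq_zero_iff_mem] at h; rw [h] at ha; exact ha (by simp)
  have vr := (val_alg_eq_one (K := K) v).mpr h0
  have hr0 : algebraMap R K r ≠ 0 := by intro h; rw [h] at vr; simp at vr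
  have hl : lg v (Units.mk0 _ hr0) = 0 := (val_eq_one_iff v _).mp (by simpa using vr)
  refine ⟨Units.mk0 _ hr0, hl, ?_⟩
  rwa [locSq_iff_residue v h2 hl (r := r) (by simp)]

/-- L2, nondyadic: local norm group is proper -/
lemma exists_not_locNorm (h2 : v.valuation K 2 = 1) {ε : Kˣ} (hε : ε ∉ locSq (v.valuation K)) :
    ∃ x : Kˣ, x ∉ locNorm (v.valuation K) (ε : K) := by
  by_cases he : Even (lg v ε)
  · obtain ⟨π, hπ⟩ := exists_lg K v 1
    refine ⟨π, ?_⟩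
    rw [mem_locNorm]
    rintro ⟨y, ⟨a, b, hy⟩, z, hz, h⟩
    have hz := locSq_even v hz
    have hl := congrArg (lg v) h
    rw [lg_mul, hπ] at hl
    have hodd : ¬ Even (lg v y) := by
      intro h'; have := h'.add hz; rw [hl] at this; revert this; decide
    have hb : b ≠ 0 := by
      rintro rfl
      have ha : a ≠ 0 := by rintro rfl; simp at hy
      have : y = (Units.mk0 a ha) ^ 2 := by ext; simp [hy]
      rw [this, lg_pow] at hodd; exact hodd (by simp)
    have ha : a ≠ 0 := by
      rintro rfl
      have : y = -ε * (Units.mk0 b hb) ^ 2 := by ext; simp [hy]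
      have h3 : lg v (-ε) = lg v ε := by simp [lg, Valuation.map_neg]
      rw [this, lg_mul, h3, lg_pow] at hodd; exact hodd (he.add (by simp))
    have hlt : v.valuation K (y : K) < v.valuation K (a ^ 2) := by
      set e2 : Kˣ := ε * (Units.mk0 b hb) ^ 2
      have e1 : Even (lg v e2) := by rw [lg_mul, lg_pow]; exact he.add (by simp)
      have hy' : (y : K) = ((Units.mk0 a ha ^ 2 : Kˣ) : K) - e2 := by simp [hy, e2]
      have e0 : Even (lg v (Units.mk0 a ha ^ 2)) := by rw [lg_pow]; simp
      have : a ^ 2 = ((Units.mk0 a ha ^ 2 : Kˣ) : K) := by simp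
      rw [this]
      by_contra hcon
      push Not at hcon
      rcases lt_trichotomy (v.valuation K ((Units.mk0 a ha ^ 2 : Kˣ) : K)) (v.valuation K (e2 : K)) with h1 | h1 | h1
      · have := Valuation.map_sub_eq_of_lt_right _ h1
        rw [← hy', val_eq_val_iff] at this
        rw [this] at hodd; exact hodd e1
      · have h4 := Valuation.map_sub (v.valuation K) ((Units.mk0 a ha ^ 2 : Kˣ) : K) e2
        rw [← hy', h1, max_self, ← h1] at h4
        have := le_antisymm h4 hcon
        rw [val_eq_val_iff] at this; rw [this] at hodd; exact hodd e0
      · have := Valuation.map_sub_eq_of_lt_left _ h1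
        rw [← hy', val_eq_val_iff] at this
        rw [this] at hodd; exact hodd e0
    have := near_locSq v h2 (x := ε * (Units.mk0 b hb) ^ 2) (z := (Units.mk0 a ha) ^ 2) (by
      rw [Valuation.map_sub_swap]
      simpa [hy] using hlt)
    rw [mul_mem_locSq_comm, mul_assoc, ← mul_pow] at this
    exact hε ((Subgroup.mul_mem_cancel_right _ (sq_mem_locSq _ _)).mp this)
  · obtain ⟨u, hu, hus⟩ := exists_nonsq_unit (K := K) v h2
    refine ⟨u, ?_⟩
    rw [mem_locNorm]
    rintro ⟨y, ⟨a, b, hy⟩, z, hz, h⟩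
    have hzs := locSq_even v hz
    have hl := congrArg (lg v) h
    rw [lg_mul, hu] at hl
    have hey : Even (lg v y) := by
      have : lg v y = - lg v z := by omega
      rw [this]; exact hzs.neg
    rcases norm_odd v he (a := a) (b := b) (by rw [← hy]; exact y.ne_zero) with ⟨h0, h1⟩ | ⟨h0, h1⟩
    · have := near_locSq v h2 (x := y) (z := (Units.mk0 a h0) ^ 2) (by
        have : (y : K) - ((Units.mk0 a h0) ^ 2 : Kˣ) = - (ε * b ^ 2) := by
          simp [hy]
        rw [this, Valuation.map_neg]; simpa using h1)
      rw [mul_mem_locSq_comm] at this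
      have hys := (Subgroup.mul_mem_cancel_right _ (sq_mem_locSq _ _)).mp this
      exact hus (h ▸ Subgroup.mul_mem _ hys hz)
    · have h3 := Valuation.map_sub_eq_of_lt_right _ h1
      rw [← hy] at h3
      have : (ε : K) * b ^ 2 = ((ε * (Units.mk0 b h0) ^ 2 : Kˣ) : K) := by simp
      rw [this, val_eq_val_iff, lg_mul, lg_pow] at h3
      apply he
      rw [h3] at hey
      exact (Int.even_add.mp hey).mpr (by simp)
end
end QH

end

section
namespace QH
open IsDedekindDomain NumberField WithZero

section grp
variable {G : Type*} [CommGroup G]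

lemma index_le_of_fun {α : Type*} [Finite α] (H : Subgroup G) (f : G → α)
    (h : ∀ x y, f x = f y → x / y ∈ H) : H.index ≠ 0 ∧ H.index ≤ Nat.card α := by
  have hinj : Function.Injective (fun q : G ⧸ H => f q.out) := by
    intro a b hab
    have := h _ _ hab
    rw [← Quotient.out_eq' a, ← Quotient.out_eq' b]
    rw [eq_comm]
    refine QuotientGroup.eq.mpr ?_
    rwa [div_eq_mul_inv, mul_comm] at this
  have := Finite.of_injective _ hinj
  exact ⟨Subgroup.index_ne_zero_of_finite, Nat.card_le_card_of_injective _ hinj⟩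

lemma relIndex_le_of_fun {α : Type*} [Finite α] (H K : Subgroup G) (f : G → α)
    (h : ∀ x ∈ K, ∀ y ∈ K, f x = f y → x / y ∈ H) : H.relIndex K ≠ 0 ∧ H.relIndex K ≤ Nat.card α :=
  index_le_of_fun (H.subgroupOf K) (fun x => f x) (fun x y hxy => by
    rw [Subgroup.mem_subgroupOf]; exact h x x.2 y y.2 hxy)

lemma card_le_index {ι : Type*} [Finite ι] (H : Subgroup G) (h0 : H.index ≠ 0) (f : ι → G)
    (h : ∀ i j, f i / f j ∈ H → i = j) : Nat.card ι ≤ H.index := by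
  have : Finite (G ⧸ H) := Nat.finite_of_card_ne_zero h0
  refine Nat.card_le_card_of_injective (fun i => (f i : G ⧸ H)) ?_
  intro i j hij
  refine (h j i ?_).symm
  rw [div_eq_mul_inv, mul_comm]
  exact QuotientGroup.eq.mp hij

lemma card_le_relIndex {ι : Type*} [Finite ι] (H K : Subgroup G) (h0 : H.relIndex K ≠ 0) (f : ι → G)
    (hf : ∀ i, f i ∈ K) (h : ∀ i j, f i / f j ∈ H → i = j) : Nat.card ι ≤ H.relIndex K :=
  card_le_index (H.subgroupOf K) h0 (fun i => ⟨f i, hf i⟩) (fun i j hij => h i j (by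
    rw [Subgroup.mem_subgroupOf] at hij; exact hij))

lemma sq_index (V H : Subgroup G) (hHV : H ≤ V) (h0 : H.relIndex V ≠ 0) :
    (H ⊔ V.map (powMonoidHom 2)).relIndex V = H.relIndex (H.comap (powMonoidHom 2) ⊓ V) := by
  set s : G →* G := powMonoidHom 2
  have hsV : V.map s ≤ V := by
    rintro _ ⟨x, hx, rfl⟩; exact V.pow_mem hx 2
  have h1 : H.relIndex (H ⊔ V.map s) * (H ⊔ V.map s).relIndex V = H.relIndex V :=
    Subgroup.relIndex_mul_relIndex _ _ _ le_sup_left (sup_le hHV hsV)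
  have hHP : H ≤ H.comap s ⊓ V := le_inf (fun x hx => H.pow_mem hx 2) hHV
  have h2 : H.relIndex (H.comap s ⊓ V) * (H.comap s ⊓ V).relIndex V = H.relIndex V :=
    Subgroup.relIndex_mul_relIndex _ _ _ hHP inf_le_right
  have h3 : (H.comap s ⊓ V).relIndex V = H.relIndex (H ⊔ V.map s) := by
    rw [Subgroup.inf_relIndex_right, Subgroup.relIndex_comap, sup_comm, Subgroup.relIndex_sup_right]
  rw [h3, mul_comm, ← h1] at h2
  have : H.relIndex (H ⊔ V.map s) ≠ 0 := by
    intro h; rw [h, zero_mul] at h1; exact h0 h1.symm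
  exact (Nat.eq_of_mul_eq_mul_left (Nat.pos_of_ne_zero this) h2).symm
end grp

section
variable {R : Type*} [CommRing R] [IsDedekindDomain R] {K : Type*} [Field K] [Algebra R K] [IsFractionRing R K]
  (v : HeightOneSpectrum R)

variable (K) in
/-- higher unit groups -/
def uGrp (j : ℕ) : Subgroup Kˣ where
  carrier := {x | v.valuation K (x : K) = 1 ∧ v.valuation K ((x : K) - 1) ≤ exp (-(j : ℤ))}
  one_mem' := by simp
  mul_mem' := by
    rintro x y ⟨hx, hx'⟩ ⟨hy, hy'⟩
    refine ⟨by rw [Units.val_mul, map_mul, hx, hy, one_mul], ?_⟩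
    have : ((x * y : Kˣ) : K) - 1 = (x - 1) * y + (y - 1) := by push_cast; ring
    rw [this]
    refine (Valuation.map_add _ _ _).trans (max_le ?_ hy')
    rw [map_mul, hy, mul_one]; exact hx'
  inv_mem' := by
    rintro x ⟨hx, hx'⟩
    refine ⟨by simp [hx], ?_⟩
    have : ((x⁻¹ : Kˣ) : K) - 1 = - (x - 1) * (x : K)⁻¹ := by
      have := x.ne_zero; push_cast; field_simp; ring
    rw [this, map_mul, Valuation.map_neg, map_inv₀, hx, inv_one, mul_one]; exact hx'

lemma mem_uGrp {j : ℕ} {x : Kˣ} : x ∈ uGrp K v j ↔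
  v.valuation K (x : K) = 1 ∧ v.valuation K ((x : K) - 1) ≤ exp (-(j : ℤ)) := Iff.rfl

lemma uGrp_anti {i j : ℕ} (h : i ≤ j) : uGrp K v j ≤ uGrp K v i := by
  rintro x ⟨hx, hx'⟩
  exact ⟨hx, hx'.trans (by rw [exp_le_exp]; omega)⟩

lemma lt_exp_iff {x : K} {n : ℤ} : v.valuation K x < exp n ↔ v.valuation K x ≤ exp (n - 1) := by
  by_cases hx : x = 0
  · subst hx; simp
  have := val_eq_exp v (Units.mk0 x hx)
  rw [Units.val_mk0] at this
  rw [this, exp_lt_exp, exp_le_exp]; omega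

variable [Finite (R ⧸ v.asIdeal)]

lemma uGrp_succ (j : ℕ) : (uGrp K v (j + 1)).relIndex (uGrp K v j) ≠ 0 ∧
    (uGrp K v (j + 1)).relIndex (uGrp K v j) ≤ Nat.card (R ⧸ v.asIdeal) := by
  classical
  obtain ⟨π, hπ⟩ := exists_lg K v (-(j : ℤ))
  have vπ := val_eq_exp v π
  rw [hπ] at vπ
  have h1 : ∀ x : Kˣ, ∃ r : R, x ∈ uGrp K v j →
      v.valuation K (((x : K) - 1) / π - algebraMap R K r) < 1 := by
    intro x
    by_cases hx : x ∈ uGrp K v j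
    · obtain ⟨r, hr⟩ := exists_residue (K := K) v (x := ((x : K) - 1) / π) (by
        rw [map_div₀, vπ]
        exact (div_le_one₀ (exp_pos)).mpr hx.2)
      exact ⟨r, fun _ => hr⟩
    · exact ⟨0, fun h => absurd h hx⟩
  choose f hf using h1
  refine relIndex_le_of_fun _ _ (fun x => Ideal.Quotient.mk v.asIdeal (f x)) ?_
  intro x hx y hy hxy
  rw [Ideal.Quotient.eq, ← val_alg_lt_one (K := K)] at hxy
  have e : v.valuation K (((x : K) - y) / π) < 1 := by
    have : ((x : K) - y) / π = ((((x : K) - 1) / π - algebraMap R K (f x)) + algebraMap R K (f x - f y)) -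
      (((y : K) - 1) / π - algebraMap R K (f y)) := by rw [map_sub]; ring
    rw [this]
    exact Valuation.map_sub_lt _ (Valuation.map_add_lt _ (hf x hx) hxy) (hf y hy)
  rw [map_div₀, vπ, div_lt_one₀ exp_pos, lt_exp_iff] at e
  refine ⟨((uGrp K v j).div_mem hx hy).1, ?_⟩
  have : ((x / y : Kˣ) : K) - 1 = (x - y) / y := by
    have := y.ne_zero; push_cast; field_simp
  rw [this, map_div₀, hy.1, div_one]
  refine e.trans (le_of_eq ?_)
  push_cast; congr 1; ring

lemma uGrp_add (j i : ℕ) : (uGrp K v (j + i)).relIndex (uGrp K v j) ≠ 0 ∧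
    (uGrp K v (j + i)).relIndex (uGrp K v j) ≤ Nat.card (R ⧸ v.asIdeal) ^ i := by
  induction i with
  | zero => simp
  | succ i ih =>
    have h := Subgroup.relIndex_mul_relIndex _ _ _ (uGrp_anti (K := K) v (Nat.le_succ (j + i)))
      (uGrp_anti (K := K) v (Nat.le_add_right j i))
    have h1 := uGrp_succ (K := K) v (j + i)
    rw [← add_assoc, ← h]
    refine ⟨mul_ne_zero h1.1 ih.1, ?_⟩
    rw [pow_succ, mul_comm]
    exact Nat.mul_le_mul ih.2 h1.2

/-- L1 -/
lemma locSq_index {e : ℕ} (he : v.valuation K 2 = exp (-(e : ℤ))) :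
    (locSq (v.valuation K)).index ≠ 0 ∧
    (locSq (v.valuation K)).index ≤ 4 * Nat.card (R ⧸ v.asIdeal) ^ e := by
  set N := Nat.card (R ⧸ v.asIdeal)
  set V := uGrp K v 0
  set H := uGrp K v (2 * e + 1)
  set s : Kˣ →* Kˣ := powMonoidHom 2
  have h20 : (2 : K) ≠ 0 := by rintro h; rw [h, map_zero] at he; exact exp_ne_zero he.symm
  have he4 : v.valuation K 4 = exp (-(2 * e : ℤ)) := by rw [v_four, he, ← exp_add]; congr 1; ring
  have hHV : H ≤ V := uGrp_anti v (Nat.zero_le _)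
  have hHV0 : H.relIndex V ≠ 0 := by simpa using (uGrp_add (K := K) v 0 (2 * e + 1)).1
  -- P inside W
  set W := uGrp K v (e + 1) ⊔ Subgroup.zpowers (-1 : Kˣ)
  have hP : H.comap s ⊓ V ≤ W := by
    rintro x ⟨hx, hx'⟩
    have hx2 := hx.2
    have e1 : ((s x : Kˣ) : K) - 1 = (x - 1) * (x + 1) := by
      simp only [s, powMonoidHom_apply, Units.val_pow_eq_pow_val]; ring
    rw [e1, map_mul] at hx2
    have : v.valuation K ((x : K) - 1) < exp (-(e : ℤ)) ∨ v.valuation K ((x : K) + 1) < exp (-(e : ℤ)) := by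
      by_contra hcon
      push Not at hcon
      have := (mul_le_mul' hcon.1 hcon.2).trans hx2
      rw [← exp_add, exp_le_exp] at this; push_cast at this; omega
    rcases this with h | h
    · refine Subgroup.mem_sup_left ⟨hx'.1, ?_⟩
      rw [lt_exp_iff] at h; refine h.trans (le_of_eq ?_); push_cast; congr 1; ring
    · have h3 : -x ∈ uGrp K v (e + 1) := by
        refine ⟨by simpa [Valuation.map_neg] using hx'.1, ?_⟩
        rw [lt_exp_iff] at h
        have : ((-x : Kˣ) : K) - 1 = - (x + 1) := by push_cast; ring
        rw [this, Valuation.map_neg]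
        refine h.trans (le_of_eq ?_); push_cast; congr 1; ring
      have : x = -x * (-1) := by simp
      rw [this]
      exact Subgroup.mul_mem_sup h3 (Subgroup.mem_zpowers _)
  have hHe : H ≤ uGrp K v (e + 1) := uGrp_anti v (by omega)
  have hW : H.relIndex W ≠ 0 ∧ H.relIndex W ≤ N ^ e * 2 := by
    have h := Subgroup.relIndex_mul_relIndex H (uGrp K v (e + 1)) W hHe le_sup_left
    have h1 := uGrp_add (K := K) v (e + 1) e
    have h2 : e + 1 + e = 2 * e + 1 := by ring
    rw [h2] at h1
    have h3 : (uGrp K v (e + 1)).relIndex W ≠ 0 ∧ (uGrp K v (e + 1)).relIndex W ≤ 2 := by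
      rw [show W = Subgroup.zpowers (-1 : Kˣ) ⊔ uGrp K v (e + 1) from sup_comm _ _, Subgroup.relIndex_sup_right]
      have hc : Nat.card (Subgroup.zpowers (-1 : Kˣ)) = orderOf (-1 : Kˣ) := Nat.card_zpowers _
      have ho : orderOf (-1 : Kˣ) ∣ 2 := orderOf_dvd_of_pow_eq_one (by simp)
      have hd := Subgroup.relIndex_dvd_card (uGrp K v (e + 1)) (Subgroup.zpowers (-1 : Kˣ))
      rw [hc] at hd
      have := hd.trans ho
      exact ⟨fun h => by rw [h] at this; simp at this, Nat.le_of_dvd (by norm_num) this⟩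
    rw [← h]
    exact ⟨mul_ne_zero h1.1 h3.1, Nat.mul_le_mul h1.2 h3.2⟩
  have hsq := sq_index V H hHV hHV0
  have hPd : H.relIndex (H.comap s ⊓ V) ∣ H.relIndex W :=
    Dvd.intro _ (Subgroup.relIndex_mul_relIndex H (H.comap s ⊓ V) W
      (le_inf (fun x hx => H.pow_mem hx 2) hHV) hP)
  have hPi : H.relIndex (H.comap s ⊓ V) ≤ N ^ e * 2 :=
    (Nat.le_of_dvd (Nat.pos_of_ne_zero hW.1) hPd).trans hW.2
  have hPi0 : H.relIndex (H.comap s ⊓ V) ≠ 0 := by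
    intro h0
    rw [h0] at hPd; exact hW.1 (zero_dvd_iff.mp hPd)
  have hle : H ⊔ V.map s ≤ locSq (v.valuation K) := by
    refine sup_le ?_ ?_
    · rintro x ⟨hx, hx'⟩
      have h4 : (4 : K) ≠ 0 := by
        have : (4 : K) = 2 * 2 := by norm_num
        rw [this]; exact mul_ne_zero h20 h20
      refine ⟨1, ((x : K) - 1) / 4, ?_, by push_cast; field_simp; ring⟩
      rw [map_div₀, he4, div_lt_one₀ exp_pos]
      refine lt_of_le_of_lt hx' ?_
      rw [exp_lt_exp]; push_cast; omega
    · rintro _ ⟨x, hx, rfl⟩; exact sq_mem_locSq _ x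
  have hlV : (locSq (v.valuation K)).relIndex V ∣ H.relIndex (H.comap s ⊓ V) := by
    rw [← hsq]
    exact Subgroup.relIndex_dvd_of_le_left V hle
  have hlV0 : (locSq (v.valuation K)).relIndex V ≠ 0 := fun h => hPi0 (zero_dvd_iff.mp (h ▸ hlV))
  have hlV' : (locSq (v.valuation K)).relIndex V ≤ N ^ e * 2 :=
    (Nat.le_of_dvd (Nat.pos_of_ne_zero hPi0) hlV).trans hPi
  have hG : (V ⊔ locSq (v.valuation K)).index ≠ 0 ∧ (V ⊔ locSq (v.valuation K)).index ≤ 2 := by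
    have := index_le_of_fun (V ⊔ locSq (v.valuation K)) (fun x => (decide (Even (lg v x)) : Bool)) (by
      intro x y hxy
      have hev : Even (lg v (x / y)) := by
        rw [lg_div, Int.even_sub]; simpa using hxy
      obtain ⟨a, b, hab, ha⟩ := even_normalize v hev
      rw [hab]
      refine Subgroup.mul_mem_sup ?_ (sq_mem_locSq _ b)
      have va := (val_eq_one_iff v a).mpr ha
      refine ⟨va, ?_⟩
      simp only [Nat.cast_zero, neg_zero, exp_zero]
      exact (Valuation.map_sub _ _ _).trans (by simp [va]))
    simpa using this
  have hfin := Subgroup.relIndex_mul_index (H := locSq (v.valuation K)) (K := V ⊔ locSq (v.valuation K)) le_sup_right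
  rw [Subgroup.relIndex_sup_right] at hfin
  rw [← hfin]
  refine ⟨mul_ne_zero hlV0 hG.1, ?_⟩
  calc _ ≤ (N ^ e * 2) * 2 := Nat.mul_le_mul hlV' hG.2
    _ = 4 * N ^ e := by ring
end
end QH

end

section
namespace QH
open IsDedekindDomain NumberField WithZero

section
variable (A : Type*) [AddCommGroup A] [Module.Finite ℤ A]

lemma card_two_torsion_formula :
    (nsmulAddMonoidHom (α := A) 2).range.index = 2 ^ Module.finrank ℤ A * Nat.card (nsmulAddMonoidHom (α := A) 2).ker := by
  set d := nsmulAddMonoidHom (α := A) 2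
  set T : Submodule ℤ A := Submodule.torsion ℤ A
  set T' : AddSubgroup A := T.toAddSubgroup
  have hTmem : ∀ x : A, 2 • x ∈ T' → x ∈ T' := by
    intro x hx
    obtain ⟨n, hn⟩ := (Submodule.mem_torsion_iff _).mp hx
    refine (Submodule.mem_torsion_iff _).mpr ⟨n * ⟨2, by simp⟩, ?_⟩
    rw [mul_smul]
    rw [← hn]
    congr 1
    change (2 : ℤ) • x = 2 • x
    exact ofNat_zsmul x 2
  have hTfin : Finite T := Module.finite_of_fg_torsion _ (Submodule.torsion_isTorsion)
  have hTfin' : Finite T' := hTfin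
  have : Module.Free ℤ (A ⧸ T) := inferInstance
  have h1 : (d.range ⊔ T').index = 2 ^ Module.finrank ℤ A := by
    have h := AddSubgroup.index_range_nsmul (A ⧸ T) 2
    have h0 : Module.finrank ℤ T = 0 := Module.finrank_eq_zero_iff_isTorsion.mpr Submodule.torsion_isTorsion
    have h00 := Submodule.finrank_quotient_add_finrank T
    rw [h0, add_zero] at h00
    rw [h00] at h
    rw [← h]
    set q : A →+ A ⧸ T := (T.mkQ).toAddMonoidHom
    have hq : Function.Surjective q := T.mkQ_surjective
    rw [← AddSubgroup.index_comap_of_surjective _ hq]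
    congr 1
    ext x
    rw [AddSubgroup.mem_sup, AddSubgroup.mem_comap]
    constructor
    · rintro ⟨_, ⟨y, rfl⟩, z, hz, rfl⟩
      refine ⟨q y, ?_⟩
      have : q z = 0 := (Submodule.Quotient.mk_eq_zero T).mpr hz
      simp [d, this]
    · rintro ⟨y, hy⟩
      obtain ⟨y, rfl⟩ := hq y
      refine ⟨d y, ⟨y, rfl⟩, x - d y, ?_, by simp⟩
      have : q (x - d y) = 0 := by rw [map_sub, ← hy]; simp [d]
      exact (Submodule.Quotient.mk_eq_zero T).mp this
  have h2 : d.range.relIndex T' = Nat.card d.ker := by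
    have e1 : d.range.relIndex T' = (T'.map d).relIndex T' := by
      rw [← AddSubgroup.inf_relIndex_right, ← AddSubgroup.inf_relIndex_right (T'.map d)]
      congr 1
      ext x
      simp only [AddSubgroup.mem_inf]
      constructor
      · rintro ⟨⟨y, rfl⟩, hx⟩; exact ⟨⟨y, hTmem y hx, rfl⟩, hx⟩
      · rintro ⟨⟨y, _, rfl⟩, hx⟩; exact ⟨⟨y, rfl⟩, hx⟩
    have hle : T'.map d ≤ T' := by
      rintro _ ⟨y, hy, rfl⟩; exact T'.nsmul_mem hy 2
    have hk : d.ker ≤ T' := by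
      intro x hx; exact hTmem x (by rw [AddMonoidHom.mem_ker] at hx; change d x ∈ T'; rw [hx]; exact T'.zero_mem)
    have e2 : Nat.card (T'.map d) * (T'.map d).relIndex T' = Nat.card T' := by
      have := AddSubgroup.relIndex_mul_relIndex ⊥ (T'.map d) T' bot_le hle
      rwa [AddSubgroup.relIndex_bot_left, AddSubgroup.relIndex_bot_left] at this
    have e3 : Nat.card (T'.map d) * Nat.card d.ker = Nat.card T' := by
      have := AddSubgroup.relIndex_mul_relIndex ⊥ d.ker T' bot_le hk
      rw [AddSubgroup.relIndex_bot_left, AddSubgroup.relIndex_bot_left, AddSubgroup.relIndex_ker] at this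
      rw [mul_comm]; exact this
    have hpos : 0 < Nat.card (T'.map d) := by
      have : Finite (T'.map d) := 
        Set.Finite.to_subtype (Set.Finite.image d (Set.toFinite (T' : Set A)))
      exact Nat.card_pos
    rw [e1]
    exact Nat.eq_of_mul_eq_mul_left hpos (e2.trans e3.symm)
  have h3 := AddSubgroup.relIndex_mul_index (H := d.range) (K := d.range ⊔ T') le_sup_left
  rw [sup_comm, AddSubgroup.relIndex_sup_right, sup_comm, h1, h2] at h3
  rw [← h3, mul_comm]
end

/-- rank of a finitely generated subgroup -/
def HasRk {G : Type*} [CommGroup G] (H : Subgroup G) (n : ℕ) : Prop :=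
  Module.Finite ℤ (Additive H) ∧ Module.finrank ℤ (Additive H) = n

section
variable {G : Type*} [CommGroup G]

lemma HasRk.step {H H' : Subgroup G} {n : ℕ} (h : HasRk H n) (φ : G →* Multiplicative ℤ)
    (hH : H = H' ⊓ φ.ker) (hx : ∃ x ∈ H', φ x ≠ 1) : HasRk H' (n + 1) := by
  obtain ⟨hf, hn⟩ := h
  set f : Additive H' →ₗ[ℤ] ℤ := (MonoidHom.toAdditiveRight (φ.comp H'.subtype)).toIntLinearMap
  have hfa : ∀ x : H', f (Additive.ofMul x) = Multiplicative.toAdd (φ x) := fun x => rfl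
  have hm : ∀ x : Additive H, ((Additive.toMul x : H) : G) ∈ H' ⊓ φ.ker := fun x => hH.le (Additive.toMul x).2
  have e : Additive H ≃+ LinearMap.ker f :=
    { toFun := fun x => ⟨Additive.ofMul ⟨((Additive.toMul x : H) : G), (hm x).1⟩, by
        rw [LinearMap.mem_ker, hfa]
        have h2 : φ ((Additive.toMul x : H) : G) = 1 := (hm x).2
        simp [h2]⟩
      invFun := fun y => Additive.ofMul ⟨((Additive.toMul y.1 : H') : G), by
        rw [hH]; refine ⟨(Additive.toMul y.1).2, ?_⟩
        have := y.2
        rw [LinearMap.mem_ker] at this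
        have h3 := hfa (Additive.toMul y.1)
        rw [ofMul_toMul, this] at h3
        exact (toAdd_eq_zero.mp h3.symm)⟩
      left_inv := fun x => rfl
      right_inv := fun x => rfl
      map_add' := fun x y => rfl }
  have e' : Additive H ≃ₗ[ℤ] LinearMap.ker f := e.toIntLinearEquiv
  have hkf : Module.Finite ℤ (LinearMap.ker f) := Module.Finite.equiv e'
  have hqf : Module.Finite ℤ (Additive H' ⧸ LinearMap.ker f) :=
    Module.Finite.equiv (f.quotKerEquivRange).symm
  have hfin : Module.Finite ℤ (Additive H') := Module.Finite.of_submodule_quotient (LinearMap.ker f)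
  refine ⟨hfin, ?_⟩
  rw [← Submodule.finrank_quotient_add_finrank (LinearMap.ker f), ← e'.finrank_eq, hn,
    (f.quotKerEquivRange).finrank_eq, add_comm]
  congr 1
  have hle : Module.finrank ℤ (LinearMap.range f) ≤ 1 := by
    have := Submodule.finrank_le (LinearMap.range f)
    simpa using this
  have hge : Module.finrank ℤ (LinearMap.range f) ≠ 0 := by
    intro h0
    rw [Submodule.finrank_eq_zero] at h0
    obtain ⟨x, hx, hne⟩ := hx
    have : f (Additive.ofMul ⟨x, hx⟩) ∈ LinearMap.range f := ⟨_, rfl⟩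
    rw [h0, Submodule.mem_bot, hfa] at this
    exact hne (toAdd_eq_zero.mp this)
  omega
end

section
variable {K : Type*} [Field K] [CharZero K]

lemma HasRk.sq_index {H : Subgroup Kˣ} {n : ℕ} (h : HasRk H n) (h1 : (-1 : Kˣ) ∈ H) :
    (H.map (powMonoidHom 2)).relIndex H = 2 ^ (n + 1) := by
  obtain ⟨hf, hn⟩ := h
  have key := card_two_torsion_formula (Additive H)
  rw [hn] at key
  have e1 : (nsmulAddMonoidHom (α := Additive H) 2).range.index = (H.map (powMonoidHom 2)).relIndex H := by
    rw [Subgroup.relIndex]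
    have : (nsmulAddMonoidHom (α := Additive H) 2).range =
        Subgroup.toAddSubgroup ((H.map (powMonoidHom 2)).subgroupOf H) := by
      ext x
      constructor
      · rintro ⟨y, rfl⟩
        exact ⟨(Additive.toMul y : H), (Additive.toMul y).2, rfl⟩
      · rintro ⟨y, hy, hxy⟩
        refine ⟨Additive.ofMul ⟨y, hy⟩, ?_⟩
        apply Additive.toMul.injective
        apply Subtype.ext
        exact hxy
    rw [this]; exact Subgroup.index_toAddSubgroup
  have e2 : Nat.card (nsmulAddMonoidHom (α := Additive H) 2).ker = 2 := by
    rw [← Nat.card_congr (α := ({1, -1} : Set Kˣ)) (β := (nsmulAddMonoidHom (α := Additive H) 2).ker)]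
    · rw [Nat.card_coe_set_eq, Set.ncard_pair]
      intro h
      have := congrArg (Units.val) h
      simp only [Units.val_one, Units.val_neg] at this
      have h2 : (2 : K) = 0 := by linear_combination this
      norm_num at h2
    · refine ⟨fun x => ⟨Additive.ofMul ⟨x.1, ?_⟩, ?_⟩, fun y => ⟨(Additive.toMul y.1 : H), ?_⟩, ?_, ?_⟩
      · rcases x.2 with h | h
        · rw [h]; exact H.one_mem
        · rw [h]; exact h1
      · rw [AddMonoidHom.mem_ker]
        apply Additive.toMul.injective
        apply Subtype.ext
        change (x.1) ^ 2 = 1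
        rcases x.2 with h | h <;> rw [h] <;> simp
      · have := y.2
        rw [AddMonoidHom.mem_ker] at this
        have h3 : ((Additive.toMul y.1 : H) : Kˣ) ^ 2 = 1 :=
          congrArg (fun z : Additive H => ((Additive.toMul z : H) : Kˣ)) this
        have h4 : (((Additive.toMul y.1 : H) : Kˣ) : K) ^ 2 = 1 := by
          rw [← Units.val_pow_eq_pow_val, h3, Units.val_one]
        rw [sq] at h4
        rcases mul_self_eq_one_iff.mp h4 with h | h
        · left; ext; simpa using h
        · right; ext; simpa using h
      · intro x; rfl
      · intro x; rfl
  rw [← e1, key, e2, pow_succ]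
end
end QH

end

section
namespace QH
open IsDedekindDomain NumberField WithZero

section
variable {R : Type*} [CommRing R] [IsDedekindDomain R] (K : Type*) [Field K] [Algebra R K] [IsFractionRing R K]

/-- `S`-units -/
def SU (S : Finset (HeightOneSpectrum R)) : Subgroup Kˣ where
  carrier := {x | ∀ v ∉ S, lg v x = 0}
  one_mem' := fun v _ => lg_one v
  mul_mem' := fun {a b} ha hb v hv => by rw [lg_mul, ha v hv, hb v hv]; rfl
  inv_mem' := fun {a} ha v hv => by rw [lg_inv, ha v hv]; rfl

variable {K}
lemma mem_SU {S : Finset (HeightOneSpectrum R)} {x : Kˣ} : x ∈ SU K S ↔ ∀ v ∉ S, lg v x = 0 := Iff.rfl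

lemma SU_mono {S S' : Finset (HeightOneSpectrum R)} (h : S ⊆ S') : SU K S ≤ SU K S' :=
  fun _ hx v hv => hx v (fun h' => hv (h h'))

lemma neg_one_mem_SU (S : Finset (HeightOneSpectrum R)) : (-1 : Kˣ) ∈ SU K S := by
  intro v _
  rw [← val_eq_one_iff]; simp

lemma finite_lg_ne (x : Kˣ) : {v : HeightOneSpectrum R | lg v x ≠ 0}.Finite := by
  refine ((HeightOneSpectrum.Support.finite R (x : K)).union
    (HeightOneSpectrum.Support.finite R (x⁻¹ : K))).subset ?_
  intro v hv
  simp only [Set.mem_ofPred_eq] at hv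
  rcases lt_or_gt_of_ne hv with h | h
  · right
    change 1 < v.valuation K ((x : K)⁻¹)
    rw [← Units.val_inv_eq_inv_val, val_eq_exp, lg_inv, ← exp_zero, exp_lt_exp]; omega
  · left
    change 1 < v.valuation K (x : K)
    rw [val_eq_exp, ← exp_zero, exp_lt_exp]; omega

lemma exists_SU (x : Kˣ) : ∃ S : Finset (HeightOneSpectrum R), x ∈ SU K S :=
  ⟨(finite_lg_ne x).toFinset, fun v hv => by simpa using hv⟩

lemma lg_alg_le (v : HeightOneSpectrum R) (g : R) (hg : algebraMap R K g ≠ 0) (n : ℕ) :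
    lg v (Units.mk0 _ hg) ≤ -n ↔ g ∈ v.asIdeal ^ n := by
  rw [← HeightOneSpectrum.intValuation_le_pow_iff_mem, ← HeightOneSpectrum.valuation_of_algebraMap (K := K)]
  change _ ↔ v.valuation K ((Units.mk0 _ hg : Kˣ) : K) ≤ _
  rw [val_eq_exp, exp_le_exp]

variable (K) in
/-- class group generated by S -/
def ClS (S : Finset (HeightOneSpectrum R)) : Prop :=
  ∀ v ∉ S, ∃ x : Kˣ, lg v x = -1 ∧ ∀ w ∉ S, w ≠ v → lg w x = 0

lemma ClS.mono {S S' : Finset (HeightOneSpectrum R)} (h : ClS K S) (hS : S ⊆ S') : ClS K S' := by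
  intro v hv
  obtain ⟨x, h1, h2⟩ := h v (fun h' => hv (hS h'))
  exact ⟨x, h1, fun w hw => h2 w (fun h' => hw (hS h'))⟩

variable [Finite (ClassGroup R)]

lemma exists_ClS (S : Finset (HeightOneSpectrum R)) : ∃ S', S ⊆ S' ∧ ClS K S' := by
  classical
  have hc : ∀ c : ClassGroup R, ∃ I : nonZeroDivisors (Ideal R), ClassGroup.mk0 I = c := fun c =>
    ClassGroup.mk0_surjective c
  choose I hI using hc
  have hI0 : ∀ c, (I c : Ideal R) ≠ 0 := fun c => nonZeroDivisors.coe_ne_zero _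
  have hfin : (⋃ c, {v : HeightOneSpectrum R | v.asIdeal ∣ (I c : Ideal R)}).Finite :=
    Set.finite_iUnion fun c => Ideal.finite_factors (hI0 c)
  refine ⟨S ∪ hfin.toFinset, Finset.subset_union_left, ?_⟩
  intro v hv
  have hdv : ∀ w ∉ S ∪ hfin.toFinset, ∀ c, ¬ w.asIdeal ∣ (I c : Ideal R) := by
    intro w hw c hd
    apply hw
    rw [Finset.mem_union]; right
    rw [Set.Finite.mem_toFinset]
    exact Set.mem_iUnion.mpr ⟨c, hd⟩
  have hv0 : v.asIdeal ∈ nonZeroDivisors (Ideal R) := mem_nonZeroDivisors_of_ne_zero v.ne_bot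
  set c := (ClassGroup.mk0 ⟨v.asIdeal, hv0⟩)⁻¹
  have hp : ClassGroup.mk0 (⟨v.asIdeal, hv0⟩ * I c) = 1 := by
    rw [map_mul, hI c]; simp [c]
  have hpr := (ClassGroup.mk0_eq_one_iff (I := v.asIdeal * (I c : Ideal R)) (mul_mem hv0 (I c).2)).mp hp
  obtain ⟨g, hg⟩ := hpr
  have hg' : v.asIdeal * (I c : Ideal R) = Ideal.span {g} := hg
  have hg0 : algebraMap R K g ≠ 0 := by
    intro h
    have : g = 0 := (FaithfulSMul.algebraMap_injective R K) (by rw [h, map_zero])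
    rw [this] at hg'
    simp only [Ideal.span_singleton_zero] at hg'
    exact mul_ne_zero v.ne_bot (hI0 c) hg'
  have hmem : ∀ J : Ideal R, g ∈ J ↔ J ∣ v.asIdeal * (I c : Ideal R) := by
    intro J
    rw [hg', Ideal.dvd_span_singleton]
  refine ⟨Units.mk0 _ hg0, ?_, ?_⟩
  · have h1 := (lg_alg_le v g hg0 1).mpr (by rw [hmem, pow_one]; exact dvd_mul_right _ _)
    have h2 : ¬ lg v (Units.mk0 _ hg0) ≤ -(2 : ℕ) := by
      rw [lg_alg_le, hmem, sq]
      intro h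
      exact hdv v hv c ((mul_dvd_mul_iff_left v.ne_bot).mp h)
    push_cast at h1 h2
    omega
  · intro w hw hwv
    have h1 := (lg_alg_le w g hg0 0).mpr (by simp)
    have h2 : ¬ lg w (Units.mk0 _ hg0) ≤ -(1 : ℕ) := by
      rw [lg_alg_le, hmem, pow_one]
      intro h
      rcases (w.prime).dvd_or_dvd h with h | h
      · apply hwv
        have := (v.isMaximal).eq_of_le (w.isPrime.ne_top) (Ideal.dvd_iff_le.mp h)
        exact (HeightOneSpectrum.ext this).symm
      · exact hdv w hw c h
    push_cast at h1 h2
    omega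

lemma exists_prime_unit (v : HeightOneSpectrum R) : ∃ x : Kˣ, lg v x ≠ 0 ∧ ∀ w, w ≠ v → lg w x = 0 := by
  have hv0 : v.asIdeal ∈ nonZeroDivisors (Ideal R) := mem_nonZeroDivisors_of_ne_zero v.ne_bot
  set h := Nat.card (ClassGroup R)
  have hh : h ≠ 0 := Nat.card_pos.ne'
  have hp : ClassGroup.mk0 ((⟨v.asIdeal, hv0⟩ : nonZeroDivisors (Ideal R)) ^ h) = 1 := by
    rw [map_pow]; exact pow_card_eq_one'
  obtain ⟨g, hg⟩ := (ClassGroup.mk0_eq_one_iff (I := v.asIdeal ^ h) (pow_mem hv0 h)).mp hp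
  have hg' : v.asIdeal ^ h = Ideal.span {g} := hg
  have hg0 : algebraMap R K g ≠ 0 := by
    intro h
    have : g = 0 := (FaithfulSMul.algebraMap_injective R K) (by rw [h, map_zero])
    rw [this] at hg'
    simp only [Ideal.span_singleton_zero] at hg'
    exact pow_ne_zero _ v.ne_bot hg'
  have hmem : ∀ J : Ideal R, g ∈ J ↔ J ∣ v.asIdeal ^ h := by
    intro J
    rw [hg', Ideal.dvd_span_singleton]
  refine ⟨Units.mk0 _ hg0, ?_, ?_⟩
  · have h1 := (lg_alg_le v g hg0 1).mpr (by rw [hmem, pow_one]; exact dvd_pow_self _ hh)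
    push_cast at h1; omega
  · intro w hwv
    have h1 := (lg_alg_le w g hg0 0).mpr (by simp)
    have h2 : ¬ lg w (Units.mk0 _ hg0) ≤ -(1 : ℕ) := by
      rw [lg_alg_le, hmem, pow_one]
      intro h
      have h := (w.prime).dvd_of_dvd_pow h
      apply hwv
      have := (v.isMaximal).eq_of_le (w.isPrime.ne_top) (Ideal.dvd_iff_le.mp h)
      exact (HeightOneSpectrum.ext this).symm
    push_cast at h1 h2
    omega
end

section
variable (K : Type*) [Field K] [NumberField K]

lemma SU_empty : HasRk (SU (R := 𝓞 K) K ∅) (Units.rank K) := by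
  have e : Additive (𝓞 K)ˣ ≃+ Additive (SU (R := 𝓞 K) K ∅) := by
    refine MulEquiv.toAdditive (?_ : (𝓞 K)ˣ ≃* SU (R := 𝓞 K) K ∅)
    let f : (𝓞 K)ˣ →* Kˣ := Units.map (algebraMap (𝓞 K) K).toMonoidHom
    have hf : Function.Injective f := Units.map_injective (FaithfulSMul.algebraMap_injective (𝓞 K) K)
    have hr : f.range = SU (R := 𝓞 K) K ∅ := by
      ext x
      constructor
      · rintro ⟨y, rfl⟩ v _
        have h1 : v.valuation K (algebraMap (𝓞 K) K (y : 𝓞 K)) ≤ 1 := v.valuation_le_one _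
        have h2 : v.valuation K (algebraMap (𝓞 K) K ((y⁻¹ : (𝓞 K)ˣ) : 𝓞 K)) ≤ 1 := v.valuation_le_one _
        have e1 : algebraMap (𝓞 K) K (y : 𝓞 K) = (f y : K) := rfl
        have e2 : algebraMap (𝓞 K) K ((y⁻¹ : (𝓞 K)ˣ) : 𝓞 K) = (((f y)⁻¹ : Kˣ) : K) := by
          rw [← map_inv]; rfl
        rw [e1, val_eq_exp, ← exp_zero, exp_le_exp] at h1
        rw [e2, val_eq_exp, ← exp_zero, exp_le_exp, lg_inv] at h2
        omega
      · intro hx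
        have h1 : ∀ v : HeightOneSpectrum (𝓞 K), v.valuation K (x : K) = 1 := fun v =>
          (val_eq_one_iff v x).mpr (hx v (by simp))
        obtain ⟨a, ha⟩ := HeightOneSpectrum.mem_integers_of_valuation_le_one K (x : K) (fun v => (h1 v).le)
        obtain ⟨b, hb⟩ := HeightOneSpectrum.mem_integers_of_valuation_le_one K ((x : K)⁻¹) (fun v => by
          rw [map_inv₀, h1 v, inv_one])
        have hab : a * b = 1 := FaithfulSMul.algebraMap_injective (𝓞 K) K (by
          rw [map_mul, ha, hb, map_one, mul_inv_cancel₀ x.ne_zero])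
        exact ⟨⟨a, b, hab, by rw [mul_comm, hab]⟩, Units.ext ha⟩
    exact (MonoidHom.ofInjective hf).trans (MulEquiv.subgroupCongr hr)
  have e' : Additive (𝓞 K)ˣ ≃ₗ[ℤ] Additive (SU (R := 𝓞 K) K ∅) := e.toIntLinearEquiv
  exact ⟨Module.Finite.equiv e', by rw [← e'.finrank_eq, Units.finrank_eq]⟩

lemma SU_rk (S : Finset (HeightOneSpectrum (𝓞 K))) : HasRk (SU K S) (Units.rank K + S.card) := by
  classical
  induction S using Finset.induction_on with
  | empty => exact SU_empty K
  | insert v S hv ih =>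
    rw [Finset.card_insert_of_notMem hv, ← add_assoc]
    refine ih.step (ordv v) ?_ ?_
    · ext x
      constructor
      · intro hx
        exact ⟨SU_mono (Finset.subset_insert _ _) hx, (congrArg Multiplicative.ofAdd (hx v hv) : _)⟩
      · rintro ⟨hx, hx'⟩ w hw
        by_cases hwv : w = v
        · subst hwv
          exact congrArg Multiplicative.toAdd hx'
        · exact hx w (by simp [hwv, hw])
    · obtain ⟨x, h1, h2⟩ := exists_prime_unit (K := K) v
      refine ⟨x, fun w hw => h2 w (fun h => hw (by simp [h])), fun h => h1 ?_⟩
      exact congrArg Multiplicative.toAdd h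

lemma SU_sq (S : Finset (HeightOneSpectrum (𝓞 K))) :
    ((SU K S).map (powMonoidHom 2)).relIndex (SU K S) = 2 ^ (Units.rank K + S.card + 1) :=
  (SU_rk K S).sq_index (neg_one_mem_SU S)
end
end QH

end

section
namespace QH
open IsDedekindDomain NumberField WithZero

section
variable {G : Type*} [CommGroup G]

lemma HasRk.sq_index' {H : Subgroup G} {n : ℕ} (h : HasRk H n) :
    (H.map (powMonoidHom 2)).relIndex H = 2 ^ n * Nat.card (H ⊓ (powMonoidHom (α := G) 2).ker : Subgroup G) := by
  obtain ⟨hf, hn⟩ := h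
  have key := card_two_torsion_formula (Additive H)
  rw [hn] at key
  have e1 : (nsmulAddMonoidHom (α := Additive H) 2).range.index = (H.map (powMonoidHom 2)).relIndex H := by
    rw [Subgroup.relIndex]
    have : (nsmulAddMonoidHom (α := Additive H) 2).range =
        Subgroup.toAddSubgroup ((H.map (powMonoidHom 2)).subgroupOf H) := by
      ext x
      constructor
      · rintro ⟨y, rfl⟩
        exact ⟨(Additive.toMul y : H), (Additive.toMul y).2, rfl⟩
      · rintro ⟨y, hy, hxy⟩
        refine ⟨Additive.ofMul ⟨y, hy⟩, ?_⟩
        apply Additive.toMul.injective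
        apply Subtype.ext
        exact hxy
    rw [this]; exact Subgroup.index_toAddSubgroup
  have e2 : Nat.card (nsmulAddMonoidHom (α := Additive H) 2).ker =
      Nat.card (H ⊓ (powMonoidHom (α := G) 2).ker : Subgroup G) := by
    refine Nat.card_congr ⟨fun y => ⟨((Additive.toMul y.1 : H) : G), (Additive.toMul y.1).2, ?_⟩,
      fun x => ⟨Additive.ofMul ⟨x.1, x.2.1⟩, ?_⟩, fun x => rfl, fun x => rfl⟩
    · have := y.2
      rw [AddMonoidHom.mem_ker] at this
      exact congrArg (fun z : Additive H => ((Additive.toMul z : H) : G)) this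
    · rw [AddMonoidHom.mem_ker]
      apply Additive.toMul.injective
      apply Subtype.ext
      exact x.2.2
  rw [← e1, key, e2]

lemma HasRk.tors_ne {H : Subgroup G} {n : ℕ} (h : HasRk H n) :
    Nat.card (H ⊓ (powMonoidHom (α := G) 2).ker : Subgroup G) ≠ 0 := by
  have hf := h.1
  have hfin : Finite (Submodule.torsion ℤ (Additive H)) := Module.finite_of_fg_torsion _ (Submodule.torsion_isTorsion)
  have : Finite (H ⊓ (powMonoidHom (α := G) 2).ker : Subgroup G) := by
    refine Finite.of_injective (β := Submodule.torsion ℤ (Additive H)) (fun x => ⟨Additive.ofMul ⟨x.1, x.2.1⟩, ?_⟩) ?_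
    · refine (Submodule.mem_torsion_iff _).mpr ⟨⟨2, by simp⟩, ?_⟩
      change (2 : ℤ) • (Additive.ofMul (⟨x.1, x.2.1⟩ : H)) = 0
      rw [ofNat_zsmul]
      apply Additive.toMul.injective
      apply Subtype.ext
      exact x.2.2
    · intro x y hxy
      apply Subtype.ext
      exact congrArg (fun z : Submodule.torsion ℤ (Additive H) => ((Additive.toMul z.1 : H) : G)) hxy
  exact Nat.card_pos.ne'

theorem herbrand [Module.Finite ℤ (Additive G)] {σ : G →* G} (hσ : ∀ x, σ (σ x) = x) {P Mn : Subgroup G}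
    (hP : ∀ x, x ∈ P ↔ σ x = x) (hM : ∀ x, x ∈ Mn ↔ x * σ x = 1) {p m : ℕ} (hp : HasRk P p)
    (hm : Module.finrank ℤ (Additive G) = m) {N D : G →* G} (hN : ∀ x, N x = x * σ x)
    (hD : ∀ x, D x = x / σ x) :
    N.range.relIndex P * 2 ^ m = D.range.relIndex Mn * 2 ^ (2 * p) ∧ N.range.relIndex P ≠ 0 := by
  have hNP : N.range ≤ P := by
    rintro _ ⟨x, rfl⟩
    rw [hP, hN, map_mul, hσ, mul_comm]
  have hDM : D.range ≤ Mn := by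
    rintro _ ⟨x, rfl⟩
    rw [hM, hD, map_div, hσ]; simp
  have hkN : N.ker = Mn := by
    ext x; rw [MonoidHom.mem_ker, hM, hN]
  have hkD : D.ker = P := by
    ext x; rw [MonoidHom.mem_ker, hP, hD, div_eq_one, eq_comm]
  -- rank of Mn
  obtain ⟨q, hq, hqp⟩ : ∃ q, HasRk Mn q ∧ q + p = m := by
    have hpf := hp.1
    let f : Additive G →ₗ[ℤ] Additive P :=
      (MonoidHom.toAdditive (N.codRestrict P (fun x => hNP ⟨x, rfl⟩))).toIntLinearMap
    have hfa : ∀ x : G, ((Additive.toMul (f (Additive.ofMul x)) : P) : G) = N x := fun x => rfl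
    have hker : ∀ x : G, Additive.ofMul x ∈ LinearMap.ker f ↔ x ∈ Mn := by
      intro x
      rw [LinearMap.mem_ker, ← hkN, MonoidHom.mem_ker, ← hfa]
      constructor
      · intro h; rw [h]; rfl
      · intro h; apply Additive.toMul.injective; apply Subtype.ext; exact h
    let e : LinearMap.ker f ≃+ Additive Mn :=
      { toFun := fun x => Additive.ofMul ⟨Additive.toMul x.1, (hker _).mp x.2⟩
        invFun := fun y => ⟨Additive.ofMul ((Additive.toMul y : Mn) : G), (hker _).mpr (Additive.toMul y).2⟩
        left_inv := fun x => rfl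
        right_inv := fun x => rfl
        map_add' := fun x y => rfl }
    let e' : LinearMap.ker f ≃ₗ[ℤ] Additive Mn := e.toIntLinearEquiv
    have hkf : Module.Finite ℤ (LinearMap.ker f) := inferInstance
    refine ⟨Module.finrank ℤ (LinearMap.ker f), ⟨Module.Finite.equiv e', e'.finrank_eq.symm⟩, ?_⟩
    have h1 := Submodule.finrank_quotient_add_finrank (LinearMap.ker f)
    rw [(f.quotKerEquivRange).finrank_eq, hm] at h1
    have hle : Module.finrank ℤ (LinearMap.range f) ≤ p := by
      have := Submodule.finrank_le (LinearMap.range f)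
      rwa [hp.2] at this
    let g : Additive P →ₗ[ℤ] Additive P := (2 : ℤ) • LinearMap.id
    have hg : LinearMap.range g ≤ LinearMap.range f := by
      rintro _ ⟨x, rfl⟩
      refine ⟨Additive.ofMul ((Additive.toMul x : P) : G), ?_⟩
      apply Additive.toMul.injective
      apply Subtype.ext
      rw [hfa, hN, (hP _).mp (Additive.toMul x).2]
      have : g x = x + x := two_zsmul x
      rw [this]; rfl
    have h2 := Submodule.finrank_quotient_add_finrank (LinearMap.ker g)
    rw [(g.quotKerEquivRange).finrank_eq, hp.2] at h2
    have h3 : Module.finrank ℤ (LinearMap.ker g) = 0 := by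
      refine Module.finrank_eq_zero_iff_isTorsion.mpr ?_
      intro x
      refine ⟨⟨2, by simp⟩, ?_⟩
      apply Subtype.ext
      have := x.2
      rw [LinearMap.mem_ker] at this
      exact this
    have h4 := Submodule.finrank_mono hg
    omega
  have key : ∀ (f : G →* G) (X Y : Subgroup G), f.ker = Y → (∀ x ∈ X, f x = x ^ 2) →
      (X.map (powMonoidHom 2)).relIndex f.range = (X ⊔ Y).index := by
    intro f X Y hY hX
    have : X.map (powMonoidHom 2) = X.map f := by
      ext y; constructor
      · rintro ⟨x, hx, rfl⟩; exact ⟨x, hx, hX x hx⟩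
      · rintro ⟨x, hx, rfl⟩; exact ⟨x, hx, (hX x hx).symm⟩
    rw [this, ← hY, MonoidHom.range_eq_map, Subgroup.relIndex_map_map, top_sup_eq, Subgroup.relIndex_top_right]
  have k1 := key N P Mn hkN (fun x hx => by rw [hN, (hP x).mp hx, sq])
  have k2 := key D Mn P hkD (fun x hx => by
    rw [hD, eq_inv_of_mul_eq_one_right ((hM x).mp hx), div_inv_eq_mul, sq])
  have r1 := Subgroup.relIndex_mul_relIndex (P.map (powMonoidHom 2)) N.range P (by
    rintro _ ⟨x, hx, rfl⟩; exact ⟨x, by rw [hN, (hP x).mp hx, powMonoidHom_apply, sq]⟩) hNP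
  have r2 := Subgroup.relIndex_mul_relIndex (Mn.map (powMonoidHom 2)) D.range Mn (by
    rintro _ ⟨x, hx, rfl⟩; exact ⟨x, by
      rw [hD, eq_inv_of_mul_eq_one_right ((hM x).mp hx), div_inv_eq_mul, powMonoidHom_apply, sq]⟩) hDM
  have ht : P ⊓ (powMonoidHom (α := G) 2).ker = Mn ⊓ (powMonoidHom (α := G) 2).ker := by
    ext x
    simp only [Subgroup.mem_inf, MonoidHom.mem_ker, powMonoidHom_apply, hP, hM]
    refine and_congr_left fun h => ?_
    have hx : x⁻¹ = x := by rw [inv_eq_iff_mul_eq_one, ← sq, h]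
    rw [mul_eq_one_iff_inv_eq, hx, eq_comm]
  rw [k1, hp.sq_index'] at r1
  rw [k2, hq.sq_index', sup_comm, ← ht] at r2
  have hc := hp.tors_ne
  set c := Nat.card (P ⊓ (powMonoidHom (α := G) 2).ker : Subgroup G)
  set I := (P ⊔ Mn).index
  have hI : I * N.range.relIndex P ≠ 0 := by rw [r1]; positivity
  have hI0 : I ≠ 0 := left_ne_zero_of_mul hI
  refine ⟨?_, right_ne_zero_of_mul hI⟩
  apply Nat.eq_of_mul_eq_mul_left (Nat.pos_of_ne_zero hI0)
  apply Nat.eq_of_mul_eq_mul_left (Nat.pos_of_ne_zero hc)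
  rw [← hqp, pow_add, two_mul, pow_add]
  calc c * (I * (N.range.relIndex P * (2 ^ q * 2 ^ p)))
      = (I * N.range.relIndex P) * (2 ^ q * c) * 2 ^ p := by ring
    _ = (2 ^ p * c) * (I * D.range.relIndex Mn) * 2 ^ p := by rw [r1, r2]
    _ = _ := by ring
end
end QH

end

section
namespace QH
open IsDedekindDomain NumberField WithZero

universe u

/-- quadratic extension data -/
structure QE (K E : Type*) [Field K] [Field E] [Algebra K E] (ε : K) where
  θ : E
  hθ : θ ^ 2 = algebraMap K E ε
  σ : E ≃ₐ[K] E
  hσ : σ θ = - θ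
  gen : ∀ x : E, ∃ a b : K, x = algebraMap K E a + algebraMap K E b * θ
  rk : Module.finrank K E = 2
  nonsq : ¬ IsSquare ε

section
variable {K E : Type*} [Field K] [Field E] [Algebra K E] {ε : K} (q : QE K E ε)

lemma QE.ne {K E : Type*} [Field K] [Field E] [Algebra K E] {ε : K} (q : QE K E ε) : ε ≠ 0 := fun h => q.nonsq (by rw [h]; exact ⟨0, by simp⟩)

lemma QE.θ_ne : q.θ ≠ 0 := fun h => q.ne (by
  have := q.hθ; rw [h] at this; exact (algebraMap K E).injective (by rw [← this]; simp))

lemma QE.indep {a b : K} (h : algebraMap K E a + algebraMap K E b * q.θ = 0) : a = 0 ∧ b = 0 := by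
  by_cases hb : b = 0
  · subst hb
    simpa using h
  · exfalso
    apply q.nonsq
    refine ⟨a / b, (algebraMap K E).injective ?_⟩
    have hb' : algebraMap K E b ≠ 0 := by simpa using hb
    have h1 : q.θ = - (algebraMap K E a) / algebraMap K E b := by
      field_simp; linear_combination h
    rw [← q.hθ, h1, map_mul, map_div₀]; ring

lemma QE.σ_apply (a b : K) : q.σ (algebraMap K E a + algebraMap K E b * q.θ) =
    algebraMap K E a - algebraMap K E b * q.θ := by
  rw [map_add, map_mul, q.σ.commutes, q.σ.commutes, q.hσ]; ring

lemma QE.σσ (x : E) : q.σ (q.σ x) = x := by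
  obtain ⟨a, b, rfl⟩ := q.gen x
  rw [q.σ_apply, sub_eq_add_neg, ← neg_mul, ← map_neg, q.σ_apply]; simp

lemma QE.norm (a b : K) : (algebraMap K E a + algebraMap K E b * q.θ) * q.σ (algebraMap K E a + algebraMap K E b * q.θ) =
    algebraMap K E (a ^ 2 - ε * b ^ 2) := by
  rw [q.σ_apply, map_sub, map_mul, map_pow, map_pow, ← q.hθ]; ring
end

lemma exists_QE (K : Type u) [Field K] [NumberField K] {ε : K} (h : ¬ IsSquare ε) :
    ∃ (E : Type u) (_ : Field E) (_ : NumberField E) (_ : Algebra K E), Nonempty (QE K E ε) := by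
  have hf : Fact (∀ r : K, r ^ 2 ≠ ε + 0 * r) := ⟨fun r hr => h ⟨r, by rw [← sq, hr]; ring⟩⟩
  have hch : CharZero (QuadraticAlgebra K ε 0) := charZero_of_injective_algebraMap (algebraMap K (QuadraticAlgebra K ε 0)).injective
  have hfin : FiniteDimensional ℚ (QuadraticAlgebra K ε 0) := by
    have : Module.Finite ℚ K := inferInstance
    have : Module.Finite K (QuadraticAlgebra K ε 0) := inferInstance
    have ht : IsScalarTower ℚ K (QuadraticAlgebra K ε 0) := inferInstance
    exact Module.Finite.trans K (QuadraticAlgebra K ε 0)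
  refine ⟨QuadraticAlgebra K ε 0, inferInstance, ⟨⟩, inferInstance, ⟨⟨⟨0, 1⟩, ?_, ?_, ?_, ?_, QuadraticAlgebra.finrank_eq_two ε 0, h⟩⟩⟩
  · ext <;> simp [sq]
  · exact AlgEquiv.ofBijective
      { toFun := fun x => star x
        map_one' := star_one _
        map_zero' := star_zero _
        map_add' := star_add
        map_mul' := fun x y => by rw [star_mul, mul_comm]
        commutes' := fun r => by ext <;> simp } (star_involutive.bijective)
  · change star _ = _
    ext <;> simp
  · intro x
    refine ⟨x.re, x.im, ?_⟩
    ext <;> simp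
end QH

end

section
namespace QH
open IsDedekindDomain NumberField WithZero

section
variable {K E : Type*} [Field K] [NumberField K] [Field E] [NumberField E] [Algebra K E]

/-- place below -/
noncomputable def below (w : HeightOneSpectrum (𝓞 E)) : HeightOneSpectrum (𝓞 K) := HeightOneSpectrum.under (𝓞 K) w

lemma exists_ram (w : HeightOneSpectrum (𝓞 E)) : ∃ e : ℕ, e ≠ 0 ∧ ∀ x : K,
    w.valuation E (algebraMap K E x) = (below (K := K) w).valuation K x ^ e := by
  have : w.asIdeal.LiesOver (below (K := K) w).asIdeal := ⟨rfl⟩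
  refine ⟨(below (K := K) w).asIdeal.ramificationIdx' w.asIdeal, ?_, fun x =>
    (HeightOneSpectrum.valuation_liesOver E (below (K := K) w) w x).symm⟩
  exact Ideal.IsDedekindDomain.ramificationIdx'_ne_zero_of_liesOver _ (below (K := K) w).ne_bot

/-- unit map -/
noncomputable abbrev ua (K E : Type*) [Field K] [Field E] [Algebra K E] : Kˣ →* Eˣ := Units.map (algebraMap K E).toMonoidHom

lemma ua_val (x : Kˣ) : ((ua K E x : Eˣ) : E) = algebraMap K E x := rfl

lemma ua_inj : Function.Injective (ua K E) := Units.map_injective (algebraMap K E).injective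

lemma exists_ram_lg (w : HeightOneSpectrum (𝓞 E)) : ∃ e : ℕ, e ≠ 0 ∧ ∀ x : Kˣ,
    lg w (ua K E x) = e * lg (below (K := K) w) x := by
  obtain ⟨e, he, h⟩ := exists_ram (K := K) w
  refine ⟨e, he, fun x => ?_⟩
  have := h x
  rw [← ua_val, val_eq_exp, val_eq_exp, ← exp_nsmul] at this
  rw [exp_inj.mp this]; simp

lemma below_lt_one {w : HeightOneSpectrum (𝓞 E)} {x : K} : 
    w.valuation E (algebraMap K E x) < 1 ↔ (below (K := K) w).valuation K x < 1 := by
  obtain ⟨e, he, h⟩ := exists_ram (K := K) w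
  rw [h, pow_lt_one_iff he]

lemma below_eq_one {w : HeightOneSpectrum (𝓞 E)} {x : K} : 
    w.valuation E (algebraMap K E x) = 1 ↔ (below (K := K) w).valuation K x = 1 := by
  obtain ⟨e, he, h⟩ := exists_ram (K := K) w
  rw [h, pow_eq_one_iff]; simp [he]

lemma below_le_iff {w : HeightOneSpectrum (𝓞 E)} {x y : K} : 
    w.valuation E (algebraMap K E x) ≤ w.valuation E (algebraMap K E y) ↔
    (below (K := K) w).valuation K x ≤ (below (K := K) w).valuation K y := by
  obtain ⟨e, he, h⟩ := exists_ram (K := K) w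
  rw [h, h, pow_le_pow_iff_left₀ zero_le zero_le he]

lemma below_locSq {w : HeightOneSpectrum (𝓞 E)} {x : Kˣ} (h : x ∈ locSq ((below (K := K) w).valuation K)) :
    ua K E x ∈ locSq (w.valuation E) :=
  locSq_map _ _ (algebraMap K E) (fun _ hx => below_lt_one.mpr hx) h

lemma below_surj (v : HeightOneSpectrum (𝓞 K)) : ∃ w : HeightOneSpectrum (𝓞 E), below (K := K) w = v := by
  obtain ⟨x, h1, h2⟩ := exists_prime_unit (K := K) v
  by_contra! hcon
  have h3 : ∀ w : HeightOneSpectrum (𝓞 E), lg w (ua K E x) = 0 := by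
    intro w
    obtain ⟨e, -, he⟩ := exists_ram_lg (K := K) w
    rw [he, h2 _ (hcon w), mul_zero]
  have h4 : ∀ y : Kˣ, (∀ w : HeightOneSpectrum (𝓞 E), lg w (ua K E y) = 0) → lg v y ≤ 0 := by
    intro y hy
    obtain ⟨a, ha⟩ := HeightOneSpectrum.mem_integers_of_valuation_le_one (R := 𝓞 E) E (ua K E y : E) (fun w => by
      rw [val_eq_exp, hy w]; simp)
    have hi : IsIntegral ℤ (algebraMap K E y) := by
      rw [← ua_val, ← ha]; exact a.2
    have hi2 : IsIntegral ℤ (y : K) := (isIntegral_algebraMap_iff (algebraMap K E).injective).mp hi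
    have h5 : v.valuation K (algebraMap (𝓞 K) K ⟨y, hi2⟩) ≤ 1 := v.valuation_le_one _
    change v.valuation K (y : K) ≤ 1 at h5
    rw [val_eq_exp, ← exp_zero, exp_le_exp] at h5
    exact h5
  have h5 := h4 x h3
  have h6 := h4 x⁻¹ (fun w => by rw [map_inv, lg_inv, h3]; rfl)
  rw [lg_inv] at h6
  omega

lemma below_fin (v : HeightOneSpectrum (𝓞 K)) : {w : HeightOneSpectrum (𝓞 E) | below (K := K) w = v}.Finite := by
  obtain ⟨x, h1, h2⟩ := exists_prime_unit (K := K) v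
  refine (finite_lg_ne (ua K E x)).subset ?_
  rintro w rfl
  obtain ⟨e, he0, he⟩ := exists_ram_lg (K := K) w
  change lg w (ua K E x) ≠ 0
  rw [he]
  exact mul_ne_zero (by exact_mod_cast he0) h1

/-- places above `S` -/
noncomputable def above (E : Type*) [Field E] [NumberField E] [Algebra K E] (S : Finset (HeightOneSpectrum (𝓞 K))) :
    Finset (HeightOneSpectrum (𝓞 E)) :=
  (Set.Finite.biUnion S.finite_toSet (fun v _ => below_fin (E := E) v)).toFinset

lemma mem_above {S : Finset (HeightOneSpectrum (𝓞 K))} {w : HeightOneSpectrum (𝓞 E)} :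
    w ∈ above E S ↔ below w ∈ S := by
  simp [above]

lemma ua_mem_SU {S : Finset (HeightOneSpectrum (𝓞 K))} {x : Kˣ} : ua K E x ∈ SU E (above E S) ↔ x ∈ SU K S := by
  constructor
  · intro h v hv
    obtain ⟨w, rfl⟩ := below_surj (E := E) v
    obtain ⟨e, he0, he⟩ := exists_ram_lg (K := K) w
    have := h w (by rwa [mem_above])
    rw [he] at this
    exact (mul_eq_zero.mp this).resolve_left (by exact_mod_cast he0)
  · intro h w hw
    obtain ⟨e, he0, he⟩ := exists_ram_lg (K := K) w
    rw [he, h _ (by rwa [mem_above] at hw), mul_zero]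

/-- conjugate place -/
lemma exists_conj (σ : E ≃ₐ[K] E) (w : HeightOneSpectrum (𝓞 E)) : ∃ w' : HeightOneSpectrum (𝓞 E),
    ∀ x : E, w'.valuation E x = w.valuation E (σ x) := by
  let τ : 𝓞 E ≃+* 𝓞 E := RingOfIntegers.mapRingEquiv σ.toRingEquiv
  have hτ : ∀ r : 𝓞 E, algebraMap (𝓞 E) E (τ r) = σ (algebraMap (𝓞 E) E r) := fun r => rfl
  have hpr : (w.asIdeal.comap (τ : 𝓞 E →+* 𝓞 E)).IsPrime := Ideal.IsPrime.comap _
  let w' : HeightOneSpectrum (𝓞 E) := ⟨w.asIdeal.comap (τ : 𝓞 E →+* 𝓞 E), hpr, by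
    intro h
    apply w.ne_bot
    rw [eq_bot_iff]
    intro x hx
    have : τ.symm x ∈ w.asIdeal.comap (τ : 𝓞 E →+* 𝓞 E) := by
      rw [Ideal.mem_comap]; simpa using hx
    rw [h, Ideal.mem_bot] at this
    simpa using this⟩
  have hpow : ∀ (n : ℕ) (r : 𝓞 E), r ∈ w'.asIdeal ^ n ↔ τ r ∈ w.asIdeal ^ n := by
    intro n r
    have h1 : w'.asIdeal = w.asIdeal.map (τ.symm : 𝓞 E →+* 𝓞 E) := (Ideal.map_symm τ).symm
    rw [h1, ← Ideal.map_pow]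
    have h2 := Ideal.map_symm (I := w.asIdeal ^ n) τ
    have h3 : Ideal.map (τ.symm : 𝓞 E →+* 𝓞 E) (w.asIdeal ^ n) = Ideal.comap (τ : 𝓞 E →+* 𝓞 E) (w.asIdeal ^ n) := h2
    rw [h3, Ideal.mem_comap]
    rfl
  have hintg : ∀ r : 𝓞 E, w'.valuation E (algebraMap (𝓞 E) E r) = w.valuation E (σ (algebraMap (𝓞 E) E r)) := by
    intro r
    by_cases hr : r = 0
    · subst hr; simp
    have h0 : algebraMap (𝓞 E) E r ≠ 0 := by simpa using hr
    have h1 : algebraMap (𝓞 E) E (τ r) ≠ 0 := by simpa using hr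
    have key : ∀ n : ℕ, lg w' (Units.mk0 _ h0) ≤ -n ↔ lg w (Units.mk0 _ h1) ≤ -n := by
      intro n; rw [lg_alg_le, lg_alg_le, hpow]
    have k0 := (lg_alg_le w' r h0 0).mpr (by simp)
    have k1 := (lg_alg_le w (τ r) h1 0).mpr (by simp)
    have heq : lg w' (Units.mk0 _ h0) = lg w (Units.mk0 _ h1) := by
      have a1 := (key (-(lg w' (Units.mk0 _ h0))).toNat).mp (by simp at k0; omega)
      have a2 := (key (-(lg w (Units.mk0 _ h1))).toNat).mpr (by simp at k1; omega)
      simp at k0 k1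
      omega
    rw [← hτ]
    change w'.valuation E ((Units.mk0 _ h0 : Eˣ) : E) = w.valuation E ((Units.mk0 _ h1 : Eˣ) : E)
    rw [val_eq_exp, val_eq_exp, heq]
  refine ⟨w', fun x => ?_⟩
  obtain ⟨a, b, hb, rfl⟩ := IsFractionRing.div_surjective (A := 𝓞 E) x
  rw [map_div₀, map_div₀, map_div₀, hintg, hintg]

lemma below_ext {w w' : HeightOneSpectrum (𝓞 E)} (h : ∀ x : K, w.valuation E (algebraMap K E x) < 1 ↔ w'.valuation E (algebraMap K E x) < 1) :
    below (K := K) w = below w' := by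
  apply HeightOneSpectrum.ext
  ext r
  rw [← val_alg_lt_one (K := K), ← val_alg_lt_one (K := K), ← below_lt_one, ← below_lt_one, h]

end
end QH

end

section
namespace QH
open IsDedekindDomain NumberField WithZero
open scoped Classical

universe u

section
variable {R : Type*} [CommRing R] [IsDedekindDomain R] {K : Type*} [Field K] [Algebra R K] [IsFractionRing R K]

lemma lg_prod {ι : Type*} (v : HeightOneSpectrum R) (s : Finset ι) (f : ι → Kˣ) :
    lg v (∏ i ∈ s, f i) = ∑ i ∈ s, lg v (f i) := by
  induction s using Finset.induction_on with
  | empty => simp [lg_one]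
  | insert a s ha ih => rw [Finset.prod_insert ha, Finset.sum_insert ha, lg_mul, ih]

lemma ClS.exists_of_fun {S : Finset (HeightOneSpectrum R)} (h : ClS K S) (Z : Finset (HeightOneSpectrum R))
    (n : HeightOneSpectrum R → ℤ) (hn : ∀ v ∉ S, v ∉ Z → n v = 0) :
    ∃ c : Kˣ, ∀ v ∉ S, lg v c = n v := by
  have h' : ∀ v : HeightOneSpectrum R, ∃ x : Kˣ, v ∉ S → lg v x = -1 ∧ ∀ w ∉ S, w ≠ v → lg w x = 0 := by
    intro v
    by_cases hv : v ∈ S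
    · exact ⟨1, fun h => absurd hv h⟩
    · obtain ⟨x, hx⟩ := h v hv; exact ⟨x, fun _ => hx⟩
  choose x hx using h'
  refine ⟨∏ v ∈ Z \ S, (x v) ^ (- n v), fun v hv => ?_⟩
  rw [lg_prod]
  by_cases hvZ : v ∈ Z
  · rw [Finset.sum_eq_single v]
    · rw [lg_zpow, (hx v hv).1]; ring
    · intro w hw hwv
      rw [lg_zpow, (hx w (Finset.mem_sdiff.mp hw).2).2 v hv hwv.symm, mul_zero]
    · intro hcon; exact absurd (Finset.mem_sdiff.mpr ⟨hvZ, hv⟩) hcon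
  · rw [hn v hv hvZ]
    refine Finset.sum_eq_zero fun w hw => ?_
    rw [lg_zpow, (hx w (Finset.mem_sdiff.mp hw).2).2 v hv (by rintro rfl; exact hvZ (Finset.mem_sdiff.mp hw).1), mul_zero]
end

section
variable {K E : Type*} [Field K] [NumberField K] [Field E] [NumberField E] [Algebra K E] {ε : Kˣ}

lemma above_split (q : QE K E (ε : K)) (v : HeightOneSpectrum (𝓞 K)) (h : ε ∈ locSq (v.valuation K)) :
    ∃ w w' : HeightOneSpectrum (𝓞 E), w ≠ w' ∧ below w = v ∧ below w' = v := by
  obtain ⟨w, hw⟩ := below_surj (E := E) v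
  obtain ⟨w', hw'⟩ := exists_conj q.σ w
  refine ⟨w, w', ?_, hw, ?_⟩
  · rintro rfl
    obtain ⟨y, c, hc, hy⟩ := h
    set ρ : E := (q.θ / algebraMap K E y - 1) / 2 with hρ
    have hy0 : algebraMap K E y ≠ 0 := by simp
    have h1 : ρ ^ 2 + ρ = algebraMap K E c := by
      have : q.θ ^ 2 = (algebraMap K E y) ^ 2 * (1 + 4 * algebraMap K E c) := by
        rw [q.hθ, hy, map_mul, map_pow, map_add, map_mul, map_one, map_ofNat]
      rw [hρ]; field_simp; linear_combination this
    have h2 : q.σ ρ = -(ρ + 1) := by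
      rw [hρ, map_div₀, map_sub, map_div₀, q.hσ, q.σ.commutes, map_one, map_ofNat]; ring
    have h3 : w.valuation E ρ = w.valuation E (ρ + 1) := by
      rw [hw', h2, Valuation.map_neg]
    have h4 : w.valuation E (ρ * (ρ + 1)) < 1 := by
      have : ρ * (ρ + 1) = algebraMap K E c := by rw [← h1]; ring
      rw [this, below_lt_one, hw]; exact hc
    rw [map_mul, ← h3] at h4
    have h5 : w.valuation E ρ < 1 := by
      by_contra hcon
      push Not at hcon
      exact absurd h4 (not_lt.mpr (one_le_mul hcon hcon))
    have h6 : w.valuation E ((ρ + 1) - ρ) < 1 := lt_of_le_of_lt (Valuation.map_sub _ _ _) (max_lt (h3 ▸ h5) h5)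
    simp at h6
  · rw [← hw]
    apply below_ext
    intro x
    rw [hw', q.σ.commutes]

lemma above_card (q : QE K E (ε : K)) (S : Finset (HeightOneSpectrum (𝓞 K))) :
    2 * S.card ≤ (above E S).card + (S.filter (fun v => ε ∉ locSq (v.valuation K))).card := by
  have h1 : (above E S).card = ∑ v ∈ S, ((above E S).filter (fun w => below w = v)).card :=
    Finset.card_eq_sum_card_fiberwise (fun w hw => by
      have : w ∈ above E S := hw
      rw [mem_above] at this; exact this)
  rw [h1, Finset.card_filter, ← Finset.sum_add_distrib, mul_comm, ← smul_eq_mul, ← Finset.sum_const]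
  refine Finset.sum_le_sum fun v hv => ?_
  by_cases h : ε ∈ locSq (v.valuation K)
  · obtain ⟨w, w', hne, hw, hw'⟩ := above_split q v h
    have : ({w, w'} : Finset _) ⊆ (above E S).filter (fun w => below w = v) := by
      intro z hz
      rw [Finset.mem_filter, mem_above]
      rcases Finset.mem_insert.mp hz with rfl | hz
      · exact ⟨hw ▸ hv, hw⟩
      · rw [Finset.mem_singleton.mp hz]; exact ⟨hw' ▸ hv, hw'⟩
    have := Finset.card_le_card this
    rw [Finset.card_pair hne] at this
    omega
  · obtain ⟨w, hw⟩ := below_surj (E := E) v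
    have : 0 < ((above E S).filter (fun w => below w = v)).card := 
      Finset.card_pos.mpr ⟨w, by rw [Finset.mem_filter, mem_above]; exact ⟨hw ▸ hv, hw⟩⟩
    rw [if_pos h]; omega

/-- locally a constant from the base field -/
def Good (K : Type*) {E : Type*} [Field K] [NumberField K] [Field E] [NumberField E] [Algebra K E]
    (v : HeightOneSpectrum (𝓞 K)) (x : Eˣ) : Prop :=
  ∃ c : Kˣ, ∀ w : HeightOneSpectrum (𝓞 E), below w = v → lg w x = lg w (ua K E c)

lemma Good.div {v : HeightOneSpectrum (𝓞 K)} {x y : Eˣ} (hx : Good K v x) (hy : Good K v y) : Good K v (x / y) := by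
  obtain ⟨c, hc⟩ := hx
  obtain ⟨d, hd⟩ := hy
  exact ⟨c / d, fun w hw => by rw [map_div, lg_div, lg_div, hc w hw, hd w hw]⟩

lemma good_of_val {v : HeightOneSpectrum (𝓞 K)} {x : Eˣ} {c : K} (hc : c ≠ 0)
    (h : ∀ w : HeightOneSpectrum (𝓞 E), below w = v → w.valuation E (x : E) = w.valuation E (algebraMap K E c)) : Good K v x := by
  refine ⟨Units.mk0 c hc, fun w hw => ?_⟩
  rw [← val_eq_val_iff, h w hw]; rfl

lemma good_even (q : QE K E (ε : K)) {v : HeightOneSpectrum (𝓞 K)} (h2 : v.valuation K 2 = 1) (he : Even (lg v ε)) {x : Eˣ}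
    (hx : ∀ w : HeightOneSpectrum (𝓞 E), below w = v → w.valuation E (x : E) = w.valuation E (q.σ x)) : Good K v x := by
  obtain ⟨ε', z, hεz, hε'⟩ := even_normalize v he
  obtain ⟨a, b', hab⟩ := q.gen x
  obtain ⟨b, hb⟩ : ∃ b, b = b' * (z : K) := ⟨_, rfl⟩
  set θ' : E := q.θ / algebraMap K E z with hθ'
  have hz : algebraMap K E z ≠ 0 := by simp
  have hx' : (x : E) = algebraMap K E a + algebraMap K E b * θ' := by
    rw [hab, hθ', hb, map_mul]; field_simp
  have hσ' : q.σ x = algebraMap K E a - algebraMap K E b * θ' := by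
    rw [hab, q.σ_apply, hθ', hb, map_mul]; field_simp
  have hθv : ∀ w : HeightOneSpectrum (𝓞 E), below w = v → w.valuation E θ' = 1 := by
    intro w hw
    have : θ' ^ 2 = algebraMap K E ε' := by
      rw [hθ', div_pow, q.hθ, hεz]; simp
    have h1 : w.valuation E (θ' ^ 2) = 1 := by
      rw [this, below_eq_one, hw, val_eq_one_iff, hε']
    rw [map_pow] at h1
    exact (pow_eq_one_iff.mp h1).resolve_right (by norm_num)
  have key : ∀ w : HeightOneSpectrum (𝓞 E), below w = v →
      w.valuation E (x : E) = max (w.valuation E (algebraMap K E a)) (w.valuation E (algebraMap K E b)) := by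
    intro w hw
    have hw2 : w.valuation E 2 = 1 := by
      rw [← map_ofNat (algebraMap K E), below_eq_one, hw]; exact h2
    apply le_antisymm
    · rw [hx']
      refine (Valuation.map_add _ _ _).trans ?_
      rw [map_mul, hθv w hw, mul_one]
    · have e1 : w.valuation E (algebraMap K E a) = w.valuation E ((x : E) + q.σ x) := by
        rw [hσ', hx']
        have : algebraMap K E a + algebraMap K E b * θ' + (algebraMap K E a - algebraMap K E b * θ') = 2 * algebraMap K E a := by ring
        rw [this, map_mul, hw2, one_mul]
      have e2 : w.valuation E (algebraMap K E b) = w.valuation E ((x : E) - q.σ x) := by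
        rw [hσ', hx']
        have : algebraMap K E a + algebraMap K E b * θ' - (algebraMap K E a - algebraMap K E b * θ') = 2 * (algebraMap K E b * θ') := by ring
        rw [this, map_mul, map_mul, hw2, one_mul, hθv w hw, mul_one]
      rw [e1, e2]
      apply max_le
      · exact (Valuation.map_add _ _ _).trans (by rw [← hx w hw, max_self])
      · exact (Valuation.map_sub _ _ _).trans (by rw [← hx w hw, max_self])
  rcases le_total (v.valuation K a) (v.valuation K b) with hle | hle
  · refine good_of_val (c := b) ?_ ?_
    · rintro h0
      rw [h0, map_zero, le_zero_iff, Valuation.zero_iff] at hle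
      rw [hle, h0] at hx'
      simp at hx'
    · intro w hw
      rw [key w hw, max_eq_right]
      rw [below_le_iff, hw]; exact hle
  · refine good_of_val (c := a) ?_ ?_
    · rintro h0
      rw [h0, map_zero, le_zero_iff, Valuation.zero_iff] at hle
      rw [hle, h0] at hx'
      simp at hx'
    · intro w hw
      rw [key w hw, max_eq_left]
      rw [below_le_iff, hw]; exact hle

lemma good_odd (q : QE K E (ε : K)) {v : HeightOneSpectrum (𝓞 K)} (he : ¬ Even (lg v ε)) (x : Eˣ) :
    Good K v x ∨ Good K v (x * Units.mk0 q.θ q.θ_ne) := by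
  obtain ⟨a, b, hab⟩ := q.gen x
  have hn : a ^ 2 - (ε : K) * b ^ 2 ≠ 0 := by
    intro h0
    have := q.norm a b
    rw [h0, ← hab, map_zero] at this
    rcases mul_eq_zero.mp this with h | h
    · exact x.ne_zero h
    · exact x.ne_zero ((map_eq_zero _).mp h)
  have hsq : ∀ (w : HeightOneSpectrum (𝓞 E)) (y z : E), w.valuation E (y ^ 2) < w.valuation E (z ^ 2) → w.valuation E y < w.valuation E z := by
    intro w y z h
    rw [map_pow, map_pow] at h
    exact lt_of_pow_lt_pow_left₀ 2 zero_le h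
  rcases norm_odd v he hn with ⟨h0, h1⟩ | ⟨h0, h1⟩
  · left
    refine good_of_val h0 fun w hw => ?_
    rw [hab]
    refine Valuation.map_add_eq_of_lt_left _ (hsq w _ _ ?_)
    have : (algebraMap K E b * q.θ) ^ 2 = algebraMap K E (ε * b ^ 2) := by
      rw [mul_pow, q.hθ]; simp [mul_comm]
    rw [this, ← map_pow, ← not_le, below_le_iff, hw, not_le]; exact h1
  · right
    refine good_of_val (c := b * ε) (mul_ne_zero h0 ε.ne_zero) fun w hw => ?_
    have e2 : algebraMap K E (b * ε) = (algebraMap K E b * q.θ) * q.θ := by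
      rw [map_mul, ← q.hθ]; ring
    rw [Units.val_mul, Units.val_mk0, e2, map_mul, map_mul _ (algebraMap K E b * q.θ)]
    congr 1
    rw [hab]
    refine Valuation.map_add_eq_of_lt_right _ (hsq w _ _ ?_)
    have : (algebraMap K E b * q.θ) ^ 2 = algebraMap K E (ε * b ^ 2) := by
      rw [mul_pow, q.hθ]; simp [mul_comm]
    rw [this, ← map_pow, ← not_le, below_le_iff, hw, not_le]; exact h1
end
end QH

end

section
namespace QH
open IsDedekindDomain NumberField WithZero
open scoped Classical

universe u
set_option linter.unusedSectionVars false

section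
variable {K E : Type*} [Field K] [NumberField K] [Field E] [NumberField E] [Algebra K E] {ε : Kˣ}

/-- conjugation on units -/
noncomputable def QE.τ (q : QE K E (ε : K)) : Eˣ →* Eˣ := Units.map (q.σ : E →* E)

lemma QE.τ_val (q : QE K E (ε : K)) (x : Eˣ) : ((q.τ x : Eˣ) : E) = q.σ x := rfl

lemma QE.ττ (q : QE K E (ε : K)) (x : Eˣ) : q.τ (q.τ x) = x := Units.ext (q.σσ x)

lemma QE.conj_lg (q : QE K E (ε : K)) (w : HeightOneSpectrum (𝓞 E)) :
    ∃ w' : HeightOneSpectrum (𝓞 E), below (K := K) w' = below w ∧ ∀ x, lg w (q.τ x) = lg w' x := by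
  obtain ⟨w', hw'⟩ := exists_conj q.σ w
  refine ⟨w', ?_, fun x => ?_⟩
  · apply below_ext
    intro x
    rw [hw', q.σ.commutes]
  · rw [lg, lg, hw', q.τ_val]

lemma QE.τ_mem (q : QE K E (ε : K)) (S : Finset (HeightOneSpectrum (𝓞 K))) {x : Eˣ} (hx : x ∈ SU E (above E S)) :
    q.τ x ∈ SU E (above E S) := by
  intro w hw
  obtain ⟨w', h1, h2⟩ := q.conj_lg w
  rw [h2]
  apply hx
  rw [mem_above] at hw ⊢
  rwa [h1]

lemma QE.exists_hilb (q : QE K E (ε : K)) {z : Eˣ} (hz : z * q.τ z = 1) : ∃ x : Eˣ, x / q.τ x = z := by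
  have hz' : (z : E) * q.σ z = 1 := by rw [← q.τ_val, ← Units.val_mul, hz]; rfl
  by_cases h : (1 : E) + z = 0
  · refine ⟨Units.mk0 q.θ q.θ_ne, ?_⟩
    ext
    have : (z : E) = -1 := by linear_combination h
    rw [Units.val_div_eq_div_val, q.τ_val, Units.val_mk0, q.hσ, this]
    have := q.θ_ne
    field_simp
  · refine ⟨Units.mk0 _ h, ?_⟩
    ext
    rw [Units.val_div_eq_div_val, q.τ_val, Units.val_mk0, map_add, map_one]
    have h2 : 1 + q.σ z ≠ 0 := by
      intro h0
      apply h
      have : (z : E) * (1 + q.σ z) = 0 := by rw [h0, mul_zero]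
      linear_combination this - hz'
    rw [div_eq_iff h2]
    linear_combination - hz'

lemma exists_of_good {S : Finset (HeightOneSpectrum (𝓞 K))} (hcl : ClS K S) {x : Eˣ} (h : ∀ v ∉ S, Good K v x) :
    ∃ c : Kˣ, x / ua K E c ∈ SU E (above E S) := by
  have h' : ∀ v : HeightOneSpectrum (𝓞 K), ∃ c : Kˣ, v ∉ S → ∀ w : HeightOneSpectrum (𝓞 E), below w = v → lg w x = lg w (ua K E c) := by
    intro v
    by_cases hv : v ∈ S
    · exact ⟨1, fun h => absurd hv h⟩
    · obtain ⟨x, hx⟩ := h v hv; exact ⟨x, fun _ => hx⟩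
  choose c hc using h'
  set Z : Finset (HeightOneSpectrum (𝓞 K)) := (finite_lg_ne x).toFinset.image (fun w : HeightOneSpectrum (𝓞 E) => below w)
  obtain ⟨d, hd⟩ := hcl.exists_of_fun Z (fun v => if v ∈ Z then lg v (c v) else 0) (fun v _ hv => if_neg hv)
  refine ⟨d, fun w hw => ?_⟩
  rw [mem_above] at hw
  obtain ⟨e, he, hlg⟩ := exists_ram_lg (K := K) w
  rw [lg_div, hlg, hd _ hw]
  split_ifs with hZ
  · rw [hc _ hw w rfl, hlg, sub_self]
  · rw [mul_zero, sub_zero]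
    by_contra hne
    exact hZ (Finset.mem_image.mpr ⟨w, by simpa using hne, rfl⟩)

lemma hilb_bound (q : QE K E (ε : K)) (S : Finset (HeightOneSpectrum (𝓞 K)))
    (hdy : ∀ v ∉ S, v.valuation K 2 = 1) (hcl : ClS K S) (Todd : Finset (HeightOneSpectrum (𝓞 K)))
    (hT : ∀ v ∉ S, ¬ Even (lg v ε) → v ∈ Todd) (Mn D : Subgroup (SU E (above E S)))
    (hM : ∀ x, x ∈ Mn → (x : Eˣ) * q.τ x = 1) (hD : ∀ x : SU E (above E S), ∀ y : SU E (above E S), (x : Eˣ) = y / q.τ y → x ∈ D) :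
    D.relIndex Mn ≤ 2 ^ Todd.card := by
  have hx : ∀ z : SU E (above E S), ∃ x : Eˣ, z ∈ Mn → x / q.τ x = z := by
    intro z
    by_cases hz : z ∈ Mn
    · obtain ⟨x, hx⟩ := q.exists_hilb (hM z hz); exact ⟨x, fun _ => hx⟩
    · exact ⟨1, fun h => absurd h hz⟩
  choose x hx using hx
  have := (relIndex_le_of_fun D Mn (fun z => fun v : Todd => Good K (v : HeightOneSpectrum (𝓞 K)) (x z)) ?_).2
  · simpa using this
  intro z1 hz1 z2 hz2 h12
  have hg : ∀ v ∉ S, Good K v (x z1 / x z2) := by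
    intro v hv
    by_cases he : Even (lg v ε)
    · refine good_even q (hdy v hv) he ?_
      intro w hw
      rw [← q.τ_val, val_eq_val_iff, ← sub_eq_zero, ← lg_div]
      have : x z1 / x z2 / q.τ (x z1 / x z2) = ((z1 / z2 : SU E (above E S)) : Eˣ) := by
        rw [map_div, div_div_div_comm, hx z1 hz1, hx z2 hz2]; rfl
      rw [this]
      apply (z1 / z2).2
      rw [mem_above, hw]; exact hv
    · have h1 := congrFun h12 ⟨v, hT v hv he⟩
      simp only [eq_iff_iff] at h1
      by_cases hg : Good K v (x z1)
      · exact hg.div (h1.mp hg)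
      · have g1 := (good_odd q he (x z1)).resolve_left hg
        have g2 := (good_odd q he (x z2)).resolve_left (fun h => hg (h1.mpr h))
        have := g1.div g2
        rwa [mul_div_mul_right_eq_div] at this
  obtain ⟨c, hc⟩ := exists_of_good hcl hg
  apply hD _ ⟨_, hc⟩
  have hτc : q.τ (ua K E c) = ua K E c := by
    ext; rw [q.τ_val, ua_val, q.σ.commutes]
  rw [map_div, hτc, div_div_div_cancel_right, map_div, div_div_div_comm, hx z1 hz1, hx z2 hz2]; rfl

end

lemma rank_tc (K : Type*) [Field K] [NumberField K] [IsTotallyComplex K] :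
    2 * (Units.rank K + 1) = Module.finrank ℚ K := by
  have h1 : Units.rank K = Fintype.card (InfinitePlace K) - 1 := rfl
  have h2 := IsTotallyComplex.finrank (K := K)
  have h3 := InfinitePlace.card_eq_nrRealPlaces_add_nrComplexPlaces K
  have h4 : InfinitePlace.nrRealPlaces K = 0 := nrRealPlaces_eq_zero_iff.mpr inferInstance
  have h5 : 0 < Module.finrank ℚ K := Module.finrank_pos
  omega

theorem lemmaH {K : Type u} [Field K] [NumberField K] [IsTotallyComplex K] {ε : Kˣ} (hns : ¬ IsSquare (ε : K))
    (S : Finset (HeightOneSpectrum (𝓞 K)))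
    (hdy : ∀ v ∉ S, v.valuation K 2 = 1) (hcl : ClS K S) (k : ℕ)
    (hk : (S.filter (fun v => ε ∉ locSq (v.valuation K))).card ≤ k) (Todd : Finset (HeightOneSpectrum (𝓞 K)))
    (hT : ∀ v ∉ S, ¬ Even (lg v ε) → v ∈ Todd) :
    (normGrp (ε : K)).relIndex (SU K S) ≠ 0 ∧ 2 * (normGrp (ε : K)).relIndex (SU K S) ≤ 2 ^ (k + Todd.card) := by
  obtain ⟨E, _, _, _, ⟨q⟩⟩ := exists_QE K hns
  have hE : IsTotallyComplex E := isTotallyComplex_of_algebra K E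
  set M := SU E (above E S) with hMdef
  obtain ⟨hfin, hrk⟩ := SU_rk E (above E S)
  let σ : M →* M := (q.τ.comp M.subtype).codRestrict M (fun x => q.τ_mem S x.2)
  have hσv : ∀ x : M, ((σ x : M) : Eˣ) = q.τ x := fun x => rfl
  have hσ : ∀ x, σ (σ x) = x := fun x => Subtype.ext (q.ττ x)
  let N : M →* M := MonoidHom.id M * σ
  let D : M →* M := MonoidHom.id M / σ
  let P : Subgroup M := σ.eqLocus (MonoidHom.id M)
  have hP : ∀ x, x ∈ P ↔ σ x = x := fun x => Iff.rfl
  have hM : ∀ x, x ∈ N.ker ↔ x * σ x = 1 := fun x => Iff.rfl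
  let i0 : SU K S →* M := ((ua K E).comp (SU K S).subtype).codRestrict M (fun x => ua_mem_SU.mpr x.2)
  let i : SU K S →* P := i0.codRestrict P (fun x => by
    rw [hP]; ext; exact q.σ.commutes _)
  have hiv : ∀ x : SU K S, (((i x : P) : M) : Eˣ) = ua K E x := fun x => rfl
  have hi : Function.Bijective i := by
    constructor
    · intro x y hxy
      have : ua K E x = ua K E y := by rw [← hiv, ← hiv, hxy]
      exact Subtype.ext (ua_inj this)
    · intro x
      obtain ⟨a, b, hab⟩ := q.gen ((x : M) : Eˣ)
      have h1 : q.σ ((x : M) : Eˣ) = ((x : M) : Eˣ) := by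
        have := congrArg (fun y : M => ((y : Eˣ) : E)) ((hP _).mp x.2)
        exact this
      rw [hab, q.σ_apply] at h1
      have h2 : algebraMap K E 0 + algebraMap K E (2 * b) * q.θ = 0 := by
        rw [map_zero, map_mul, map_ofNat]; linear_combination - h1
      have h3 : b = 0 := by simpa using (q.indep h2).2
      rw [h3, map_zero, zero_mul, add_zero] at hab
      have ha : a ≠ 0 := by
        rintro rfl
        rw [map_zero] at hab
        exact ((x : M) : Eˣ).ne_zero hab
      have h4 : ((x : M) : Eˣ) = ua K E (Units.mk0 a ha) := Units.ext hab
      refine ⟨⟨Units.mk0 a ha, ?_⟩, ?_⟩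
      · rw [← ua_mem_SU (E := E), ← h4]; exact (x : M).2
      · apply Subtype.ext; apply Subtype.ext; exact h4.symm
  have hp : HasRk P (Units.rank K + S.card) := by
    obtain ⟨f1, f2⟩ := SU_rk K S
    let e : SU K S ≃* P := MulEquiv.ofBijective i hi
    let e' : Additive (SU K S) ≃ₗ[ℤ] Additive P := (MulEquiv.toAdditive e).toIntLinearEquiv
    exact ⟨Module.Finite.equiv e', by rw [← f2]; exact e'.symm.finrank_eq⟩
  obtain ⟨hh1, hh2⟩ := herbrand hσ hP hM hp hrk (N := N) (D := D) (fun x => rfl) (fun x => rfl)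
  have hB : D.range.relIndex N.ker ≤ 2 ^ Todd.card := by
    refine hilb_bound q S hdy hcl Todd hT _ _ ?_ ?_
    · intro x hx
      have := congrArg (fun y : M => (y : Eˣ)) ((hM x).mp hx)
      exact this
    · intro x y hxy
      exact ⟨y, Subtype.ext hxy.symm⟩
  have hA : (normGrp (ε : K)).relIndex (SU K S) ∣ N.range.relIndex P := by
    have e1 : ((N.range.subgroupOf P).comap i).index = N.range.relIndex P :=
      Subgroup.index_comap_of_surjective _ hi.2
    rw [← e1]
    apply Subgroup.index_dvd_of_le
    intro x hx
    rw [Subgroup.mem_subgroupOf, mem_normGrp]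
    obtain ⟨y, hy⟩ := hx
    have hy' : ((y : Eˣ) : E) * q.σ (y : Eˣ) = algebraMap K E (x : Kˣ) := by
      have := congrArg (fun y : M => ((y : Eˣ) : E)) hy
      exact this
    obtain ⟨a, b, hab⟩ := q.gen (y : Eˣ)
    refine ⟨a, b, ?_⟩
    rw [hab, q.norm] at hy'
    exact ((algebraMap K E).injective hy').symm
  have hA0 : (normGrp (ε : K)).relIndex (SU K S) ≠ 0 := fun h => hh2 (by rw [h] at hA; exact zero_dvd_iff.mp hA)
  refine ⟨hA0, ?_⟩
  have hA1 := Nat.le_of_dvd (Nat.pos_of_ne_zero hh2) hA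
  have r1 := rank_tc K
  have r2 := rank_tc E
  have r3 : Module.finrank ℚ K * Module.finrank K E = Module.finrank ℚ E := Module.finrank_mul_finrank ℚ K E
  rw [q.rk] at r3
  have hc := above_card q S
  have e1 : 1 + 2 * (Units.rank K + S.card) ≤ (Units.rank E + (above E S).card) + k := by omega
  have hpos : 0 < 2 ^ (Units.rank E + (above E S).card) := by positivity
  refine Nat.le_of_mul_le_mul_right ?_ hpos
  calc _ ≤ 2 * N.range.relIndex P * 2 ^ (Units.rank E + (above E S).card) := by gcongr
    _ = 2 * (D.range.relIndex N.ker * 2 ^ (2 * (Units.rank K + S.card))) := by rw [mul_assoc, hh1]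
    _ ≤ 2 * (2 ^ Todd.card * 2 ^ (2 * (Units.rank K + S.card))) := by gcongr
    _ = 2 ^ Todd.card * 2 ^ (1 + 2 * (Units.rank K + S.card)) := by rw [pow_add 2 1]; ring
    _ ≤ 2 ^ Todd.card * 2 ^ ((Units.rank E + (above E S).card) + k) := by gcongr; norm_num
    _ = _ := by rw [pow_add, pow_add]; ring
end QH

end

section
namespace QH
open IsDedekindDomain NumberField WithZero
open scoped Classical
set_option linter.unusedSectionVars false
section
variable {R : Type*} [CommRing R] [IsDedekindDomain R] {K : Type*} [Field K] [Algebra R K] [IsFractionRing R K]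

lemma weak_approx (B : Finset (HeightOneSpectrum R)) (x : HeightOneSpectrum R → K) (n : HeightOneSpectrum R → ℤ) :
    ∃ y : K, ∀ v ∈ B, v.valuation K (y - x v) ≤ exp (n v) := by
  obtain ⟨b, hb⟩ := IsLocalization.exist_integer_multiples_of_finset (nonZeroDivisors R) (B.image x)
  have hb0 : algebraMap R K b ≠ 0 := by
    rw [Ne, IsFractionRing.to_map_eq_zero_iff]; exact nonZeroDivisors.ne_zero b.2
  have hb' : ∀ v : HeightOneSpectrum R, ∃ r : R, v ∈ B → algebraMap R K r = algebraMap R K b * x v := by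
    intro v
    by_cases hv : v ∈ B
    · obtain ⟨r, hr⟩ := hb (x v) (Finset.mem_image_of_mem _ hv)
      exact ⟨r, fun _ => by rw [hr, Algebra.smul_def]⟩
    · exact ⟨0, fun h => absurd h hv⟩
  choose r hr using hb'
  obtain ⟨y, hy⟩ := IsDedekindDomain.exists_forall_sub_mem_ideal (s := B) (fun v => v.asIdeal)
    (fun v => (-(n v + lg v (Units.mk0 _ hb0))).toNat) (fun v _ => v.prime)
    (fun v _ w _ h => fun h' => h (HeightOneSpectrum.ext h')) (fun v => r v)
  refine ⟨algebraMap R K y / algebraMap R K b, fun v hv => ?_⟩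
  have h1 := (HeightOneSpectrum.intValuation_le_pow_iff_mem _ _ _).mpr (hy v hv)
  rw [← HeightOneSpectrum.valuation_of_algebraMap (K := K)] at h1
  have h2 : algebraMap R K y / algebraMap R K b - x v = algebraMap R K (y - r v) / algebraMap R K b := by
    rw [map_sub, hr v hv]; field_simp
  have h3 : v.valuation K (algebraMap R K b) = exp (lg v (Units.mk0 _ hb0)) := val_eq_exp v (Units.mk0 _ hb0)
  rw [h2, map_div₀, h3]
  rw [div_le_iff₀ (by simp), ← exp_add]
  refine h1.trans ?_
  rw [exp_le_exp]
  omega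

lemma weak_approx_unit [CharZero K] (B : Finset (HeightOneSpectrum R)) (x : HeightOneSpectrum R → Kˣ) :
    ∃ y : Kˣ, ∀ v ∈ B, v.valuation K (y : K) = v.valuation K (x v : K) ∧ y / x v ∈ locSq (v.valuation K) := by
  have h4 : (4 : K) ≠ 0 := by norm_num
  rcases B.eq_empty_or_nonempty with rfl | ⟨v0, hv0⟩
  · exact ⟨1, by simp⟩
  obtain ⟨y, hy⟩ := weak_approx B (fun v => (x v : K)) (fun v => lg v (Units.mk0 4 h4 * x v) - 1)
  have hlt : ∀ v ∈ B, v.valuation K (y - x v) < v.valuation K (4 * x v) := by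
    intro v hv
    refine lt_of_le_of_lt (hy v hv) ?_
    have := val_eq_exp v (Units.mk0 4 h4 * x v)
    rw [Units.val_mul, Units.val_mk0] at this
    rw [this, exp_lt_exp]; omega
  have hlt' : ∀ v ∈ B, v.valuation K (y - x v) < v.valuation K (x v : K) := by
    intro v hv
    refine lt_of_lt_of_le (hlt v hv) ?_
    rw [map_mul]
    exact mul_le_of_le_one_left' (v_four_le _)
  have hyv : ∀ v ∈ B, v.valuation K y = v.valuation K (x v : K) := by
    intro v hv
    have := Valuation.map_add_eq_of_lt_right (v.valuation K) (hlt' v hv)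
    rwa [sub_add_cancel] at this
  have hy0 : y ≠ 0 := by
    rintro rfl
    have := hyv v0 hv0
    rw [map_zero] at this
    exact val_ne v0 _ this.symm
  exact ⟨Units.mk0 y hy0, fun v hv => ⟨hyv v hv, mem_locSq_of_near _ (hlt v hv)⟩⟩
end

section
variable {G : Type*} [CommGroup G]
lemma two_pow_le_relIndex {ι : Type*} (T : Finset ι) (H U : Subgroup G) (h0 : H.relIndex U ≠ 0) (y : ι → G) (Hi : ι → Subgroup G)
    (hyU : ∀ i ∈ T, y i ∈ U) (hH : ∀ i ∈ T, H ≤ Hi i) (h1 : ∀ i ∈ T, y i ∉ Hi i)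
    (h2 : ∀ i ∈ T, ∀ j ∈ T, j ≠ i → y j ∈ Hi i) : 2 ^ T.card ≤ H.relIndex U := by
  have key : ∀ I ∈ T.powerset, ∀ i ∈ T, (∏ j ∈ I, y j) ∈ Hi i ↔ i ∉ I := by
    intro I hI i hi
    rw [Finset.mem_powerset] at hI
    constructor
    · intro h hiI
      rw [← Finset.mul_prod_erase _ _ hiI] at h
      refine h1 i hi ((Subgroup.mul_mem_cancel_right _ ?_).mp h)
      exact Subgroup.prod_mem _ fun j hj => h2 i hi j (hI (Finset.mem_of_mem_erase hj)) (Finset.ne_of_mem_erase hj)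
    · intro h
      exact Subgroup.prod_mem _ fun j hj => h2 i hi j (hI hj) (by rintro rfl; exact h hj)
  have := card_le_relIndex H U h0 (fun I : T.powerset => ∏ j ∈ (I : Finset ι), y j)
    (fun I => Subgroup.prod_mem _ fun j hj => hyU j (Finset.mem_powerset.mp I.2 hj)) ?_
  · rwa [Nat.card_eq_fintype_card, Fintype.card_coe, Finset.card_powerset] at this
  intro I J hIJ
  apply Subtype.ext
  ext i
  by_cases hi : i ∈ T
  · have h3 := hH i hi hIJ
    have k1 := key I I.2 i hi
    have k2 := key J J.2 i hi
    have h4 : (∏ j ∈ (I : Finset ι), y j) ∈ Hi i ↔ (∏ j ∈ (J : Finset ι), y j) ∈ Hi i := by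
      constructor
      · intro h
        have := Subgroup.div_mem _ h h3
        simpa using this
      · intro h
        have := Subgroup.mul_mem _ h3 h
        simpa using this
    tauto
  · exact ⟨fun h => absurd (Finset.mem_powerset.mp I.2 h) hi, fun h => absurd (Finset.mem_powerset.mp J.2 h) hi⟩
end
end QH

end

section
namespace QH
open IsDedekindDomain NumberField WithZero
open scoped Classical
set_option linter.unusedSectionVars false
universe u

lemma exists_prime_notMem (K : Type*) [Field K] [NumberField K] (bad : Finset (HeightOneSpectrum (𝓞 K))) :
    ∃ v, v ∉ bad := by
  obtain ⟨N, hN⟩ : ∃ N, N = ∏ v ∈ bad, Ideal.absNorm v.asIdeal := ⟨_, rfl⟩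
  obtain ⟨p, hp1, hp⟩ := Nat.exists_infinite_primes (N + 1)
  have hnu : ¬ IsUnit ((p : 𝓞 K)) := by
    intro h
    have h1 := Ideal.absNorm_span_natCast (S := 𝓞 K) p
    rw [Ideal.span_singleton_eq_top.mpr h, Ideal.absNorm_top] at h1
    have h2 : Module.finrank ℤ (𝓞 K) ≠ 0 := Module.finrank_pos.ne'
    exact hp.one_lt.ne' ((pow_eq_one_iff.mp h1.symm).resolve_right h2)
  obtain ⟨M, hM, hpM⟩ := exists_max_ideal_of_mem_nonunits hnu
  have hM0 : M ≠ ⊥ := by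
    intro h
    rw [h, Ideal.mem_bot] at hpM
    exact hp.ne_zero (Nat.cast_eq_zero.mp hpM)
  obtain ⟨w, hw⟩ : ∃ w : HeightOneSpectrum (𝓞 K), w.asIdeal = M := ⟨⟨M, hM.isPrime, hM0⟩, rfl⟩
  refine ⟨w, fun hb => ?_⟩
  have hd : Ideal.absNorm M ∣ N := by
    rw [hN, ← hw]
    exact Finset.dvd_prod_of_mem (fun v : HeightOneSpectrum (𝓞 K) => Ideal.absNorm v.asIdeal) hb
  have hpos : 0 < N := by
    rw [hN]
    exact Finset.prod_pos fun v _ => Nat.pos_of_ne_zero (by rw [Ne, Ideal.absNorm_eq_zero_iff]; exact v.ne_bot)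
  have hlt : Ideal.absNorm M < p := lt_of_le_of_lt (Nat.le_of_dvd hpos hd) (Nat.lt_of_succ_le hp1)
  have hN0 : 0 < Ideal.absNorm M := Nat.pos_of_dvd_of_pos hd hpos
  have hco : Nat.Coprime (Ideal.absNorm M) p := by
    rw [Nat.coprime_comm, hp.coprime_iff_not_dvd]
    exact fun h => absurd (Nat.le_of_dvd hN0 h) (not_le.mpr hlt)
  have h1 : ((Ideal.absNorm M : ℕ) : 𝓞 K) ∈ M := Ideal.absNorm_mem M
  obtain ⟨a, b, hab⟩ := Nat.isCoprime_iff_coprime.mpr hco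
  apply hM.ne_top
  rw [Ideal.eq_top_iff_one]
  have : (1 : 𝓞 K) = a * (Ideal.absNorm M : ℕ) + b * (p : ℕ) := by
    have := congrArg (Int.cast : ℤ → 𝓞 K) hab
    push_cast at this
    exact this.symm
  rw [this]
  exact M.add_mem (M.mul_mem_left _ h1) (M.mul_mem_left _ hpM)

section
variable {K : Type u} [Field K] [NumberField K]

variable (K) in
/-- dyadic places -/
noncomputable def dyad : Finset (HeightOneSpectrum (𝓞 K)) := (finite_lg_ne (Units.mk0 (2 : K) two_ne_zero)).toFinset

lemma mem_dyad {v : HeightOneSpectrum (𝓞 K)} : v ∉ dyad K ↔ v.valuation K 2 = 1 := by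
  have := val_eq_one_iff v (Units.mk0 (2 : K) two_ne_zero)
  rw [Units.val_mk0] at this
  rw [this, dyad]
  simp

lemma inf_base [IsTotallyComplex K] {δ : Kˣ} (hδ : ¬ IsSquare (δ : K)) (hd : ∀ v ∈ dyad K, δ ∈ locSq (v.valuation K))
    (bad : Finset (HeightOneSpectrum (𝓞 K))) : ∃ v ∉ bad, δ ∉ locSq (v.valuation K) := by
  by_contra hcon
  push Not at hcon
  set B := bad.filter (fun v => δ ∉ locSq (v.valuation K)) with hB
  have hBv : ∀ v ∈ B, v.valuation K 2 = 1 ∧ δ ∉ locSq (v.valuation K) := by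
    intro v hv
    rw [hB, Finset.mem_filter] at hv
    refine ⟨?_, hv.2⟩
    rw [← mem_dyad]
    exact fun h => hv.2 (hd v h)
  have hx : ∀ v : HeightOneSpectrum (𝓞 K), ∃ y : Kˣ, v ∈ B → y ∉ locNorm (v.valuation K) (δ : K) ∧ ∀ w ∈ B, w ≠ v → y ∈ locSq (w.valuation K) := by
    intro v
    by_cases hv : v ∈ B
    · obtain ⟨x, hx⟩ := exists_not_locNorm v (hBv v hv).1 (hBv v hv).2
      obtain ⟨y, hy⟩ := weak_approx_unit B (fun w => if w = v then x else 1)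
      refine ⟨y, fun _ => ⟨?_, ?_⟩⟩
      · have h1 := (hy v hv).2
        rw [if_pos rfl] at h1
        intro h2
        apply hx
        have := Subgroup.div_mem _ h2 (locSq_le_locNorm _ h1)
        simpa using this
      · intro w hw hwv
        have h1 := (hy w hw).2
        rw [if_neg hwv] at h1
        simpa using h1
    · exact ⟨1, fun h => absurd h hv⟩
  choose y hy using hx
  choose Sy hSy using fun v => exists_SU (R := 𝓞 K) (y v)
  obtain ⟨Sδ, hSδ⟩ := exists_SU (R := 𝓞 K) δ
  obtain ⟨S, hSS, hcl⟩ := exists_ClS (K := K) (bad ∪ dyad K ∪ B.biUnion Sy ∪ Sδ)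
  have hk : (S.filter (fun v => δ ∉ locSq (v.valuation K))).card ≤ B.card := by
    apply Finset.card_le_card
    intro v hv
    rw [Finset.mem_filter] at hv
    rw [hB, Finset.mem_filter]
    refine ⟨?_, hv.2⟩
    by_contra h
    exact hv.2 (hcon v h)
  obtain ⟨h0, h1⟩ := lemmaH hδ S (fun v hv => mem_dyad.mp fun h => hv (hSS (by simp [h]))) hcl B.card hk ∅
    (fun v hv he => absurd (by rw [hSδ v (fun h => hv (hSS (by simp [h])))]; simp) he)
  have h2 := two_pow_le_relIndex B (normGrp (δ : K)) (SU K S) h0 y (fun v => locNorm (v.valuation K) (δ : K)) ?_ ?_ ?_ ?_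
  · simp at h1; have : 0 < 2 ^ B.card := by positivity
    omega
  · intro v hv
    refine SU_mono ?_ (hSy v)
    refine Finset.Subset.trans ?_ hSS
    intro w hw
    simp only [Finset.mem_union, Finset.mem_biUnion]
    exact Or.inl (Or.inr ⟨v, hv, hw⟩)
  · exact fun v _ => normGrp_le_locNorm _
  · exact fun v hv => (hy v hv).1
  · intro v hv w hw hwv
    exact locSq_le_locNorm _ ((hy w hw).2 v hv hwv.symm)

lemma QE.sq_of_sq {E : Type*} [Field E] [NumberField E] [Algebra K E] {ε : Kˣ} (q : QE K E (ε : K)) {x : Kˣ}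
    (h : IsSquare (algebraMap K E x)) : IsSquare (x : K) ∨ IsSquare ((ε * x : Kˣ) : K) := by
  obtain ⟨s, hs⟩ := h
  obtain ⟨a, b, hab⟩ := q.gen s
  have h1 : algebraMap K E (a ^ 2 + ε * b ^ 2 - x) + algebraMap K E (2 * a * b) * q.θ = 0 := by
    have hθ := q.hθ
    rw [hab] at hs
    simp only [map_add, map_sub, map_mul, map_pow, map_ofNat]
    linear_combination - hs - (algebraMap K E b) ^ 2 * hθ
  obtain ⟨h2, h3⟩ := q.indep h1
  rcases mul_eq_zero.mp h3 with h3 | h3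
  · have : a = 0 := by simpa using h3
    right
    refine ⟨ε * b, ?_⟩
    rw [Units.val_mul]
    subst this
    linear_combination - (ε : K) * h2
  · left
    subst h3
    exact ⟨a, by linear_combination - h2⟩

lemma not_sq_of_odd {x : Kˣ} {v : HeightOneSpectrum (𝓞 K)} (h : ¬ Even (lg v x)) : ¬ IsSquare (x : K) :=
  fun h' => h (locSq_even v (isSquare_mem_locSq _ h'))

lemma inf_gen [IsTotallyComplex K] {δ : Kˣ} (hδ : ¬ IsSquare (δ : K))
    (bad : Finset (HeightOneSpectrum (𝓞 K))) : ∃ v ∉ bad, δ ∉ locSq (v.valuation K) := by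
  obtain ⟨Sδ, hSδ⟩ := exists_SU (R := 𝓞 K) δ
  obtain ⟨p, hp⟩ := exists_prime_notMem K (dyad K ∪ Sδ)
  rw [Finset.mem_union, not_or] at hp
  obtain ⟨π, hπ⟩ := exists_lg K p 1
  obtain ⟨y, hy⟩ := weak_approx_unit (insert p (dyad K)) (fun w => if w = p then π else 1)
  have hyp : lg p y = 1 := by
    have := (hy p (by simp)).1
    rwa [if_pos rfl, val_eq_val_iff, hπ] at this
  have hyd : ∀ v ∈ dyad K, y ∈ locSq (v.valuation K) := by
    intro v hv
    have := (hy v (by simp [hv])).2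
    rw [if_neg (by rintro rfl; exact hp.1 hv)] at this
    simpa using this
  have hδp : lg p δ = 0 := hSδ p hp.2
  have hns : ¬ IsSquare ((δ * y : Kˣ) : K) := not_sq_of_odd (v := p) (by rw [lg_mul, hδp, hyp]; decide)
  have hyns : ¬ IsSquare ((y : Kˣ) : K) := not_sq_of_odd (v := p) (by rw [hyp]; decide)
  obtain ⟨E, _, _, _, ⟨q⟩⟩ := exists_QE K hns
  have hE : IsTotallyComplex E := isTotallyComplex_of_algebra K E
  have hδE : ¬ IsSquare ((ua K E δ : Eˣ) : E) := by
    intro h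
    rcases q.sq_of_sq h with h | h
    · exact hδ h
    · apply hyns
      obtain ⟨s, hs⟩ := h
      refine ⟨s / δ, ?_⟩
      have : (δ : K) ≠ 0 := δ.ne_zero
      simp only [Units.val_mul] at hs
      field_simp
      linear_combination hs
  obtain ⟨w, hw1, hw2⟩ := inf_base hδE (fun w hw => by
    have hv : below (K := K) w ∈ dyad K := by
      by_contra h
      rw [mem_dyad, ← below_eq_one, map_ofNat, ← mem_dyad] at h
      exact h hw
    have h1 := below_locSq (hyd _ hv)
    have h2 : ua K E (δ * y) ∈ locSq (w.valuation E) := isSquare_mem_locSq _ ⟨q.θ, by rw [ua_val, ← q.hθ, sq]⟩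
    have h3 := Subgroup.div_mem _ h2 h1
    rw [map_mul] at h3
    rwa [mul_div_cancel_right] at h3) (above E bad)
  rw [mem_above] at hw1
  exact ⟨below w, hw1, fun h => hw2 (below_locSq h)⟩

/-- Claim C -/
lemma claimC [IsTotallyComplex K] {δ m : Kˣ} (hδ : ¬ IsSquare (δ : K)) (hδm : ¬ IsSquare ((m * δ : Kˣ) : K))
    (bad : Finset (HeightOneSpectrum (𝓞 K))) : ∃ v ∉ bad, δ ∉ locSq (v.valuation K) ∧ m ∈ locSq (v.valuation K) := by
  by_cases hm : IsSquare (m : K)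
  · obtain ⟨v, h1, h2⟩ := inf_gen hδ bad
    exact ⟨v, h1, h2, isSquare_mem_locSq _ hm⟩
  obtain ⟨E, _, _, _, ⟨q⟩⟩ := exists_QE K hm
  have hE : IsTotallyComplex E := isTotallyComplex_of_algebra K E
  have hδE : ¬ IsSquare ((ua K E δ : Eˣ) : E) := by
    intro h
    rcases q.sq_of_sq h with h | h
    · exact hδ h
    · exact hδm h
  obtain ⟨Sδ, hSδ⟩ := exists_SU (R := 𝓞 K) δ
  obtain ⟨Sm, hSm⟩ := exists_SU (R := 𝓞 K) m
  obtain ⟨w, hw1, hw2⟩ := inf_gen hδE (above E (bad ∪ dyad K ∪ Sδ ∪ Sm))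
  rw [mem_above] at hw1
  simp only [Finset.mem_union, not_or] at hw1
  obtain ⟨⟨⟨hb, hd⟩, h1⟩, h2⟩ := hw1
  have hδv : δ ∉ locSq ((below w).valuation K) := fun h => hw2 (below_locSq h)
  refine ⟨below w, hb, hδv, ?_⟩
  by_contra hmv
  apply hw2
  have h3 := below_locSq (mul_nonsq _ (mem_dyad.mp hd) (hSδ _ h1) (hSm _ h2) hδv hmv)
  have h4 : ua K E m ∈ locSq (w.valuation E) := isSquare_mem_locSq _ ⟨q.θ, by rw [ua_val, ← q.hθ, sq]⟩
  have h5 := Subgroup.div_mem _ h3 h4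
  rw [map_mul] at h5
  rwa [mul_div_cancel_right] at h5
end
end QH

end

section
namespace QH
open IsDedekindDomain NumberField WithZero
open scoped Classical
set_option linter.unusedSectionVars false
universe u
section
variable {K : Type u} [Field K] [NumberField K]

lemma SU_sqrt {S : Finset (HeightOneSpectrum (𝓞 K))} {x : Kˣ} (hx : x ∈ SU K S) (h : IsSquare (x : K)) :
    x ∈ (SU K S).map (powMonoidHom 2) := by
  obtain ⟨s, hs⟩ := h
  have hs0 : s ≠ 0 := by rintro rfl; simp at hs
  have : x = (Units.mk0 s hs0) ^ 2 := by ext; simp [hs, sq]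
  refine ⟨Units.mk0 s hs0, ?_, this.symm⟩
  intro v hv
  have h1 := hx v hv
  rw [this, lg_pow] at h1
  simpa using h1

/-- elements which are squares or ε times squares -/
def sqε (ε : Kˣ) : Subgroup Kˣ where
  carrier := {x | IsSquare (x : K) ∨ IsSquare ((ε * x : Kˣ) : K)}
  one_mem' := Or.inl (by simp)
  mul_mem' := by
    rintro x y hx hy
    simp only [Set.mem_ofPred_eq, Units.val_mul] at *
    rcases hx with ⟨a, ha⟩ | ⟨a, ha⟩ <;> rcases hy with ⟨b, hb⟩ | ⟨b, hb⟩
    · exact Or.inl ⟨a * b, by rw [ha, hb]; ring⟩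
    · exact Or.inr ⟨a * b, by linear_combination (ε * y : K) * ha + a * a * hb⟩
    · exact Or.inr ⟨a * b, by linear_combination (y : K) * ha + a * a * hb⟩
    · have : (ε : K) ≠ 0 := ε.ne_zero
      refine Or.inl ⟨a * b / ε, ?_⟩
      field_simp
      linear_combination (ε * y : K) * ha + a * a * hb
  inv_mem' := by
    rintro x hx
    have hε : (ε : K) ≠ 0 := ε.ne_zero
    have hx0 : (x : K) ≠ 0 := x.ne_zero
    simp only [Set.mem_ofPred_eq, Units.val_mul, Units.val_inv_eq_inv_val] at *
    rcases hx with ⟨a, ha⟩ | ⟨a, ha⟩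
    · exact Or.inl ⟨a / x, by field_simp; linear_combination ha⟩
    · exact Or.inr ⟨a / x, by field_simp; linear_combination ha⟩

lemma locSq_pattern (v : HeightOneSpectrum (𝓞 K)) (h2 : v.valuation K 2 = 1) {x y : Kˣ} (hx : lg v x = 0) (hy : lg v y = 0)
    (h : x ∈ locSq (v.valuation K) ↔ y ∈ locSq (v.valuation K)) : x / y ∈ locSq (v.valuation K) := by
  by_cases hx' : x ∈ locSq (v.valuation K)
  · exact Subgroup.div_mem _ hx' (h.mp hx')
  · rw [mul_mem_locSq_comm]
    exact mul_nonsq v h2 hx hy hx' (fun h' => hx' (h.mpr h'))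

/-- choose auxiliary primes with dual units -/
lemma exists_aux [IsTotallyComplex K] (ε : Kˣ) (S : Finset (HeightOneSpectrum (𝓞 K))) (hdS : dyad K ⊆ S) (j : ℕ)
    (hj : j + 1 ≤ Units.rank K + S.card + 1) :
    ∃ (T : Finset (HeightOneSpectrum (𝓞 K))) (u : HeightOneSpectrum (𝓞 K) → Kˣ), T.card = j ∧ (∀ q ∈ T, q ∉ S ∧
      ε ∈ locSq (q.valuation K) ∧ u q ∈ SU K S ∧ u q ∉ locSq (q.valuation K)) ∧ ∀ q ∈ T, ∀ q' ∈ T, q' ≠ q → u q' ∈ locSq (q.valuation K) := by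
  induction j with
  | zero => exact ⟨∅, fun _ => 1, by simp, by simp, by simp⟩
  | succ j ih =>
    obtain ⟨T, u, hT, h1, h2⟩ := ih (by omega)
    have hx : ∃ x ∈ SU K S, (∀ q ∈ T, x ∈ locSq (q.valuation K)) ∧ x ∉ sqε ε := by
      by_contra hcon
      push Not at hcon
      have i1 : (sqε ε ⊓ SU K S).relIndex (SU K S) ≤ 2 ^ j := by
        have := (relIndex_le_of_fun (sqε ε ⊓ SU K S) (SU K S) (fun x => fun q : T => x ∈ locSq ((q : HeightOneSpectrum (𝓞 K)).valuation K)) ?_).2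
        · simpa [hT] using this
        intro x hx y hy hxy
        have hd := Subgroup.div_mem _ hx hy
        refine ⟨hcon _ hd fun q hq => ?_, hd⟩
        have hqS := (h1 q hq).1
        exact locSq_pattern q (mem_dyad.mp fun h => hqS (hdS h)) (hx q hqS) (hy q hqS)
          (iff_of_eq (congrFun hxy ⟨q, hq⟩))
      have i2 : ((SU K S).map (powMonoidHom 2)).relIndex (sqε ε ⊓ SU K S) ≤ 2 := by
        have := (relIndex_le_of_fun ((SU K S).map (powMonoidHom 2)) (sqε ε ⊓ SU K S) (fun x => IsSquare (x : K)) ?_).2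
        · simpa using this
        intro x hx y hy hxy
        refine SU_sqrt (Subgroup.div_mem _ hx.2 hy.2) ?_
        have hε : (ε : K) ≠ 0 := ε.ne_zero
        have hy0 : (y : K) ≠ 0 := y.ne_zero
        rw [Units.val_div_eq_div_val]
        by_cases hsx : IsSquare (x : K)
        · exact hsx.div ((iff_of_eq hxy).mp hsx)
        · have e1 := hx.1.resolve_left hsx
          have e2 := hy.1.resolve_left (fun h => hsx ((iff_of_eq hxy).mpr h))
          have := e1.div e2
          rw [Units.val_mul, Units.val_mul] at this
          rwa [mul_div_mul_left _ _ hε] at this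
      have i3 := Subgroup.relIndex_mul_relIndex ((SU K S).map (powMonoidHom 2)) (sqε ε ⊓ SU K S) (SU K S) ?_ inf_le_right
      · rw [SU_sq] at i3
        have : 2 ^ (j + 1 + 1) ≤ 2 ^ (Units.rank K + S.card + 1) := Nat.pow_le_pow_right (by norm_num) hj
        rw [← i3] at this
        have h4 := this.trans (Nat.mul_le_mul i2 i1)
        rw [pow_succ, pow_succ] at h4
        have : 0 < 2 ^ j := by positivity
        omega
      · rintro _ ⟨x, hx, rfl⟩
        refine ⟨Or.inl ⟨x, by simp [sq]⟩, Subgroup.pow_mem _ hx 2⟩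
    obtain ⟨x, hxS, hxT, hxε⟩ := hx
    obtain ⟨q, hq, hq1, hq2⟩ := claimC (δ := x) (m := ε) (fun h => hxε (Or.inl h)) (fun h => hxε (Or.inr h)) (S ∪ T)
    rw [Finset.mem_union, not_or] at hq
    have hq2v := mem_dyad.mp fun h => hq.1 (hdS h)
    refine ⟨insert q T, fun p => if p = q then x else if u p ∈ locSq (q.valuation K) then u p else u p * x, ?_, ?_, ?_⟩
    · rw [Finset.card_insert_of_notMem hq.2, hT]
    · intro p hp0
      rcases Finset.mem_insert.mp hp0 with rfl | hp
      · simp only [if_true]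
        exact ⟨hq.1, hq2, hxS, hq1⟩
      · have hpq : p ≠ q := by rintro rfl; exact hq.2 hp
        obtain ⟨g1, g2, g3, g4⟩ := h1 p hp
        simp only [if_neg hpq]
        refine ⟨g1, g2, ?_, ?_⟩
        · split_ifs
          · exact g3
          · exact Subgroup.mul_mem _ g3 hxS
        · split_ifs
          · exact g4
          · rwa [Subgroup.mul_mem_cancel_right _ (hxT p hp)]
    · intro p hp0 p' hp0' hne
      rcases Finset.mem_insert.mp hp0' with rfl | hp'
      · have hp := (Finset.mem_insert.mp hp0).resolve_left hne.symm
        simp only [if_true]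
        exact hxT p hp
      · have hpq' : p' ≠ q := by rintro rfl; exact hq.2 hp'
        simp only [if_neg hpq']
        rcases Finset.mem_insert.mp hp0 with rfl | hp
        · split_ifs with h
          · exact h
          · exact mul_nonsq p hq2v ((h1 p' hp').2.2.1 p hq.1) (hxS p hq.1) h hq1
        · split_ifs
          · exact h2 p hp p' hp' hne
          · exact Subgroup.mul_mem _ (h2 p hp p' hp' hne) (hxT p hp)

lemma not_locNorm_of_odd (v : HeightOneSpectrum (𝓞 K)) (h2 : v.valuation K 2 = 1) {y u : Kˣ} (hy : ¬ Even (lg v y))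
    (hu : lg v u = 0) (hus : u ∉ locSq (v.valuation K)) : u ∉ locNorm (v.valuation K) (y : K) := by
  rw [mem_locNorm]
  rintro ⟨x, ⟨a, b, hab⟩, z, hz, rfl⟩
  apply hus
  refine Subgroup.mul_mem _ ?_ hz
  have hn : a ^ 2 - (y : K) * b ^ 2 ≠ 0 := by rw [← hab]; exact x.ne_zero
  have hev : Even (lg v x) := by
    rw [lg_mul] at hu
    have := locSq_even v hz
    have e : lg v x = - lg v z := by omega
    rw [e]; exact this.neg
  rcases norm_odd v hy hn with ⟨h0, h1⟩ | ⟨h0, h1⟩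
  · have e1 : x / (Units.mk0 a h0) ^ 2 ∈ locSq (v.valuation K) := by
      apply mem_locSq_of_near
      rw [map_mul, four_val v h2, one_mul]
      simp only [Units.val_pow_eq_pow_val, Units.val_mk0]
      rw [hab]
      have : a ^ 2 - (y : K) * b ^ 2 - a ^ 2 = - ((y : K) * b ^ 2) := by ring
      rw [this, Valuation.map_neg]; exact h1
    have := Subgroup.mul_mem _ e1 (sq_mem_locSq (v.valuation K) (Units.mk0 a h0))
    simpa using this
  · exfalso
    have e1 : v.valuation K (x : K) = v.valuation K ((y * (Units.mk0 b h0) ^ 2 : Kˣ) : K) := by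
      simp only [Units.val_mul, Units.val_pow_eq_pow_val, Units.val_mk0]
      rw [hab, Valuation.map_sub_eq_of_lt_right _ h1]
    rw [val_eq_val_iff, lg_mul, lg_pow] at e1
    apply hy
    have e : lg v y = lg v x - 2 * lg v (Units.mk0 b h0) := by push_cast at e1; omega
    rw [e]
    exact hev.sub (even_two_mul _)

lemma propD [IsTotallyComplex K] (S T : Finset (HeightOneSpectrum (𝓞 K))) (hdS : dyad K ⊆ S) (hcl : ClS K S)
    (u : HeightOneSpectrum (𝓞 K) → Kˣ) (h1 : ∀ q ∈ T, q ∉ S ∧ u q ∈ SU K S ∧ u q ∉ locSq (q.valuation K)) 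
    (h2 : ∀ q ∈ T, ∀ q' ∈ T, q' ≠ q → u q' ∈ locSq (q.valuation K)) {y : Kˣ} (hy : y ∈ SU K (S ∪ T))
    (hyS : ∀ v ∈ S, y ∈ locSq (v.valuation K)) : IsSquare (y : K) := by
  by_contra hns
  set O := T.filter (fun q => ¬ Even (lg q y)) with hO
  obtain ⟨h0, h3⟩ := lemmaH hns S (fun v hv => mem_dyad.mp fun h => hv (hdS h)) hcl 0 
    (by rw [Finset.filter_false_of_mem (fun v hv => by simpa using hyS v hv)]; simp) O
    (fun v hv he => by
      rw [hO, Finset.mem_filter]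
      refine ⟨?_, he⟩
      by_contra hvT
      rw [hy v (by simp [hv, hvT])] at he
      simp at he)
  have h4 := two_pow_le_relIndex O (normGrp (y : K)) (SU K S) h0 u (fun q => locNorm (q.valuation K) (y : K)) ?_ ?_ ?_ ?_
  · have : 0 < 2 ^ O.card := by positivity
    rw [zero_add] at h3
    omega
  · exact fun q hq => (h1 q (Finset.mem_of_mem_filter _ hq)).2.1
  · exact fun q _ => normGrp_le_locNorm _
  · intro q hq
    rw [hO, Finset.mem_filter] at hq
    obtain ⟨g1, g2, g3⟩ := h1 q hq.1
    exact not_locNorm_of_odd q (mem_dyad.mp fun h => g1 (hdS h)) hq.2 (g2 q g1) g3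
  · intro q hq q' hq' hne
    exact locSq_le_locNorm _ (h2 q (Finset.mem_of_mem_filter _ hq) q' (Finset.mem_of_mem_filter _ hq') hne)
end
end QH

end

section
namespace QH
open IsDedekindDomain NumberField WithZero
open scoped Classical
set_option linter.unusedSectionVars false
universe u
section
variable {K : Type u} [Field K] [NumberField K]

/-- ramification of 2 -/
noncomputable def ev (v : HeightOneSpectrum (𝓞 K)) : ℕ := (- lg v (Units.mk0 (2 : K) two_ne_zero)).toNat

lemma ev_spec (v : HeightOneSpectrum (𝓞 K)) : v.valuation K 2 = exp (-(ev v : ℤ)) := by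
  have h1 := val_eq_exp v (Units.mk0 (2 : K) two_ne_zero)
  rw [Units.val_mk0] at h1
  have h2 := v_two_le (v.valuation K)
  rw [h1] at h2 ⊢
  rw [← exp_zero, exp_le_exp] at h2
  rw [exp_inj, ev]; omega

lemma ev_prod (S : Finset (HeightOneSpectrum (𝓞 K))) :
    ∏ v ∈ S, Nat.card (𝓞 K ⧸ v.asIdeal) ^ ev v ≤ 2 ^ Module.finrank ℚ K := by
  have h1 : ∏ v ∈ S, v.asIdeal ^ ev v ∣ Ideal.span {((2 : ℕ) : 𝓞 K)} := by
    apply Finset.prod_dvd_of_coprime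
    · intro v _ w _ hvw
      apply IsCoprime.pow
      have := v.isMaximal
      have := w.isMaximal
      rw [Ideal.isCoprime_iff_sup_eq]
      exact Ideal.IsMaximal.coprime_of_ne inferInstance inferInstance (fun h => hvw (HeightOneSpectrum.ext h))
    · intro v _
      rw [← HeightOneSpectrum.intValuation_le_pow_iff_dvd, ← HeightOneSpectrum.valuation_of_algebraMap (K := K)]
      have e : algebraMap (𝓞 K) K ((2 : ℕ) : 𝓞 K) = 2 := (map_natCast (algebraMap (𝓞 K) K) 2).trans Nat.cast_ofNat
      exact (congrArg (v.valuation K) e).trans_le (ev_spec v).le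
  have h2 := map_dvd Ideal.absNorm h1
  rw [Ideal.absNorm_span_natCast, RingOfIntegers.rank, map_prod] at h2
  simp only [map_pow] at h2
  exact Nat.le_of_dvd (by positivity) h2

lemma nat_card_pi_le {U' A : Subgroup Kˣ} (S : Finset (HeightOneSpectrum (𝓞 K))) (N L : HeightOneSpectrum (𝓞 K) → Subgroup Kˣ)
    (hfin : ∀ v ∈ S, (L v).relIndex (N v) ≠ 0) (h1 : ∀ x ∈ U', ∀ v ∈ S, x ∈ N v) (h2 : ∀ x ∈ U', (∀ v ∈ S, x ∈ L v) → x ∈ A) :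
    A.relIndex U' ≤ ∏ v ∈ S, (L v).relIndex (N v) := by
  have : ∀ v : S, Finite (N v ⧸ (L v).subgroupOf (N v)) := fun v => Nat.finite_of_card_ne_zero (hfin v v.2)
  have h3 := (relIndex_le_of_fun A U' (fun x => fun v : S => if h : x ∈ N v then ((⟨x, h⟩ : N v) : N v ⧸ (L v).subgroupOf (N v)) else 1) ?_).2
  · rw [Nat.card_pi] at h3
    rw [← Finset.prod_coe_sort]
    exact h3
  · intro x hx y hy hxy
    apply h2 _ (Subgroup.div_mem _ hx hy)
    intro v hv
    have h4 := congrFun hxy ⟨v, hv⟩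
    simp only [dif_pos (h1 x hx v hv), dif_pos (h1 y hy v hv)] at h4
    have h5 := QuotientGroup.eq.mp h4.symm
    rw [Subgroup.mem_subgroupOf] at h5
    rw [div_eq_mul_inv, mul_comm]
    exact h5

theorem thmN_core [IsTotallyComplex K] {ε α : Kˣ} (hε : ∀ v ∈ dyad K, ε ∈ locSq (v.valuation K))
    (hα : ∀ v : HeightOneSpectrum (𝓞 K), α ∈ locNorm (v.valuation K) (ε : K)) : α ∈ normGrp (ε : K) := by
  by_cases hns : IsSquare (ε : K)
  · rw [normGrp_eq_top_of_sq hns ε.ne_zero]; trivial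
  obtain ⟨Sε, hSε⟩ := exists_SU (R := 𝓞 K) ε
  obtain ⟨Sα, hSα⟩ := exists_SU (R := 𝓞 K) α
  obtain ⟨S, hSS, hcl⟩ := exists_ClS (K := K) (dyad K ∪ Sε ∪ Sα)
  have hdS : dyad K ⊆ S := fun v hv => hSS (by simp [hv])
  obtain ⟨T, u, hT, h1, h2⟩ := exists_aux ε S hdS (Units.rank K + S.card) le_rfl
  have hdisj : Disjoint S T := Finset.disjoint_right.mpr fun q hq => (h1 q hq).1
  set U' := SU K (S ∪ T) with hU'
  set J : Subgroup Kˣ := ⨅ v : S, locNorm ((v : HeightOneSpectrum (𝓞 K)).valuation K) (ε : K) with hJ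
  have hJm : ∀ x, x ∈ J ↔ ∀ v ∈ S, x ∈ locNorm (v.valuation K) (ε : K) := by
    intro x
    rw [hJ, Subgroup.mem_iInf]
    exact ⟨fun h v hv => h ⟨v, hv⟩, fun h v => h v v.2⟩
  set B := S.filter (fun v => ε ∉ locSq (v.valuation K)) with hB
  have hεS : ∀ v ∉ S, lg v ε = 0 := fun v hv => hSε v fun h => hv (hSS (by simp [h]))
  have hk : ((S ∪ T).filter (fun v => ε ∉ locSq (v.valuation K))).card ≤ B.card := by
    apply Finset.card_le_card
    intro v hv
    rw [Finset.mem_filter, Finset.mem_union] at hv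
    rw [hB, Finset.mem_filter]
    refine ⟨hv.1.resolve_right fun h => hv.2 (h1 v h).2.1, hv.2⟩
  obtain ⟨c0, c1⟩ := lemmaH hns (S ∪ T) (fun v hv => mem_dyad.mp fun h => hv (by simp [hdS h]))
    (hcl.mono Finset.subset_union_left) B.card hk ∅ (fun v hv he => by
      rw [hεS v (fun h => hv (by simp [h]))] at he; simp at he)
  rw [← hU', Finset.card_empty, add_zero] at c1
  rw [← hU'] at c0
  -- local indices
  have hg : ∀ v : HeightOneSpectrum (𝓞 K), (locSq (v.valuation K)).relIndex (locNorm (v.valuation K) (ε : K)) ≠ 0 ∧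
      (if v ∈ B then 2 else 1) * (locSq (v.valuation K)).relIndex (locNorm (v.valuation K) (ε : K)) ≤ 4 * Nat.card (𝓞 K ⧸ v.asIdeal) ^ ev v := by
    intro v
    obtain ⟨i1, i2⟩ := locSq_index v (ev_spec v)
    have i3 := Subgroup.relIndex_mul_index (locSq_le_locNorm (v.valuation K) (ε := (ε : K)))
    have i4 : (locSq (v.valuation K)).relIndex (locNorm (v.valuation K) (ε : K)) ≠ 0 := by
      intro h; rw [h, zero_mul] at i3; exact i1 i3.symm
    have i5 : (locNorm (v.valuation K) (ε : K)).index ≠ 0 := by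
      intro h; rw [h, mul_zero] at i3; exact i1 i3.symm
    refine ⟨i4, le_trans ?_ i2⟩
    rw [← i3, mul_comm]
    refine Nat.mul_le_mul_left _ ?_
    split_ifs with hvB
    · rw [hB, Finset.mem_filter] at hvB
      have hvd : v.valuation K 2 = 1 := mem_dyad.mp fun h => hvB.2 (hε v h)
      obtain ⟨x, hx⟩ := exists_not_locNorm v hvd hvB.2
      have : (locNorm (v.valuation K) (ε : K)).index ≠ 1 := by
        rw [Ne, Subgroup.index_eq_one]; intro h; rw [h] at hx; exact hx trivial
      omega
    · omega
  have c2 : 2 ^ B.card * ∏ v ∈ S, (locSq (v.valuation K)).relIndex (locNorm (v.valuation K) (ε : K)) ≤ 4 ^ S.card * 2 ^ Module.finrank ℚ K := by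
    have e1 : 2 ^ B.card = ∏ v ∈ S, (if v ∈ B then 2 else 1) := by
      rw [Finset.prod_ite_mem, Finset.prod_const]
      congr 2
      exact (Finset.inter_eq_right.mpr (Finset.filter_subset _ _)).symm
    rw [e1, ← Finset.prod_mul_distrib]
    refine (Finset.prod_le_prod' fun v _ => (hg v).2).trans ?_
    rw [Finset.prod_mul_distrib, Finset.prod_const]
    exact Nat.mul_le_mul_left _ (ev_prod S)
  have c3 : ((U').map (powMonoidHom 2)).relIndex (J ⊓ U') ≤ ∏ v ∈ S, (locSq (v.valuation K)).relIndex (locNorm (v.valuation K) (ε : K)) := by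
    apply nat_card_pi_le S _ _ (fun v _ => (hg v).1)
    · intro x hx v hv
      exact (hJm x).mp hx.1 v hv
    · intro x hx h
      exact SU_sqrt hx.2 (propD S T hdS hcl u (fun q hq => ⟨(h1 q hq).1, (h1 q hq).2.2⟩) h2 hx.2 h)
  have c4 := Subgroup.relIndex_mul_relIndex ((U').map (powMonoidHom 2)) (J ⊓ U') U' ?_ inf_le_right
  swap
  · rintro _ ⟨x, hx, rfl⟩
    exact ⟨(hJm _).mpr fun v hv => sq_mem_locNorm _ x, Subgroup.pow_mem _ hx 2⟩
  rw [hU', SU_sq, ← hU', Finset.card_union_of_disjoint hdisj, hT] at c4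
  have r1 := rank_tc K
  have hNJ : normGrp (ε : K) ⊓ U' ≤ J ⊓ U' := inf_le_inf_right _ fun x hx => (hJm x).mpr fun v _ => normGrp_le_locNorm _ hx
  have c5 := Subgroup.relIndex_mul_relIndex (normGrp (ε : K) ⊓ U') (J ⊓ U') U' hNJ inf_le_right
  rw [Subgroup.inf_relIndex_right (normGrp (ε : K)) U'] at c5
  have c6 : 2 ^ B.card ≤ 2 * (J ⊓ U').relIndex U' := by
    have hp : 0 < 2 ^ (Units.rank K + (S.card + (Units.rank K + S.card)) + 1) := by positivity
    refine Nat.le_of_mul_le_mul_right ?_ hp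
    have e2 : 4 ^ S.card * 2 ^ Module.finrank ℚ K = 2 * 2 ^ (Units.rank K + (S.card + (Units.rank K + S.card)) + 1) := by
      rw [← r1, show (4 : ℕ) = 2 ^ 2 from rfl, ← pow_mul, ← pow_add, ← pow_succ']
      congr 1; ring
    calc _ = (2 ^ B.card * ((U').map (powMonoidHom 2)).relIndex (J ⊓ U')) * (J ⊓ U').relIndex U' := by rw [← c4]; ring
      _ ≤ (2 * 2 ^ (Units.rank K + (S.card + (Units.rank K + S.card)) + 1)) * (J ⊓ U').relIndex U' := by
          rw [← e2]
          exact Nat.mul_le_mul_right _ ((Nat.mul_le_mul_left _ c3).trans c2)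
      _ = _ := by ring
  have c7 : (normGrp (ε : K) ⊓ U').relIndex (J ⊓ U') = 1 := by
    have n1 : (normGrp (ε : K) ⊓ U').relIndex (J ⊓ U') ≠ 0 := by
      intro h; rw [h, zero_mul] at c5; exact c0 c5.symm
    have n2 : 0 < (J ⊓ U').relIndex U' := by
      have : 0 < 2 ^ B.card := by positivity
      omega
    have n3 : (normGrp (ε : K) ⊓ U').relIndex (J ⊓ U') * (J ⊓ U').relIndex U' ≤ 1 * (J ⊓ U').relIndex U' := by
      rw [c5]; omega
    have := Nat.le_of_mul_le_mul_right n3 n2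
    omega
  rw [Subgroup.relIndex_eq_one] at c7
  have hαU : α ∈ J ⊓ U' := ⟨(hJm α).mpr fun v _ => hα v, fun v hv => hSα v fun h => hv (Finset.mem_union_left _ (hSS (by simp [h])))⟩
  exact (c7 hαU).1
end
end QH

end

section
namespace QH
open IsDedekindDomain NumberField WithZero
open scoped Classical
set_option linter.unusedSectionVars false
universe u

lemma cw3 {k : Type*} [Field k] [Finite k] (p q r s t u : k) :
    ∃ a b c : k, (a ≠ 0 ∨ b ≠ 0 ∨ c ≠ 0) ∧ p * a ^ 2 + q * b ^ 2 + r * c ^ 2 + s * (a * b) + t * (a * c) + u * (b * c) = 0 := by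
  have := Fintype.ofFinite k
  obtain ⟨ch, hch⟩ := CharP.exists k
  let f : MvPolynomial (Fin 3) k := .C p * .X 0 ^ 2 + .C q * .X 1 ^ 2 + .C r * .X 2 ^ 2 + .C s * (.X 0 * .X 1) + .C t * (.X 0 * .X 2) + .C u * (.X 1 * .X 2)
  have hC : ∀ (z : k) (g : MvPolynomial (Fin 3) k), g.totalDegree ≤ 2 → (MvPolynomial.C z * g).totalDegree ≤ 2 := by
    intro z g hg
    refine (MvPolynomial.totalDegree_mul _ _).trans ?_
    rw [MvPolynomial.totalDegree_C, zero_add]; exact hg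
  have hX : ∀ i j : Fin 3, (MvPolynomial.X i * MvPolynomial.X j : MvPolynomial (Fin 3) k).totalDegree ≤ 2 := by
    intro i j
    refine (MvPolynomial.totalDegree_mul _ _).trans ?_
    rw [MvPolynomial.totalDegree_X, MvPolynomial.totalDegree_X]
  have hA : ∀ g h : MvPolynomial (Fin 3) k, g.totalDegree ≤ 2 → h.totalDegree ≤ 2 → (g + h).totalDegree ≤ 2 :=
    fun g h h1 h2 => (MvPolynomial.totalDegree_add _ _).trans (max_le h1 h2)
  have hf : f.totalDegree < Fintype.card (Fin 3) := by
    rw [Fintype.card_fin]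
    refine Nat.lt_succ_of_le ?_
    simp only [f, sq]
    refine hA _ _ (hA _ _ (hA _ _ (hA _ _ (hA _ _ ?_ ?_) ?_) ?_) ?_) ?_ <;> exact hC _ _ (hX _ _)
  have hd := char_dvd_card_solutions ch hf
  have hp : ch ≠ 1 := CharP.char_ne_one k ch
  by_contra! hcon
  have h1 : Fintype.card { x : Fin 3 → k // MvPolynomial.eval x f = 0 } = 1 := by
    rw [Fintype.card_eq_one_iff]
    refine ⟨⟨0, by simp [f]⟩, ?_⟩
    rintro ⟨x, hx⟩
    rw [Subtype.mk.injEq]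
    by_contra hx0
    refine hcon (x 0) (x 1) (x 2) ?_ (by simpa [f] using hx)
    by_contra! h3
    exact hx0 (by ext i; fin_cases i <;> simp [h3])
  rw [h1] at hd
  exact hp (Nat.dvd_one.mp hd)

section
variable {R : Type*} [CommRing R] [IsDedekindDomain R] {K : Type*} [Field K] [Algebra R K] [IsFractionRing R K]
  (v : HeightOneSpectrum R) [Finite (R ⧸ v.asIdeal)]

lemma cwL {p q r s t u : K} (hp : v.valuation K p ≤ 1) (hq : v.valuation K q ≤ 1) (hr : v.valuation K r ≤ 1)
    (hs : v.valuation K s ≤ 1) (ht : v.valuation K t ≤ 1) (hu : v.valuation K u ≤ 1) :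
    ∃ a b c : K, v.valuation K a ≤ 1 ∧ v.valuation K b ≤ 1 ∧ v.valuation K c ≤ 1 ∧
      (v.valuation K a = 1 ∨ v.valuation K b = 1 ∨ v.valuation K c = 1) ∧
      v.valuation K (p * a ^ 2 + q * b ^ 2 + r * c ^ 2 + s * (a * b) + t * (a * c) + u * (b * c)) < 1 := by
  have := v.isMaximal
  let _ := Ideal.Quotient.field v.asIdeal
  obtain ⟨p', hp'⟩ := exists_residue v hp
  obtain ⟨q', hq'⟩ := exists_residue v hq
  obtain ⟨r', hr'⟩ := exists_residue v hr
  obtain ⟨s', hs'⟩ := exists_residue v hs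
  obtain ⟨t', ht'⟩ := exists_residue v ht
  obtain ⟨u', hu'⟩ := exists_residue v hu
  let m := Ideal.Quotient.mk v.asIdeal
  obtain ⟨a, b, c, h1, h2⟩ := cw3 (k := R ⧸ v.asIdeal) (m p') (m q') (m r') (m s') (m t') (m u')
  obtain ⟨a, rfl⟩ := Ideal.Quotient.mk_surjective a
  obtain ⟨b, rfl⟩ := Ideal.Quotient.mk_surjective b
  obtain ⟨c, rfl⟩ := Ideal.Quotient.mk_surjective c
  refine ⟨algebraMap R K a, algebraMap R K b, algebraMap R K c, HeightOneSpectrum.valuation_le_one _ _,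
    HeightOneSpectrum.valuation_le_one _ _, HeightOneSpectrum.valuation_le_one _ _, ?_, ?_⟩
  · rw [val_alg_eq_one, val_alg_eq_one, val_alg_eq_one]
    simpa only [Ne, Ideal.Quotient.eq_zero_iff_mem] using h1
  · simp only [m, ← map_mul, ← map_pow, ← map_add] at h2
    rw [Ideal.Quotient.eq_zero_iff_mem, ← val_alg_lt_one (K := K)] at h2
    have hm : ∀ (x y : K) (z : R), v.valuation K (x - y) < 1 → v.valuation K ((x - y) * algebraMap R K z) < 1 := by
      intro x y z h
      rw [map_mul]
      exact mul_lt_one_of_lt_of_le h (HeightOneSpectrum.valuation_le_one v z)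
    have e := Valuation.map_add_lt _ (Valuation.map_add_lt _ (Valuation.map_add_lt _ (Valuation.map_add_lt _ (Valuation.map_add_lt _
      (Valuation.map_add_lt _ h2 (hm _ _ (a ^ 2) hp')) (hm _ _ (b ^ 2) hq')) (hm _ _ (c ^ 2) hr')) (hm _ _ (a * b) hs'))
      (hm _ _ (a * c) ht')) (hm _ _ (b * c) hu')
    convert e using 2
    simp only [map_add, map_mul, map_pow]
    ring
end

section
variable {K : Type*} [Field K] {Γ : Type*} [LinearOrderedCommGroupWithZero Γ] (v : Valuation K Γ)
  {V : Type*} [AddCommGroup V] [Module K V] (Q : QuadraticForm K V)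

/-- strong anisotropy with respect to a valuation -/
def Aniso : Prop := ∀ l : Module.Dual K V, ∃ c : K, ∀ x, v (l x) ^ 2 ≤ v (c * Q x)

/-- approximate representation -/
def AR (b : Kˣ) : Prop := ∃ x, ∃ s ∈ locSq v, Q x = b * (s : Kˣ)

variable {v Q}

lemma Aniso.eq_zero (h : Aniso v Q) {x : V} (hx : Q x = 0) : x = 0 := by
  by_contra h0
  obtain ⟨l, hl⟩ := Module.Projective.exists_dual_ne_zero K h0
  obtain ⟨c, hc⟩ := h l
  have := hc x
  rw [hx, mul_zero, map_zero] at this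
  have h2 := le_antisymm this zero_le
  rw [sq_eq_zero_iff, Valuation.zero_iff] at h2
  exact hl h2

lemma Aniso.comp {V' : Type*} [AddCommGroup V'] [Module K V'] {Q' : QuadraticForm K V'} (f : V' →ₗ[K] V)
    (hf : Function.Injective f) (hQ : ∀ x, Q (f x) = Q' x) (h : Aniso v Q) : Aniso v Q' := by
  intro l
  obtain ⟨g, hg⟩ := f.exists_leftInverse_of_injective (LinearMap.ker_eq_bot.mpr hf)
  obtain ⟨c, hc⟩ := h (l.comp g)
  refine ⟨c, fun x => ?_⟩
  have := hc (f x)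
  have e : g (f x) = x := LinearMap.congr_fun hg x
  rwa [LinearMap.comp_apply, e, hQ] at this

end
end QH

end

section
namespace QH
open IsDedekindDomain NumberField WithZero
open scoped Classical
set_option linter.unusedSectionVars false
universe u
section
variable {R : Type*} [CommRing R] [IsDedekindDomain R] {K : Type*} [Field K] [Algebra R K] [IsFractionRing R K]
  {v : HeightOneSpectrum R} 
  {V : Type*} [AddCommGroup V] [Module K V] {Q : QuadraticForm K V}

lemma exists_pow_val_lt {c : ℤᵐ⁰} (hc : c < 1) {g : ℤᵐ⁰} (hg : g ≠ 0) : ∃ n : ℕ, c ^ n < g := by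
  by_cases h0 : c = 0
  · exact ⟨1, by rw [h0]; simpa using zero_lt_iff.mpr hg⟩
  rw [← exp_log h0, ← exp_zero, exp_lt_exp] at hc
  rw [← exp_log h0, ← exp_log hg]
  refine ⟨(-(log g)).toNat + 1, ?_⟩
  rw [← exp_nsmul, exp_lt_exp, nsmul_eq_mul]
  push_cast
  have h1 : -log g ≤ ((-log g).toNat : ℤ) := Int.self_le_toNat _
  nlinarith [Int.natCast_nonneg ((-log g).toNat)]

lemma quad_add_smul (x y : V) (s : K) : Q (x + s • y) = Q x + s * QuadraticMap.polar Q x y + s ^ 2 * Q y := by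
  rw [QuadraticMap.map_add Q, QuadraticMap.polar_smul_right, QuadraticMap.map_smul, smul_eq_mul, smul_eq_mul]
  ring

lemma Aniso.polar_le (h : Aniso (v.valuation K) Q) (x y : V) :
    v.valuation K (QuadraticMap.polar Q x y) ^ 2 ≤ v.valuation K (Q x) * v.valuation K (Q y) := by
  by_contra! hlt
  set b := QuadraticMap.polar Q x y with hb
  have hb0 : b ≠ 0 := by
    rintro h0; rw [h0] at hlt; simp at hlt
  have hvb : v.valuation K b ≠ 0 := (Valuation.ne_zero_iff _).mpr hb0
  set c := Q x * Q y / b ^ 2 with hc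
  have hc1 : v.valuation K c < 1 := by
    rw [hc, map_div₀, map_mul, map_pow]
    exact (div_lt_one₀ (zero_lt_iff.mpr (pow_ne_zero 2 hvb))).mpr hlt
  have hcb : c * b ^ 2 = Q x * Q y := by rw [hc]; field_simp
  have step : ∀ n : ℕ, ∃ t : K, v.valuation K t ≤ 1 ∧ v.valuation K (1 - t + c * t ^ 2) ≤ v.valuation K c ^ n := by
    intro n
    induction n with
    | zero => exact ⟨1, by simp, by simpa using hc1.le⟩
    | succ n ih =>
      obtain ⟨t, h1, h2⟩ := ih
      have h3 : v.valuation K (1 + c * t ^ 2) ≤ 1 := by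
        refine (Valuation.map_add _ _ _).trans (max_le (by simp) ?_)
        rw [map_mul, map_pow]
        exact mul_le_one' hc1.le (pow_le_one' h1 2)
      refine ⟨1 + c * t ^ 2, h3, ?_⟩
      have e : 1 - (1 + c * t ^ 2) + c * (1 + c * t ^ 2) ^ 2 = c * ((1 - t + c * t ^ 2) * ((1 + c * t ^ 2) + t)) := by ring
      rw [e, map_mul, map_mul, pow_succ' _ n]
      refine mul_le_mul_right ((mul_le_of_le_one_right' ?_).trans h2) _
      exact (Valuation.map_add _ _ _).trans (max_le h3 h1)
  let l : Module.Dual K V := QuadraticMap.polarBilin Q y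
  obtain ⟨d, hd⟩ := h l
  have hg : ∃ n : ℕ, v.valuation K (d * Q x) * v.valuation K c ^ n < v.valuation K b ^ 2 := by
    by_cases h0 : v.valuation K (d * Q x) = 0
    · exact ⟨0, by rw [h0, zero_mul]; exact zero_lt_iff.mpr (pow_ne_zero 2 hvb)⟩
    · obtain ⟨n, hn⟩ := exists_pow_val_lt hc1 (g := v.valuation K b ^ 2 / v.valuation K (d * Q x)) (div_ne_zero (pow_ne_zero 2 hvb) h0)
      refine ⟨n, ?_⟩
      rw [lt_div_iff₀ (zero_lt_iff.mpr h0)] at hn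
      rwa [mul_comm]
  obtain ⟨n, hn⟩ := hg
  obtain ⟨t, ht1, ht2⟩ := step n
  have h1 := hd (x + (-(Q x / b * t)) • y)
  rw [quad_add_smul, ← hb] at h1
  have e1 : Q x + -(Q x / b * t) * b + (-(Q x / b * t)) ^ 2 * Q y = Q x * (1 - t + c * t ^ 2) := by
    rw [hc]; field_simp; ring
  have e2 : l (x + (-(Q x / b * t)) • y) = b * (1 - 2 * c * t) := by
    simp only [l, map_add, map_smul, QuadraticMap.polarBilin_apply_apply]
    rw [QuadraticMap.polar_comm, ← hb, QuadraticMap.polar_self, smul_eq_mul, hc]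
    field_simp
    try push_cast
    try ring
  have e3 : v.valuation K (1 - 2 * c * t) = 1 := by
    have : v.valuation K (2 * c * t) < 1 := by
      rw [map_mul, map_mul]
      refine mul_lt_one_of_lt_of_le ?_ ht1
      exact (mul_le_of_le_one_left' (v_two_le _)).trans_lt hc1
    rw [Valuation.map_sub_eq_of_lt_left] <;> rw [map_one]
    exact this
  rw [e1, e2, map_mul _ b, e3, mul_one, ← mul_assoc, map_mul] at h1
  exact absurd (h1.trans (mul_le_mul_right ht2 _)) (not_le.mpr hn)

lemma Aniso.add_le (h : Aniso (v.valuation K) Q) {x y : V} {g : ℤᵐ⁰} (hx : v.valuation K (Q x) ≤ g) (hy : v.valuation K (Q y) ≤ g) :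
    v.valuation K (Q (x + y)) ≤ g := by
  rw [QuadraticMap.map_add Q]
  refine (Valuation.map_add _ _ _).trans (max_le ((Valuation.map_add _ _ _).trans (max_le hx hy)) ?_)
  have := h.polar_le x y
  have h2 := this.trans (mul_le_mul' hx hy)
  rw [← sq] at h2
  exact (pow_le_pow_iff_left₀ zero_le zero_le two_ne_zero).mp h2

lemma smul_le {x : V} {g : ℤᵐ⁰} {a : K} (ha : v.valuation K a ≤ 1) (hx : v.valuation K (Q x) ≤ g) : v.valuation K (Q (a • x)) ≤ g := by
  rw [QuadraticMap.map_smul, smul_eq_mul, map_mul, map_mul]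
  exact (mul_le_of_le_one_left' (mul_le_one' ha ha)).trans hx

lemma val_le_exp_sub_one {x : K} {k : ℤ} : v.valuation K x ≤ exp (k - 1) ↔ v.valuation K x < exp k := by
  by_cases hx : x = 0
  · simp [hx]
  have := val_eq_exp v (Units.mk0 x hx)
  rw [Units.val_mk0] at this
  rw [this, exp_le_exp, exp_lt_exp]; omega

lemma smul_lt' {x : V} {k : ℤ} {a : K} (ha : v.valuation K a < 1) (hx : v.valuation K (Q x) ≤ exp k) :
    v.valuation K (Q (a • x)) ≤ exp (k - 1) := by
  rw [val_le_exp_sub_one, QuadraticMap.map_smul, smul_eq_mul, map_mul, map_mul]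
  refine lt_of_le_of_lt (mul_le_mul_right hx _) (mul_lt_of_lt_one_left exp_pos ?_)
  exact mul_lt_one_of_lt_of_le ha ha.le

variable [Finite (R ⧸ v.asIdeal)]

lemma Aniso.gens (h : Aniso (v.valuation K) Q) (k : ℤ) : ∃ y₁ y₂ : V, ∀ x, v.valuation K (Q x) ≤ exp k →
    ∃ a b : K, ∃ z, x = a • y₁ + b • y₂ + z ∧ v.valuation K a ≤ 1 ∧ v.valuation K b ≤ 1 ∧ 
      v.valuation K (Q y₁) ≤ exp k ∧ v.valuation K (Q y₂) ≤ exp k ∧ v.valuation K (Q z) ≤ exp (k - 1) := by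
  by_cases h1 : ∃ y₁, v.valuation K (Q y₁) = exp k
  swap
  · push Not at h1
    refine ⟨0, 0, fun x hx => ⟨0, 0, x, by simp, by simp, by simp, by simp, by simp, ?_⟩⟩
    exact val_le_exp_sub_one.mpr (lt_of_le_of_ne hx (h1 x))
  obtain ⟨y₁, hy₁⟩ := h1
  by_cases h2 : ∃ y₂, v.valuation K (Q y₂) ≤ exp k ∧ ∀ a : K, v.valuation K a ≤ 1 → exp (k - 1) < v.valuation K (Q (y₂ - a • y₁))
  swap
  · push Not at h2
    refine ⟨y₁, 0, fun x hx => ?_⟩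
    obtain ⟨a, ha, h3⟩ := h2 x hx
    exact ⟨a, 0, x - a • y₁, by simp, ha, by simp, hy₁.le, by simp, h3⟩
  obtain ⟨y₂, hy₂, h2⟩ := h2
  refine ⟨y₁, y₂, fun x hx => ?_⟩
  obtain ⟨g, hg⟩ := exists_lg K v k
  have hgv : v.valuation K (g : K) = exp k := by rw [val_eq_exp, hg]
  have hg0 := zero_lt_iff.mpr (val_ne v g)
  have hpol : ∀ {x y : V}, v.valuation K (Q x) ≤ exp k → v.valuation K (Q y) ≤ exp k → v.valuation K (QuadraticMap.polar Q x y) ≤ exp k := by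
    intro x y hx hy
    have h2 := (h.polar_le x y).trans (mul_le_mul' hx hy)
    rw [← sq] at h2
    exact (pow_le_pow_iff_left₀ zero_le zero_le two_ne_zero).mp h2
  have hdiv : ∀ {z : K}, v.valuation K z ≤ exp k → v.valuation K (z / g) ≤ 1 := by
    intro z hz
    rw [map_div₀]
    exact (div_le_one₀ hg0).mpr (hz.trans_eq hgv.symm)
  obtain ⟨X, A, B, hX, hA, hB, hor, hlt⟩ := cwL v (hdiv hx) (hdiv hy₁.le) (hdiv hy₂) (hdiv (hpol hx hy₁.le)) (hdiv (hpol hx hy₂)) (hdiv (hpol hy₁.le hy₂))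
  have e : Q (X • x + A • y₁ + B • y₂) = g * (Q x / g * X ^ 2 + Q y₁ / g * A ^ 2 + Q y₂ / g * B ^ 2 + QuadraticMap.polar Q x y₁ / g * (X * A) + QuadraticMap.polar Q x y₂ / g * (X * B) + QuadraticMap.polar Q y₁ y₂ / g * (A * B)) := by
    rw [quad_add_smul, quad_add_smul, QuadraticMap.polar_add_left, QuadraticMap.polar_smul_left, QuadraticMap.polar_smul_left, QuadraticMap.polar_smul_left, QuadraticMap.map_smul]
    have := g.ne_zero
    field_simp
    simp only [smul_eq_mul]
    ring
  have hle : v.valuation K (Q (X • x + A • y₁ + B • y₂)) ≤ exp (k - 1) := by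
    rw [val_le_exp_sub_one, e, map_mul, hgv]
    exact mul_lt_of_lt_one_right (exp_pos) hlt
  have hinv : ∀ {a : K}, v.valuation K a = 1 → a ≠ 0 ∧ v.valuation K a⁻¹ ≤ 1 := by
    intro a ha
    exact ⟨by rintro rfl; simp at ha, by rw [map_inv₀, ha, inv_one]⟩
  have hml : ∀ {a b : K}, v.valuation K a ≤ 1 → v.valuation K b ≤ 1 → v.valuation K (-(a * b)) ≤ 1 := by
    intro a b ha hb
    rw [Valuation.map_neg, map_mul]; exact mul_le_one' ha hb
  by_cases hX1 : v.valuation K X = 1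
  · obtain ⟨i1, i2⟩ := hinv hX1
    refine ⟨-(X⁻¹ * A), -(X⁻¹ * B), X⁻¹ • (X • x + A • y₁ + B • y₂), ?_, hml i2 hA, hml i2 hB, hy₁.le, hy₂, smul_le i2 hle⟩
    simp only [smul_add, smul_smul, inv_mul_cancel₀ i1, one_smul, neg_smul]
    abel
  · have hX' : v.valuation K (Q ((-X) • x)) ≤ exp (k - 1) :=
      smul_lt' (by rw [Valuation.map_neg]; exact lt_of_le_of_ne hX hX1) hx
    have hle2 := h.add_le hX' hle
    have e2 : (-X) • x + (X • x + A • y₁ + B • y₂) = A • y₁ + B • y₂ := by rw [neg_smul]; abel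
    rw [e2] at hle2
    exfalso
    by_cases hB1 : v.valuation K B = 1
    · obtain ⟨i1, i2⟩ := hinv hB1
      have h5 := h2 (-(B⁻¹ * A)) (hml i2 hA)
      have e3 : y₂ - (-(B⁻¹ * A)) • y₁ = B⁻¹ • (A • y₁ + B • y₂) := by
        simp only [smul_add, smul_smul, inv_mul_cancel₀ i1, one_smul, neg_smul]
        abel
      rw [e3] at h5
      exact absurd (smul_le i2 hle2) (not_le.mpr h5)
    · have hA1 := (hor.resolve_left hX1).resolve_right hB1
      obtain ⟨i1, i2⟩ := hinv hA1
      have hB' : v.valuation K (Q ((-B) • y₂)) ≤ exp (k - 1) :=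
        smul_lt' (by rw [Valuation.map_neg]; exact lt_of_le_of_ne hB hB1) hy₂
      have h6 := smul_le i2 (h.add_le hB' hle2)
      have e3 : A⁻¹ • ((-B) • y₂ + (A • y₁ + B • y₂)) = y₁ := by
        rw [neg_smul, add_comm (A • y₁), neg_add_cancel_left, smul_smul, inv_mul_cancel₀ i1, one_smul]
      rw [e3, hy₁, exp_le_exp] at h6
      omega

theorem Aniso.finrank_le [FiniteDimensional K V] [CharZero K] (h : Aniso (v.valuation K) Q) : Module.finrank K V ≤ 4 := by
  by_contra! hf
  obtain ⟨y₁, y₂, h1⟩ := h.gens 0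
  obtain ⟨y₃, y₄, h2⟩ := h.gens (-1)
  let B := QuadraticMap.polarBilin Q
  let f : V →ₗ[K] (Fin 4 → K) := LinearMap.pi ![B y₁, B y₂, B y₃, B y₄]
  have hk : LinearMap.ker f ≠ ⊥ := by
    apply LinearMap.ker_ne_bot_of_finrank_lt
    simpa using hf
  obtain ⟨z, hz, hz0⟩ := (Submodule.ne_bot_iff _).mp hk
  rw [LinearMap.mem_ker] at hz
  have hz1 : QuadraticMap.polar Q y₁ z = 0 := congrFun hz 0
  have hz2 : QuadraticMap.polar Q y₂ z = 0 := congrFun hz 1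
  have hz3 : QuadraticMap.polar Q y₃ z = 0 := congrFun hz 2
  have hz4 : QuadraticMap.polar Q y₄ z = 0 := congrFun hz 3
  obtain ⟨p, hp⟩ := exists_lg K v (-1)
  have hpv : v.valuation K (p : K) = exp (-1) := by rw [val_eq_exp, hp]
  have hp1 : v.valuation K (p : K) < 1 := by rw [hpv, ← exp_zero, exp_lt_exp]; omega
  have key : ∀ n : ℕ, ∀ x, v.valuation K (Q x) ≤ exp 0 →
      v.valuation K (QuadraticMap.polar Q x z) ^ 2 ≤ (v.valuation K (p : K) ^ 2) ^ n * v.valuation K (Q z) := by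
    intro n
    induction n with
    | zero =>
      intro x hx
      rw [pow_zero]
      exact (h.polar_le x z).trans (mul_le_mul_left (hx.trans_eq exp_zero) _)
    | succ n ih =>
      intro x hx
      obtain ⟨a, b, x1, e1, -, -, -, -, hx1⟩ := h1 x hx
      obtain ⟨c, d, x2, e2, -, -, -, -, hx2⟩ := h2 x1 (by simpa using hx1)
      have e3 : x = a • y₁ + b • y₂ + (c • y₃ + d • y₄ + (p : K) • ((p : K)⁻¹ • x2)) := by
        rw [smul_smul, mul_inv_cancel₀ p.ne_zero, one_smul, ← e2, ← e1]
      have e4 : QuadraticMap.polar Q x z = p * QuadraticMap.polar Q ((p : K)⁻¹ • x2) z := by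
        rw [e3]
        simp only [QuadraticMap.polar_add_left, QuadraticMap.polar_smul_left, hz1, hz2, hz3, hz4, smul_eq_mul]
        ring
      have h5 : v.valuation K (Q ((p : K)⁻¹ • x2)) ≤ exp 0 := by
        rw [QuadraticMap.map_smul, smul_eq_mul, map_mul, map_mul, map_inv₀, hpv, ← exp_neg, ← exp_add]
        refine (mul_le_mul_right hx2 _).trans ?_
        rw [← exp_add, exp_le_exp]; norm_num
      rw [e4, map_mul, mul_pow, pow_succ' _ n, mul_assoc]
      exact mul_le_mul_right (ih _ h5) _
  have hQz : Q z ≠ 0 := fun h0 => hz0 (h.eq_zero h0)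
  -- scale z into the unit ball
  obtain ⟨m, hm⟩ : ∃ m : Kˣ, v.valuation K (Q ((m : K) • z)) ≤ exp 0 := by
    obtain ⟨m, hm⟩ := exists_lg K v (-|lg v (Units.mk0 _ hQz)|)
    refine ⟨m, ?_⟩
    have hmv : v.valuation K (m : K) = exp (-|lg v (Units.mk0 _ hQz)|) := by rw [val_eq_exp, hm]
    have hQv : v.valuation K (Q z) = exp (lg v (Units.mk0 _ hQz)) := by rw [← val_eq_exp, Units.val_mk0]
    rw [QuadraticMap.map_smul, smul_eq_mul, map_mul, map_mul, hmv, hQv, ← exp_add, ← exp_add, exp_le_exp]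
    have := le_abs_self (lg v (Units.mk0 _ hQz))
    have := abs_nonneg (lg v (Units.mk0 _ hQz))
    omega
  have hpol : QuadraticMap.polar Q ((m : K) • z) z ≠ 0 := by
    rw [QuadraticMap.polar_smul_left, QuadraticMap.polar_self]
    simp [hQz]
  have hv0 := (Valuation.ne_zero_iff (v.valuation K)).mpr hpol
  have hvQ := (Valuation.ne_zero_iff (v.valuation K)).mpr hQz
  obtain ⟨n, hn⟩ := exists_pow_val_lt (pow_lt_one' hp1 two_ne_zero)
    (g := v.valuation K (QuadraticMap.polar Q ((m : K) • z) z) ^ 2 / v.valuation K (Q z)) (div_ne_zero (pow_ne_zero 2 hv0) hvQ)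
  rw [lt_div_iff₀ (zero_lt_iff.mpr hvQ)] at hn
  exact absurd (key n _ hm) (not_le.mpr hn)

end
end QH

end

section
namespace QH
open IsDedekindDomain NumberField WithZero
open scoped Classical
set_option linter.unusedSectionVars false
universe u
section
variable {R : Type*} [CommRing R] [IsDedekindDomain R] {K : Type*} [Field K] [CharZero K] [Algebra R K] [IsFractionRing R K]
  {v : HeightOneSpectrum R} 
  {V : Type*} [AddCommGroup V] [Module K V] {Q : QuadraticForm K V}
  {V' : Type*} [AddCommGroup V'] [Module K V'] {Q' : QuadraticForm K V'}

/-- nondegeneracy -/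
def ND (Q : QuadraticForm K V) : Prop := ∀ l : Module.Dual K V, ∃ e, ∀ x, l x = QuadraticMap.polar Q x e

variable (v) in
lemma exists_small (q : K) (b : Kˣ) : ∃ s : Kˣ, v.valuation K ((s : K) ^ 2 * q) < v.valuation K (b : K) := by
  by_cases hq : q = 0
  · exact ⟨1, by rw [hq, mul_zero, map_zero]; exact zero_lt_iff.mpr (val_ne v b)⟩
  obtain ⟨m, hm⟩ := exists_lg K v (-|lg v (Units.mk0 _ hq)| - |lg v b| - 1)
  refine ⟨m, ?_⟩
  have e : (m : K) ^ 2 * q = ((m ^ 2 * Units.mk0 q hq : Kˣ) : K) := by simp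
  rw [e, val_lt_val_iff, lg_mul, lg_pow, hm]
  have := le_abs_self (lg v (Units.mk0 _ hq))
  have := abs_nonneg (lg v (Units.mk0 _ hq))
  have := neg_abs_le (lg v b)
  have := abs_nonneg (lg v b)
  push_cast
  omega

lemma AR_of_near {b : Kˣ} {x : V} (h : v.valuation K (Q x - b) < v.valuation K (4 * b)) : AR (v.valuation K) Q b := by
  have h0 : Q x ≠ 0 := by
    intro h0
    rw [h0, zero_sub, Valuation.map_neg, map_mul] at h
    exact absurd h (not_lt.mpr (mul_le_of_le_one_left' (v_four_le _)))
  refine ⟨x, Units.mk0 _ h0 / b, mem_locSq_of_near _ h, ?_⟩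
  simp [mul_div_cancel₀]

lemma AR_of_not_aniso (hnd : ND Q) (h : ¬ Aniso (v.valuation K) Q) (b : Kˣ) : AR (v.valuation K) Q b := by
  rw [Aniso] at h
  push Not at h
  obtain ⟨l, hl⟩ := h
  obtain ⟨e, he⟩ := hnd l
  have h4 : (4 : K) ≠ 0 := by norm_num
  obtain ⟨s, hs⟩ := exists_small v (Q e) (Units.mk0 4 h4 * b)
  obtain ⟨x, hx⟩ := hl (b / (4 * s ^ 2))
  have hlx : l x ≠ 0 := by rintro h0; rw [h0] at hx; simp at hx
  have hs0 := s.ne_zero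
  have hb0 := b.ne_zero
  apply AR_of_near (x := (b / (s * l x)) • x + (s : K) • e)
  have e1 : Q ((b / (s * l x)) • x + (s : K) • e) - b = (b / (s * l x)) ^ 2 * Q x + s ^ 2 * Q e := by
    rw [quad_add_smul, QuadraticMap.polar_smul_left, ← he, QuadraticMap.map_smul]
    simp only [smul_eq_mul]
    field_simp
    ring
  rw [e1]
  refine Valuation.map_add_lt _ ?_ (by simpa using hs)
  have e2 : (b / (s * l x)) ^ 2 * Q x = (4 * b / (l x) ^ 2) * (b / (4 * s ^ 2) * Q x) := by field_simp
  have hvl := (Valuation.ne_zero_iff (v.valuation K)).mpr hlx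
  rw [e2, map_mul]
  calc _ < v.valuation K (4 * b / (l x) ^ 2) * v.valuation K (l x) ^ 2 := by
        refine mul_lt_mul_of_pos_left hx (zero_lt_iff.mpr ?_)
        rw [Valuation.ne_zero_iff]
        positivity
    _ = _ := by rw [← map_pow (v.valuation K), ← map_mul]; congr 1; field_simp

lemma orth (h1 : ND Q) (h2 : ND Q') {x0 : V} {y0 : V'} (hx0 : Q x0 ≠ 0) (hy0 : Q' y0 ≠ 0)
    (h : ¬ Aniso (v.valuation K) (QuadraticMap.prod Q Q')) : ∃ c : Kˣ, AR (v.valuation K) Q c ∧ AR (v.valuation K) Q' (-c) := by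
  by_cases h3 : Aniso (v.valuation K) Q
  swap
  · exact ⟨-Units.mk0 _ hy0, AR_of_not_aniso h1 h3 _, y0, 1, Subgroup.one_mem _, by simp⟩
  by_cases h4 : Aniso (v.valuation K) Q'
  swap
  · exact ⟨Units.mk0 _ hx0, ⟨x0, 1, Subgroup.one_mem _, by simp⟩, AR_of_not_aniso h2 h4 _⟩
  rw [Aniso] at h
  push Not at h
  obtain ⟨l, hl⟩ := h
  obtain ⟨c1, hc1⟩ := h3 (l.comp (LinearMap.inl K V V'))
  obtain ⟨c2, hc2⟩ := h4 (l.comp (LinearMap.inr K V V'))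
  obtain ⟨c, hcc1, hcc2⟩ : ∃ c, v.valuation K c1 ≤ v.valuation K (4 * c) ∧ v.valuation K c2 ≤ v.valuation K (4 * c) := by
    rcases le_total (v.valuation K c1) (v.valuation K c2) with h | h
    · exact ⟨c2 / 4, by rwa [mul_div_cancel₀]; norm_num, by rw [mul_div_cancel₀]; norm_num⟩
    · exact ⟨c1 / 4, by rw [mul_div_cancel₀]; norm_num, by rwa [mul_div_cancel₀]; norm_num⟩
  obtain ⟨⟨x, y⟩, hxy⟩ := hl c
  rw [QuadraticMap.prod_apply] at hxy
  simp only at hxy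
  have hE : v.valuation K (Q x + Q' y) < v.valuation K (4 * Q x) := by
    by_contra! hle
    have hle2 : v.valuation K (4 * Q' y) ≤ v.valuation K (Q x + Q' y) := by
      have : 4 * Q' y = 4 * (Q x + Q' y) - 4 * Q x := by ring
      rw [this]
      refine (Valuation.map_sub _ _ _).trans (max_le ?_ hle)
      rw [map_mul]; exact mul_le_of_le_one_left' (v_four_le _)
    have e : l (x, y) = l (LinearMap.inl K V V' x) + l (LinearMap.inr K V V' y) := by
      rw [← map_add]; simp
    have i1 : v.valuation K (l (LinearMap.inl K V V' x)) ^ 2 ≤ v.valuation K (c * (Q x + Q' y)) := by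
      refine (hc1 x).trans ?_
      rw [map_mul, map_mul]
      refine (mul_le_mul_left hcc1 _).trans ?_
      rw [mul_comm (4 : K), map_mul, mul_assoc, ← map_mul _ (4 : K)]
      exact mul_le_mul_right hle _
    have i2 : v.valuation K (l (LinearMap.inr K V V' y)) ^ 2 ≤ v.valuation K (c * (Q x + Q' y)) := by
      refine (hc2 y).trans ?_
      rw [map_mul, map_mul]
      refine (mul_le_mul_left hcc2 _).trans ?_
      rw [mul_comm (4 : K), map_mul, mul_assoc, ← map_mul _ (4 : K)]
      exact mul_le_mul_right hle2 _
    refine absurd hxy (not_lt.mpr ?_)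
    rw [e]
    rcases le_max_iff.mp (Valuation.map_add (v.valuation K) (l (LinearMap.inl K V V' x)) (l (LinearMap.inr K V V' y))) with h | h
    · exact (pow_le_pow_left₀ zero_le h 2).trans i1
    · exact (pow_le_pow_left₀ zero_le h 2).trans i2
  have hQx : Q x ≠ 0 := by rintro h0; rw [h0] at hE; simp at hE
  refine ⟨Units.mk0 _ hQx, ⟨x, 1, Subgroup.one_mem _, by simp⟩, AR_of_near (x := y) ?_⟩
  simp only [Units.val_neg, Units.val_mk0, sub_neg_eq_add, mul_neg, Valuation.map_neg]
  rwa [add_comm]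

lemma not_aniso_of_AR {c : Kˣ} (h1 : AR (v.valuation K) Q c) (h2 : AR (v.valuation K) Q' (-c)) :
    ¬ Aniso (v.valuation K) (QuadraticMap.prod Q Q') := by
  intro h
  obtain ⟨x, s1, hs1, hx⟩ := h1
  obtain ⟨y, s2, hs2, hy⟩ := h2
  obtain ⟨u, e, he, hu⟩ := mem_locSq _ |>.mp (Subgroup.div_mem _ hs1 hs2)
  have h3 := h.polar_le (x, (u : K) • y) (0, (u : K) • y)
  have e0 : (s1 : K) = s2 * (u ^ 2 * (1 + 4 * e)) := by
    rw [← hu]; simp [mul_div_cancel₀]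
  have e1 : (QuadraticMap.prod Q Q') (x, (u : K) • y) = c * s2 * u ^ 2 * (4 * e) := by
    rw [QuadraticMap.prod_apply]
    simp only [QuadraticMap.map_smul, hx, hy, smul_eq_mul, e0, Units.val_neg]
    ring
  have e2 : (QuadraticMap.prod Q Q') (0, (u : K) • y) = - (c * s2 * u ^ 2) := by
    rw [QuadraticMap.prod_apply]
    simp only [QuadraticMap.map_smul, QuadraticMap.map_zero, hy, smul_eq_mul, Units.val_neg]
    ring
  have e3 : QuadraticMap.polar (QuadraticMap.prod Q Q') (x, (u : K) • y) (0, (u : K) • y) = - (2 * (c * s2 * u ^ 2)) := by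
    have : QuadraticMap.polar (QuadraticMap.prod Q Q') (x, (u : K) • y) (0, (u : K) • y) = QuadraticMap.polar Q' ((u : K) • y) ((u : K) • y) := by
      simp [QuadraticMap.polar]
    rw [this, QuadraticMap.polar_self, QuadraticMap.map_smul, hy]
    simp only [smul_eq_mul, Units.val_neg]
    ring
  rw [e1, e2, e3] at h3
  have e4 : v.valuation K (-(2 * (c * s2 * u ^ 2))) ^ 2 = v.valuation K (c * s2 * u ^ 2 * 4) * v.valuation K (-(c * s2 * u ^ 2)) := by
    rw [← map_pow, ← map_mul, ← Valuation.map_neg]; congr 1; ring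
  have hpos : 0 < v.valuation K (c * s2 * u ^ 2 * 4) * v.valuation K (-(c * s2 * u ^ 2)) := by
    rw [zero_lt_iff, ← map_mul, Valuation.ne_zero_iff]
    simp
  rw [e4] at h3
  refine absurd h3 (not_le.mpr ?_)
  rw [← mul_assoc (_ : K) 4 e, map_mul _ _ e, mul_comm _ (v.valuation K e), mul_assoc]
  exact mul_lt_of_lt_one_left hpos he

/-- one dimensional form -/
def dg (t : K) : QuadraticForm K K := t • QuadraticMap.sq

@[simp] lemma dg_apply (t x : K) : dg t x = t * x ^ 2 := by simp [dg, sq]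

lemma polar_dg (t x y : K) : QuadraticMap.polar (dg t) x y = 2 * t * x * y := by
  simp only [QuadraticMap.polar, dg_apply]; ring

lemma ND_dg {t : K} (ht : t ≠ 0) : ND (dg t) := by
  intro l
  refine ⟨l 1 / (2 * t), fun x => ?_⟩
  rw [polar_dg]
  have : l x = x * l 1 := by
    rw [← smul_eq_mul, ← map_smul, smul_eq_mul, mul_one]
  rw [this]; field_simp

lemma ND.prod (h1 : ND Q) (h2 : ND Q') : ND (QuadraticMap.prod Q Q') := by
  intro l
  obtain ⟨e1, h1⟩ := h1 (l.comp (LinearMap.inl K V V'))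
  obtain ⟨e2, h2⟩ := h2 (l.comp (LinearMap.inr K V V'))
  refine ⟨(e1, e2), fun x => ?_⟩
  have e : l x = l (LinearMap.inl K V V' x.1) + l (LinearMap.inr K V V' x.2) := by
    rw [← map_add]; simp
  rw [e]
  have h1 := h1 x.1
  have h2 := h2 x.2
  rw [LinearMap.comp_apply] at h1 h2
  rw [h1, h2]
  simp [QuadraticMap.polar]
  ring

lemma AR_binary {t1 t2 b : Kˣ} : AR (v.valuation K) (QuadraticMap.prod (dg (t1 : K)) (dg (t2 : K))) b ↔ 
    t1 * b ∈ locNorm (v.valuation K) (-(t1 * t2 : K)) := by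
  have h1 := t1.ne_zero
  constructor
  · rintro ⟨⟨x, y⟩, s, hs, h⟩
    simp only [QuadraticMap.prod_apply, dg_apply] at h
    rw [mem_locNorm]
    refine ⟨t1 * b * s, ⟨t1 * x, y, ?_⟩, s⁻¹, Subgroup.inv_mem _ hs, by group⟩
    push_cast
    linear_combination -(t1 : K) * h
  · intro h
    rw [mem_locNorm] at h
    obtain ⟨y, ⟨p, q, hpq⟩, s, hs, hys⟩ := h
    refine ⟨(p / t1, q), s⁻¹, Subgroup.inv_mem _ hs, ?_⟩
    have : (y : K) = t1 * b * (s⁻¹ : Kˣ) := by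
      rw [← Units.val_mul, ← Units.val_mul, ← hys]; simp
    simp only [QuadraticMap.prod_apply, dg_apply]
    have e : (t1 : K) * (b * (s⁻¹ : Kˣ)) = p ^ 2 - -(t1 * t2) * q ^ 2 := by rw [← hpq, this]; ring
    field_simp
    linear_combination -e

end
end QH

end

section
namespace QH
open IsDedekindDomain NumberField WithZero
open scoped Classical
set_option linter.unusedSectionVars false
universe u
section
variable {R : Type*} [CommRing R] [IsDedekindDomain R] {K : Type*} [Field K] [CharZero K] [Algebra R K] [IsFractionRing R K]
  (v : HeightOneSpectrum R) 

/-- ternary form -/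
def TQ (t1 t2 t3 : K) : QuadraticForm K ((K × K) × K) := QuadraticMap.prod (QuadraticMap.prod (dg t1) (dg t2)) (dg t3)

lemma TQ_apply (t1 t2 t3 : K) (x : (K × K) × K) : TQ t1 t2 t3 x = t1 * x.1.1 ^ 2 + t2 * x.1.2 ^ 2 + t3 * x.2 ^ 2 := by
  simp [TQ]

lemma ND_TQ {t1 t2 t3 : K} (h1 : t1 ≠ 0) (h2 : t2 ≠ 0) (h3 : t3 ≠ 0) : ND (TQ t1 t2 t3) := ((ND_dg h1).prod (ND_dg h2)).prod (ND_dg h3)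

lemma L3 [Finite (R ⧸ v.asIdeal)] (h2 : v.valuation K 2 = 1) {t1 t2 t3 : K} (h1 : v.valuation K t1 = 1) (h2' : v.valuation K t2 = 1) (h3 : v.valuation K t3 = 1) :
    ¬ Aniso (v.valuation K) (TQ t1 t2 t3) := by
  intro h
  obtain ⟨x, y, z, -, -, -, hor, hlt⟩ := cwL v h1.le h2'.le h3.le (s := 0) (t := 0) (u := 0) (by simp) (by simp) (by simp)
  have e0 : TQ t1 t2 t3 ((x, y), z) = t1 * x ^ 2 + t2 * y ^ 2 + t3 * z ^ 2 + 0 * (x * y) + 0 * (x * z) + 0 * (y * z) := by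
    rw [TQ_apply]; ring
  rw [← e0] at hlt
  have key : ∀ (e : (K × K) × K) (t w : K), TQ t1 t2 t3 e = t → QuadraticMap.polar (TQ t1 t2 t3) ((x, y), z) e = 2 * t * w →
      v.valuation K t = 1 → v.valuation K w = 1 → False := by
    intro e t w i1 i2 i3 i4
    have := h.polar_le ((x, y), z) e
    rw [i1, i2, map_mul, map_mul, i3, i4, h2] at this
    simp only [mul_one, one_pow] at this
    exact absurd this (not_le.mpr hlt)
  rcases hor with h | h | h
  · exact key ((1, 0), 0) t1 x (by rw [TQ_apply]; simp) (by simp only [QuadraticMap.polar, TQ_apply]; simp; ring) h1 h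
  · exact key ((0, 1), 0) t2 y (by rw [TQ_apply]; simp) (by simp only [QuadraticMap.polar, TQ_apply]; simp; ring) h2' h
  · exact key ((0, 0), 1) t3 z (by rw [TQ_apply]; simp) (by simp only [QuadraticMap.polar, TQ_apply]; simp; ring) h3 h

lemma TQ_aniso_iff {t1 t2 t3 : Kˣ} (h : ¬ Aniso (v.valuation K) (TQ (t1 : K) t2 t3)) :
    -(t1 * t3) ∈ locNorm (v.valuation K) (-(t1 * t2 : K)) := by
  obtain ⟨c, h1, h2⟩ := orth ((ND_dg t1.ne_zero).prod (ND_dg t2.ne_zero)) (ND_dg t3.ne_zero) (x0 := (1, 0)) (y0 := 1) (by simp) (by simp) h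
  rw [AR_binary] at h1
  obtain ⟨z, s, hs, h3⟩ := h2
  have hz : z ≠ 0 := by
    rintro rfl
    simp at h3
  have : -(t1 * t3) = (t1 * c) * (s * ((Units.mk0 z hz)⁻¹) ^ 2) := by
    ext
    simp only [dg_apply, Units.val_neg] at h3
    push_cast
    simp only [Units.val_mk0]
    field_simp
    linear_combination (-1) * h3
  rw [this]
  exact Subgroup.mul_mem _ h1 (locSq_le_locNorm _ (Subgroup.mul_mem _ hs (sq_mem_locSq _ _)))

lemma TQ_not_aniso {t1 t2 t3 : Kˣ} (h : -(t1 * t3) ∈ locNorm (v.valuation K) (-(t1 * t2 : K))) : ¬ Aniso (v.valuation K) (TQ (t1 : K) t2 t3) := by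
  apply not_aniso_of_AR (c := -t3)
  · rw [AR_binary]
    convert h using 1
    rw [mul_neg]
  · exact ⟨1, 1, Subgroup.one_mem _, by simp⟩

lemma sq_cont (t x : K) (g : Kˣ) : ∃ n : ℤ, ∀ y, v.valuation K (y - x) ≤ exp n → v.valuation K (t * y ^ 2 - t * x ^ 2) < v.valuation K (g : K) := by
  obtain ⟨s, hs⟩ := exists_small v t g
  obtain ⟨s', hs'⟩ := exists_small v (2 * t * x) g
  refine ⟨min (lg v s) (lg v (s' ^ 2)), fun y hy => ?_⟩
  have h1 : v.valuation K (y - x) ≤ v.valuation K (s : K) := by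
    rw [val_eq_exp]; exact hy.trans (exp_le_exp.mpr (min_le_left _ _))
  have h2 : v.valuation K (y - x) ≤ v.valuation K ((s' : K) ^ 2) := by
    rw [← Units.val_pow_eq_pow_val, val_eq_exp]; exact hy.trans (exp_le_exp.mpr (min_le_right _ _))
  have e : t * y ^ 2 - t * x ^ 2 = (y - x) ^ 2 * t + (y - x) * (2 * t * x) := by ring
  rw [e]
  refine Valuation.map_add_lt _ (lt_of_le_of_lt ?_ hs) (lt_of_le_of_lt ?_ hs')
  · rw [map_mul, map_mul, map_pow, map_pow]
    exact mul_le_mul_left (pow_le_pow_left₀ zero_le h1 2) _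
  · rw [map_mul _ (y - x), map_mul _ ((s' : K) ^ 2)]
    exact mul_le_mul_left h2 _

lemma TQ_approx (B : Finset (HeightOneSpectrum R)) (hB : B.Nonempty) (t1 t2 t3 : K) (b : HeightOneSpectrum R → Kˣ)
    (h : ∀ v ∈ B, AR (v.valuation K) (TQ t1 t2 t3) (b v)) : 
    ∃ x, ∃ g : Kˣ, TQ t1 t2 t3 x = g ∧ ∀ v ∈ B, g / b v ∈ locSq (v.valuation K) := by
  have h' : ∀ v, ∃ x, ∃ s : Kˣ, v ∈ B → s ∈ locSq (v.valuation K) ∧ TQ t1 t2 t3 x = b v * s := by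
    intro v
    by_cases hv : v ∈ B
    · obtain ⟨x, s, hs, hx⟩ := h v hv
      exact ⟨x, s, fun _ => ⟨hs, hx⟩⟩
    · exact ⟨0, 1, fun h => absurd h hv⟩
  choose x s hxs using h'
  have h4 : (4 : K) ≠ 0 := by norm_num
  choose n1 hn1 using fun v => sq_cont v t1 (x v).1.1 (Units.mk0 4 h4 * (b v * s v))
  choose n2 hn2 using fun v => sq_cont v t2 (x v).1.2 (Units.mk0 4 h4 * (b v * s v))
  choose n3 hn3 using fun v => sq_cont v t3 (x v).2 (Units.mk0 4 h4 * (b v * s v))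
  obtain ⟨y1, hy1⟩ := weak_approx B (fun v => (x v).1.1) n1
  obtain ⟨y2, hy2⟩ := weak_approx B (fun v => (x v).1.2) n2
  obtain ⟨y3, hy3⟩ := weak_approx B (fun v => (x v).2) n3
  have key : ∀ v ∈ B, v.valuation K (TQ t1 t2 t3 ((y1, y2), y3) - (b v * s v : Kˣ)) < v.valuation K (4 * (b v * s v : Kˣ)) := by
    intro v hv
    have e : TQ t1 t2 t3 ((y1, y2), y3) - (b v * s v : Kˣ) = (t1 * y1 ^ 2 - t1 * (x v).1.1 ^ 2) + (t2 * y2 ^ 2 - t2 * (x v).1.2 ^ 2) + (t3 * y3 ^ 2 - t3 * (x v).2 ^ 2) := by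
      rw [Units.val_mul, ← (hxs v hv).2, TQ_apply, TQ_apply]; ring
    rw [e]
    exact Valuation.map_add_lt _ (Valuation.map_add_lt _ (hn1 v _ (hy1 v hv)) (hn2 v _ (hy2 v hv))) (hn3 v _ (hy3 v hv))
  have h0 : TQ t1 t2 t3 ((y1, y2), y3) ≠ 0 := by
    intro h0
    obtain ⟨v, hv⟩ := hB
    have := key v hv
    rw [h0, zero_sub, Valuation.map_neg, map_mul] at this
    exact absurd this (not_lt.mpr (mul_le_of_le_one_left' (v_four_le _)))
  refine ⟨((y1, y2), y3), Units.mk0 _ h0, rfl, fun v hv => ?_⟩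
  have h1 : Units.mk0 _ h0 / (b v * s v) ∈ locSq (v.valuation K) := mem_locSq_of_near _ (key v hv)
  have h2 := Subgroup.mul_mem _ h1 (hxs v hv).1
  convert h2 using 1
  rw [div_mul_eq_mul_div, mul_div_mul_right_eq_div]
end

section
variable {K : Type u} [Field K] [NumberField K] [IsTotallyComplex K]

lemma NO1 {t1 t2 t3 : Kˣ} (hd : ∀ v ∈ dyad K, -(t1 * t2) ∈ locSq (v.valuation K))
    (h : ∀ v : HeightOneSpectrum (𝓞 K), ¬ Aniso (v.valuation K) (TQ (t1 : K) t2 t3)) : ∃ x y : K, t1 * x ^ 2 + t2 * y ^ 2 + t3 = 0 := by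
  obtain ⟨x, y, hxy⟩ := thmN_core (ε := -(t1 * t2)) (α := -(t1 * t3)) hd (fun v => by
    have := TQ_aniso_iff v (h v)
    rwa [Units.val_neg, Units.val_mul])
  have h1 := t1.ne_zero
  refine ⟨x / t1, y, ?_⟩
  push_cast at hxy
  field_simp
  linear_combination -hxy

theorem NO2 {t1 t2 t3 : Kˣ} (h : ∀ v : HeightOneSpectrum (𝓞 K), ¬ Aniso (v.valuation K) (TQ (t1 : K) t2 t3)) : 
    ∃ x, x ≠ 0 ∧ TQ (t1 : K) t2 t3 x = 0 := by
  obtain ⟨v0, -⟩ := exists_prime_notMem K ∅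
  obtain ⟨⟨⟨a, b⟩, c⟩, g, hg, hgl⟩ := TQ_approx (K := K) (insert v0 (dyad K)) (Finset.insert_nonempty _ _) t1 t2 t3 (fun _ => -(t1 * t2 * t3))
    (fun v _ => AR_of_not_aniso (ND_TQ t1.ne_zero t2.ne_zero t3.ne_zero) (h v) _)
  have hgl : ∀ v ∈ dyad K, g * -(t1 * t2 * t3) ∈ locSq (v.valuation K) := fun v hv =>
    (mul_mem_locSq_comm _).mp (hgl v (Finset.mem_insert_of_mem hv))
  rw [TQ_apply] at hg
  simp only at hg
  by_cases hab : a = 0 ∧ b = 0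
  · obtain ⟨rfl, rfl⟩ := hab
    have hc : c ≠ 0 := by rintro rfl; simp at hg; exact g.ne_zero hg.symm
    have : ∀ v ∈ dyad K, -(t1 * t2) ∈ locSq (v.valuation K) := by
      intro v hv
      have := Subgroup.div_mem _ (hgl v hv) (sq_mem_locSq (v.valuation K) (t3 * Units.mk0 c hc))
      convert this using 1
      rw [eq_div_iff_mul_eq']
      ext
      push_cast
      rw [Units.val_mk0]
      linear_combination (-(t1 * t2 * t3) : K) * hg
    obtain ⟨x, y, hxy⟩ := NO1 this h
    exact ⟨((x, y), 1), by simp, by rw [TQ_apply]; simpa using hxy⟩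
  by_cases hg' : (t1 * a ^ 2 + t2 * b ^ 2 : K) = 0
  · refine ⟨((a, b), 0), ?_, by rw [TQ_apply]; simpa using hg'⟩
    simp only [Ne, Prod.mk_eq_zero, and_true]
    exact hab
  set g' : Kˣ := Units.mk0 _ hg' with hg'd
  have hg'v : (g' : K) = t1 * a ^ 2 + t2 * b ^ 2 := rfl
  let H : ((K × K) × K) →ₗ[K] ((K × K) × K) :=
    { toFun := fun x => ((-(t2 * b * x.1.1) + a * t3 * c * x.1.2 + a * x.2, t1 * a * x.1.1 + b * t3 * c * x.1.2 + b * x.2), -(g' * x.1.2) + c * x.2)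
      map_add' := by intro x y; ext <;> simp <;> ring
      map_smul' := by intro r x; ext <;> simp <;> ring }
  have hH : ∀ x, TQ (t1 : K) t2 t3 (H x) = TQ ((t1 * t2 * g' : Kˣ) : K) ((t3 * g' * g : Kˣ) : K) (g : K) x := by
    rintro ⟨⟨x, y⟩, z⟩
    simp only [TQ_apply, H, LinearMap.coe_mk, AddHom.coe_mk]
    push_cast
    rw [← hg, hg'v]
    ring
  have hinj : Function.Injective H := by
    rw [← LinearMap.ker_eq_bot, LinearMap.ker_eq_bot']
    rintro ⟨⟨x, y⟩, z⟩ hx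
    simp only [H, LinearMap.coe_mk, AddHom.coe_mk, Prod.mk_eq_zero] at hx
    obtain ⟨⟨h1, h2⟩, h3⟩ := hx
    have i1 : ((t1 * t2 * g' : Kˣ) : K) * x = 0 := by
      push_cast; rw [hg'v]; linear_combination (-(t1 * t2 * b : K)) * h1 + (t1 * t2 * a : K) * h2
    have i2 : (g : K) * z = 0 := by
      rw [← hg]; linear_combination (t1 * a : K) * h1 + (t2 * b : K) * h2 + (t3 * c : K) * h3 + t3 * c * y * hg'v
    have i1 : x = 0 := by simpa using i1
    have i2 : z = 0 := by simpa using i2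
    have i3 : y = 0 := by rw [i2] at h3; simpa using h3
    simp [i1, i2, i3]
  let e := LinearEquiv.ofInjectiveEndo H hinj
  have he : ∀ x, H (e.symm x) = x := fun x => e.apply_symm_apply x
  obtain ⟨x, y, hxy⟩ := NO1 (t1 := t1 * t2 * g') (t2 := t3 * g' * g) (t3 := g) (fun v hv => by
      have := Subgroup.mul_mem _ (hgl v hv) (sq_mem_locSq (v.valuation K) g')
      convert this using 1
      rw [mul_neg, neg_mul, neg_inj, sq]
      simp only [mul_assoc, mul_comm, mul_left_comm]) (fun v hv => h v (hv.comp (e.symm : _ →ₗ[K] _) e.symm.injective (fun x => by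
        rw [← hH]; exact congrArg _ (he x))))
  refine ⟨H ((x, y), 1), ?_, ?_⟩
  · intro h0
    have := hinj (h0.trans (map_zero H).symm)
    simp at this
  · rw [hH, TQ_apply]; simpa using hxy
end
end QH

end

section
namespace QH
open IsDedekindDomain NumberField WithZero
open scoped Classical
set_option linter.unusedSectionVars false
universe u
section
variable {R : Type*} [CommRing R] [IsDedekindDomain R] {K : Type*} [Field K] [CharZero K] [Algebra R K] [IsFractionRing R K]
  (v : HeightOneSpectrum R) 

lemma normGrp_mul_sq (e u : K) (hu : u ≠ 0) : normGrp (e * u ^ 2) = normGrp e := by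
  ext x
  constructor
  · rintro ⟨a, b, h⟩
    exact ⟨a, u * b, by rw [h]; ring⟩
  · rintro ⟨a, b, h⟩
    exact ⟨a, b / u, by rw [h]; field_simp⟩

lemma L_quat {t1 t2 t3 : Kˣ} (h : AR (v.valuation K) (TQ (t1 : K) t2 t3) (-(t1 * t2 * t3))) : ¬ Aniso (v.valuation K) (TQ (t1 : K) t2 t3) := by
  have h1 : ¬ Aniso (v.valuation K) (QuadraticMap.prod (TQ (t1 : K) t2 t3) (dg ((t1 * t2 * t3 : Kˣ) : K))) :=
    not_aniso_of_AR h ⟨1, 1, Subgroup.one_mem _, by simp⟩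
  have h2 : ¬ Aniso (v.valuation K) (QuadraticMap.prod (QuadraticMap.prod (dg (t1 : K)) (dg (t2 : K))) (QuadraticMap.prod (dg (t3 : K)) (dg ((t1 * t2 * t3 : Kˣ) : K)))) := by
    intro h2
    refine h1 (h2.comp (LinearEquiv.prodAssoc K (K × K) K K : _ →ₗ[K] _) (LinearEquiv.prodAssoc K (K × K) K K).injective ?_)
    rintro ⟨⟨⟨x, y⟩, z⟩, w⟩
    simp [TQ]
    ring
  obtain ⟨c, h3, h4⟩ := orth ((ND_dg t1.ne_zero).prod (ND_dg t2.ne_zero)) ((ND_dg t3.ne_zero).prod (ND_dg (Units.ne_zero _)))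
    (x0 := (1, 0)) (y0 := (1, 0)) (by simp) (by simp) h2
  rw [AR_binary] at h3 h4
  have e1 : -((t3 : K) * ((t1 * t2 * t3 : Kˣ) : K)) = -(t1 * t2 : K) * (t3 : K) ^ 2 := by push_cast; ring
  rw [e1, locNorm, normGrp_mul_sq _ _ t3.ne_zero, ← locNorm] at h4
  apply TQ_not_aniso
  have h5 := Subgroup.mul_mem _ (Subgroup.mul_mem _ h3 h4) (Subgroup.inv_mem _ (sq_mem_locNorm (v.valuation K) c (ε := -(t1 * t2 : K))))
  convert h5 using 1
  rw [eq_mul_inv_iff_mul_eq]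
  ext
  push_cast
  ring
end

section
variable {F : Type u} [Field F] [NumberField F]

/-- totally positive -/
def TP (x : F) : Prop := ∀ φ : F →+* ℝ, 0 < φ x

lemma TP.mul {x y : F} (hx : TP x) (hy : TP y) : TP (x * y) := fun φ => by rw [map_mul]; exact mul_pos (hx φ) (hy φ)

lemma tc_of_neg {E : Type u} [Field E] [NumberField E] [Algebra F E] {d : F} (hd : TP (-d)) {θ : E} (h : θ ^ 2 = algebraMap F E d) :
    IsTotallyComplex E := by
  refine ⟨fun w => ?_⟩
  rw [← InfinitePlace.not_isReal_iff_isComplex]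
  intro hw
  have h1 := hd ((InfinitePlace.embedding_of_isReal hw).comp (algebraMap F E))
  rw [map_neg, RingHom.comp_apply, ← h, map_pow] at h1
  nlinarith [sq_nonneg (InfinitePlace.embedding_of_isReal hw θ)]

theorem quat (φ0 : F →+* ℝ) {a1 a2 a3 a4 a : F} (h1 : TP a1) (h2 : TP a2) (h3 : TP a3) (h4 : TP a4) (h5 : TP a) :
    ∃ x1 x2 x3 x4 : F, a1 * x1 ^ 2 + a2 * x2 ^ 2 + a3 * x3 ^ 2 + a4 * x4 ^ 2 = a := by
  have ne : ∀ {x : F}, TP x → x ≠ 0 := fun {x} hx h => by have := hx φ0; rw [h, map_zero] at this; exact lt_irrefl _ this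
  let t1 : Fˣ := Units.mk0 a3 (ne h3)
  let t2 : Fˣ := Units.mk0 a4 (ne h4)
  let t3 : Fˣ := -Units.mk0 a (ne h5)
  have ht1 : (t1 : F) = a3 := rfl
  have ht2 : (t2 : F) = a4 := rfl
  have ht3 : (t3 : F) = -a := rfl
  obtain ⟨S1, hS1⟩ := exists_SU (R := 𝓞 F) t1
  obtain ⟨S2, hS2⟩ := exists_SU (R := 𝓞 F) t2
  obtain ⟨S3, hS3⟩ := exists_SU (R := 𝓞 F) t3
  obtain ⟨v0, -⟩ := exists_prime_notMem F ∅
  set B := insert v0 (dyad F ∪ S1 ∪ S2 ∪ S3) with hB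
  have hloc : ∀ v : HeightOneSpectrum (𝓞 F), ∃ c : Fˣ, AR (v.valuation F) (QuadraticMap.prod (dg a1) (dg a2)) c ∧ AR (v.valuation F) (TQ (t1 : F) t2 t3) (-c) := by
    intro v
    apply orth ((ND_dg (ne h1)).prod (ND_dg (ne h2))) (ND_TQ t1.ne_zero t2.ne_zero t3.ne_zero) (x0 := (1, 0)) (y0 := ((1, 0), 0)) (by simpa using ne h1) (by simp [TQ_apply])
    intro h
    have := h.finrank_le
    simp at this
  choose c hc1 hc2 using hloc
  obtain ⟨x, g, hxg, hgB⟩ := TQ_approx B (Finset.insert_nonempty _ _) a1 a2 0 c (fun v _ => by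
    obtain ⟨x, s, hs, hx⟩ := hc1 v
    exact ⟨(x, 0), s, hs, by rw [← hx, TQ_apply]; simp⟩)
  rw [TQ_apply, zero_mul, add_zero] at hxg
  have hg : TP (g : F) := by
    intro φ
    have h0 : 0 ≤ φ (g : F) := by
      rw [← hxg]; simp only [map_add, map_mul, map_pow]
      have := h1 φ
      have := h2 φ
      positivity
    exact lt_of_le_of_ne h0 (Ne.symm ((map_ne_zero φ).mpr g.ne_zero))
  have hgAR : ∀ v ∈ B, AR (v.valuation F) (TQ (t1 : F) t2 t3) (-g) := by
    intro v hv
    obtain ⟨y, s, hs, hy⟩ := hc2 v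
    refine ⟨y, s * (g / c v)⁻¹, Subgroup.mul_mem _ hs (Subgroup.inv_mem _ (hgB v hv)), ?_⟩
    rw [hy, ← Units.val_mul, ← Units.val_mul]
    congr 1
    rw [inv_div, neg_mul, neg_mul, neg_inj, mul_div_assoc', mul_div_assoc', eq_div_iff_mul_eq']
    simp only [mul_assoc, mul_comm, mul_left_comm]
  set d : F := -(g * a3 * a4 * a) with hd
  have hdn : TP (-d) := by rw [hd, neg_neg]; exact ((hg.mul h3).mul h4).mul h5
  have hdsq : ¬ IsSquare d := by
    rintro ⟨r, hr⟩
    have := hdn φ0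
    rw [hr, map_neg, map_mul] at this
    nlinarith [mul_self_nonneg (φ0 r)]
  obtain ⟨E, _, _, _, ⟨q⟩⟩ := exists_QE F hdsq
  have hE : IsTotallyComplex E := tc_of_neg hdn q.hθ
  have hd0 : d ≠ 0 := by rintro h; rw [h] at hdsq; exact hdsq ⟨0, by simp⟩
  have hθ0 : q.θ ≠ 0 := by
    intro h
    have := q.hθ
    rw [h, zero_pow two_ne_zero] at this
    exact hd0 ((map_eq_zero _).mp this.symm)
  have hiso : ∀ w : HeightOneSpectrum (𝓞 E), ¬ Aniso (w.valuation E) (TQ ((ua F E t1 : Eˣ) : E) (ua F E t2 : Eˣ) (ua F E t3 : Eˣ)) := by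
    intro w
    by_cases hw : below (K := F) w ∈ B
    · apply L_quat
      obtain ⟨y, s, hs, hy⟩ := hgAR _ hw
      have hs' := below_locSq hs
      refine ⟨((algebraMap F E y.1.1, algebraMap F E y.1.2), algebraMap F E y.2), ua F E s * (Units.mk0 q.θ hθ0 / ua F E (t1 * t2 * t3)) ^ 2, Subgroup.mul_mem _ hs' (sq_mem_locSq _ _), ?_⟩
      have e := congrArg (algebraMap F E) hy
      rw [TQ_apply] at e ⊢
      simp only [map_add, map_mul, map_pow] at e
      simp only [ua_val]
      rw [e]
      have e2 : q.θ ^ 2 = algebraMap F E (-((g : F) * a3 * a4 * a)) := q.hθ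
      have n1 : algebraMap F E a3 ≠ 0 := (map_ne_zero _).mpr (ne h3)
      have n2 : algebraMap F E a4 ≠ 0 := (map_ne_zero _).mpr (ne h4)
      have n3 : algebraMap F E a ≠ 0 := (map_ne_zero _).mpr (ne h5)
      simp only [Units.val_mul, Units.val_neg, Units.val_pow_eq_pow_val, Units.val_div_eq_div_val, ua_val, map_mul, map_neg, Units.val_mk0, ht1, ht2, ht3, div_pow, e2]
      field_simp
    · rw [hB, Finset.mem_insert] at hw
      push Not at hw
      simp only [Finset.mem_union] at hw
      push Not at hw
      obtain ⟨-, ⟨⟨hw0, hw1⟩, hw2⟩, hw3⟩ := hw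
      apply L3
      · have := below_eq_one (K := F) (w := w) (x := 2) |>.mpr (mem_dyad.mp hw0)
        rwa [map_ofNat] at this
      · rw [ua_val, below_eq_one, val_eq_one_iff]; exact hS1 _ hw1
      · rw [ua_val, below_eq_one, val_eq_one_iff]; exact hS2 _ hw2
      · rw [ua_val, below_eq_one, val_eq_one_iff]; exact hS3 _ hw3
  obtain ⟨⟨⟨X, Y⟩, Z⟩, hne, h0⟩ := NO2 hiso
  rw [TQ_apply] at h0
  simp only [ua_val, ht1, ht2, ht3] at h0
  obtain ⟨p1, q1, rfl⟩ := q.gen X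
  obtain ⟨p2, q2, rfl⟩ := q.gen Y
  obtain ⟨p3, q3, rfl⟩ := q.gen Z
  have i0 : algebraMap F E ((a3 * p1 ^ 2 + a4 * p2 ^ 2 - a * p3 ^ 2) + d * (a3 * q1 ^ 2 + a4 * q2 ^ 2 - a * q3 ^ 2)) + algebraMap F E (2 * (a3 * p1 * q1 + a4 * p2 * q2 - a * p3 * q3)) * q.θ = 0 := by
    simp only [map_add, map_sub, map_mul, map_pow, map_neg, map_ofNat] at h0 ⊢
    linear_combination h0 - (algebraMap F E a3 * algebraMap F E q1 ^ 2 + algebraMap F E a4 * algebraMap F E q2 ^ 2 - algebraMap F E a * algebraMap F E q3 ^ 2) * q.hθ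
  have i1 : a3 * p1 * q1 + a4 * p2 * q2 - a * p3 * q3 = 0 := by
    by_contra hn
    apply hdsq
    set A := (a3 * p1 ^ 2 + a4 * p2 ^ 2 - a * p3 ^ 2) + d * (a3 * q1 ^ 2 + a4 * q2 ^ 2 - a * q3 ^ 2)
    set C := 2 * (a3 * p1 * q1 + a4 * p2 * q2 - a * p3 * q3) with hC
    have hC0 : C ≠ 0 := mul_ne_zero two_ne_zero hn
    refine ⟨A / C, ?_⟩
    apply (algebraMap F E).injective
    have hC1 : algebraMap F E C ≠ 0 := (map_ne_zero _).mpr hC0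
    rw [map_mul, map_div₀, ← q.hθ]
    field_simp
    linear_combination (algebraMap F E C * q.θ - algebraMap F E A) * i0
  have i2 : (a3 * p1 ^ 2 + a4 * p2 ^ 2 - a * p3 ^ 2) + d * (a3 * q1 ^ 2 + a4 * q2 ^ 2 - a * q3 ^ 2) = 0 := by
    rw [i1, mul_zero, map_zero, zero_mul, add_zero] at i0
    exact (map_eq_zero _).mp i0
  set m1 := (p2 * q3 - p3 * q2) / a3 with hm1
  set m2 := (p3 * q1 - p1 * q3) / a4 with hm2
  set m3 := (p1 * q2 - p2 * q1) / (-a) with hm3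
  set Tq := a3 * q1 ^ 2 + a4 * q2 ^ 2 - a * q3 ^ 2 with hTq
  have n1 := ne h3
  have n2 := ne h4
  have n3 := ne h5
  have key : (g : F) * Tq ^ 2 + a3 * m1 ^ 2 + a4 * m2 ^ 2 = a * m3 ^ 2 := by
    have f1 : a3 * m1 = p2 * q3 - p3 * q2 := by rw [hm1]; field_simp
    have f2 : a4 * m2 = p3 * q1 - p1 * q3 := by rw [hm2]; field_simp
    have f3 : a * m3 = -(p1 * q2 - p2 * q1) := by rw [hm3]; field_simp
    have f0 : a3 * a4 * a ≠ 0 := mul_ne_zero (mul_ne_zero n1 n2) n3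
    apply mul_left_cancel₀ f0
    have L1 : a3 * a4 * (p1 * q2 - p2 * q1) ^ 2 - a3 * a * (p3 * q1 - p1 * q3) ^ 2 - a4 * a * (p2 * q3 - p3 * q2) ^ 2
        = (a3 * p1 ^ 2 + a4 * p2 ^ 2 - a * p3 ^ 2) * Tq - (a3 * p1 * q1 + a4 * p2 * q2 - a * p3 * q3) ^ 2 := by
      rw [hTq]; ring
    have L2 : a3 * a4 * (p1 * q2 - p2 * q1) ^ 2 = a3 * a4 * (a * m3) ^ 2 := by rw [f3]; ring
    rw [i1, ← f1, ← f2, L2] at L1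
    rw [hd] at i2
    linear_combination (-1 : F) * L1 - Tq * i2
  have pos : ∀ {u b c : F}, a3 * u ^ 2 + a4 * b ^ 2 - a * c ^ 2 = 0 → c = 0 → u = 0 ∧ b = 0 := by
    intro u b c h hc
    rw [hc] at h
    have h' := congrArg φ0 h
    simp only [map_sub, map_add, map_mul, map_pow, map_zero] at h'
    have u1 := h3 φ0
    have u2 := h4 φ0
    have w1 := mul_nonneg u1.le (sq_nonneg (φ0 u))
    have w2 := mul_nonneg u2.le (sq_nonneg (φ0 b))
    have w3 : φ0 a3 * φ0 u ^ 2 = 0 := by nlinarith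
    have w4 : φ0 a4 * φ0 b ^ 2 = 0 := by nlinarith
    simpa [u1.ne', u2.ne'] using And.intro w3 w4
  have fin : ∀ {u b c : F}, a3 * u ^ 2 + a4 * b ^ 2 - a * c ^ 2 = 0 → (c ≠ 0) → ∃ x1 x2 x3 x4 : F, a1 * x1 ^ 2 + a2 * x2 ^ 2 + a3 * x3 ^ 2 + a4 * x4 ^ 2 = a := by
    intro u b c h hc
    refine ⟨0, 0, u / c, b / c, ?_⟩
    field_simp
    linear_combination h
  by_cases hm : m3 = 0
  · have hk := congrArg φ0 key
    rw [hm] at hk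
    simp only [map_add, map_mul, map_pow, map_zero] at hk
    have w1 := mul_nonneg (hg φ0).le (sq_nonneg (φ0 Tq))
    have w2 := mul_nonneg (h3 φ0).le (sq_nonneg (φ0 m1))
    have w3 := mul_nonneg (h4 φ0).le (sq_nonneg (φ0 m2))
    have w4 : φ0 g * φ0 Tq ^ 2 = 0 := by nlinarith
    have hT : Tq = 0 := by simpa [(hg φ0).ne'] using w4
    rw [hT, mul_zero, add_zero] at i2
    by_cases hq : q3 = 0
    · obtain ⟨z1, z2⟩ := pos hT hq
      by_cases hp : p3 = 0
      · obtain ⟨z3, z4⟩ := pos i2 hp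
        exact absurd (by simp [z1, z2, z3, z4, hp, hq]) hne
      · exact fin i2 hp
    · exact fin hT hq
  · refine ⟨x.1.1 * Tq / m3, x.1.2 * Tq / m3, m1 / m3, m2 / m3, ?_⟩
    have : a = (a * m3 ^ 2) / m3 ^ 2 := by field_simp
    rw [this, ← key, ← hxg]
    simp only [div_pow, mul_pow]
    ring
end
end QH

end

section
open scoped TensorProduct
open IsDedekindDomain
namespace QH
open IsDedekindDomain NumberField WithZero
open scoped Classical
set_option linter.unusedSectionVars false
universe u
section
variable {F : Type} [Field F] [NumberField F]

lemma PosDef.tp {V : Type} [AddCommGroup V] [Module F V] {Q : QuadraticForm F V} (h : PosDef F Q) {x : V} (hx : x ≠ 0) : TP (Q x) :=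
  fun φ => h φ x hx

lemma map_smul_add {V : Type} [AddCommGroup V] [Module F V] (Q : QuadraticForm F V) (c : F) (x y : V) (h : QuadraticMap.polar Q x y = 0) :
    Q (c • x + y) = Q x * c ^ 2 + Q y := by
  rw [QuadraticMap.map_add Q, QuadraticMap.polar_smul_left, h, QuadraticMap.map_smul]
  simp only [smul_eq_mul]
  ring

lemma rep_one (φ0 : F →+* ℝ) {V : Type} [AddCommGroup V] [Module F V] {Q : QuadraticForm F V} (h : PosDef F Q)
    (hr : 4 ≤ Module.finrank F V) {a : F} (ha : TP a) : ∃ x : V, Q x = a := by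
  have hf : FiniteDimensional F V := Module.finite_of_finrank_pos (by omega)
  have hex : ∀ (m : ℕ) (l : V →ₗ[F] (Fin m → F)), m < 4 → ∃ x : V, x ≠ 0 ∧ l x = 0 := by
    intro m l hm
    have := LinearMap.ker_ne_bot_of_finrank_lt (f := l) (by simp; omega)
    obtain ⟨x, hx, hx0⟩ := Submodule.exists_mem_ne_zero_of_ne_bot this
    exact ⟨x, hx0, hx⟩
  obtain ⟨v1, h1, -⟩ := hex 0 0 (by norm_num)
  obtain ⟨v2, h2, k2⟩ := hex 1 (LinearMap.pi ![Q.polarBilin v1]) (by norm_num)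
  obtain ⟨v3, h3, k3⟩ := hex 2 (LinearMap.pi ![Q.polarBilin v1, Q.polarBilin v2]) (by norm_num)
  obtain ⟨v4, h4, k4⟩ := hex 3 (LinearMap.pi ![Q.polarBilin v1, Q.polarBilin v2, Q.polarBilin v3]) (by norm_num)
  have p12 : QuadraticMap.polar Q v1 v2 = 0 := by simpa using congrFun k2 0
  have p13 : QuadraticMap.polar Q v1 v3 = 0 := by simpa using congrFun k3 0
  have p23 : QuadraticMap.polar Q v2 v3 = 0 := by simpa using congrFun k3 1
  have p14 : QuadraticMap.polar Q v1 v4 = 0 := by simpa using congrFun k4 0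
  have p24 : QuadraticMap.polar Q v2 v4 = 0 := by simpa using congrFun k4 1
  have p34 : QuadraticMap.polar Q v3 v4 = 0 := by simpa using congrFun k4 2
  obtain ⟨x1, x2, x3, x4, hx⟩ := quat φ0 (PosDef.tp h h1) (PosDef.tp h h2) (PosDef.tp h h3) (PosDef.tp h h4) ha
  refine ⟨x1 • v1 + (x2 • v2 + (x3 • v3 + x4 • v4)), ?_⟩
  rw [map_smul_add, map_smul_add, map_smul_add, QuadraticMap.map_smul, ← hx, smul_eq_mul]
  · ring
  · simp [QuadraticMap.polar_smul_right, p34]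
  · simp [QuadraticMap.polar_smul_right, QuadraticMap.polar_add_right, p23, p24]
  · simp [QuadraticMap.polar_smul_right, QuadraticMap.polar_add_right, p12, p13, p14]

lemma PosDef.comp {V U : Type} [AddCommGroup V] [Module F V] [AddCommGroup U] [Module F U] {Q : QuadraticForm F V} (h : PosDef F Q)
   (f : U →ₗ[F] V) (hf : Function.Injective f) : PosDef F (Q.comp f) := fun φ x hx => by
  rw [QuadraticMap.comp_apply]
  exact h φ _ (by rwa [Ne, map_eq_zero_iff f hf])

theorem rep (φ0 : F →+* ℝ) (n : ℕ) : ∀ (W V : Type) [AddCommGroup W] [Module F W] [AddCommGroup V] [Module F V]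
    (Q' : QuadraticForm F W) (Q : QuadraticForm F V), FiniteDimensional F W → PosDef F Q' → PosDef F Q →
    Module.finrank F W = n → n + 3 ≤ Module.finrank F V → SpaceRep Q' Q := by
  induction n with
  | zero =>
    intro W V _ _ _ _ Q' Q hfd hp' hp hn hr
    have := Module.finrank_zero_iff.mp hn
    refine ⟨0, fun x y _ => Subsingleton.elim _ _, fun x => ?_⟩
    rw [Subsingleton.elim x 0]; simp
  | succ n ih =>
    intro W V _ _ _ _ Q' Q hfd hp' hp hn hr
    have hfV : FiniteDimensional F V := Module.finite_of_finrank_pos (by omega)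
    have : Nontrivial W := Module.nontrivial_of_finrank_pos (R := F) (by omega)
    obtain ⟨w, hw⟩ := exists_ne (0 : W)
    obtain ⟨v, hv⟩ := rep_one φ0 hp (by omega) (PosDef.tp hp' hw)
    have hQw : Q' w ≠ 0 := fun h => by have := hp' φ0 w hw; rw [h, map_zero] at this; exact lt_irrefl _ this
    set lw : W →ₗ[F] F := Q'.polarBilin w with hlw
    set lv : V →ₗ[F] F := Q.polarBilin v with hlv
    have hlww : lw w = 2 * Q' w := by simp [hlw, QuadraticMap.polar_self]
    have h2 : lw w ≠ 0 := by rw [hlww]; exact mul_ne_zero two_ne_zero hQw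
    have hsurj : Function.Surjective lw := LinearMap.surjective (fun h => h2 (by rw [h]; rfl))
    have d1 := LinearMap.finrank_range_add_finrank_ker lw
    rw [LinearMap.range_eq_top.mpr hsurj, finrank_top, Module.finrank_self] at d1
    have d2 := LinearMap.finrank_range_add_finrank_ker lv
    have d3 : Module.finrank F (LinearMap.range lv) ≤ 1 := by
      have := Submodule.finrank_le (LinearMap.range lv)
      rwa [Module.finrank_self] at this
    obtain ⟨σ, hσ, hiso⟩ := ih (LinearMap.ker lw) (LinearMap.ker lv) (Q'.comp (LinearMap.ker lw).subtype) (Q.comp (LinearMap.ker lv).subtype)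
      inferInstance (PosDef.comp hp' _ (Submodule.subtype_injective _)) (PosDef.comp hp _ (Submodule.subtype_injective _)) (by omega) (by omega)
    let c : W →ₗ[F] F := (lw w)⁻¹ • lw
    let π : W →ₗ[F] LinearMap.ker lw := LinearMap.codRestrict _ (LinearMap.id - c.smulRight w) (fun x => by
      rw [LinearMap.mem_ker]
      simp only [c, LinearMap.sub_apply, LinearMap.id_apply, LinearMap.smulRight_apply, LinearMap.smul_apply, map_sub, map_smul, smul_eq_mul]
      field_simp
      ring)
    let τ : W →ₗ[F] V := c.smulRight v + (LinearMap.ker lv).subtype ∘ₗ σ ∘ₗ π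
    have hτ : ∀ x, Q (τ x) = Q' x := by
      intro x
      have e1 : τ x = c x • v + (σ (π x) : V) := rfl
      have e2 : x = c x • w + (π x : W) := by
        change x = c x • w + (x - c x • w)
        abel
      have z1 : QuadraticMap.polar Q v (σ (π x) : V) = 0 := (σ (π x)).2
      have z2 : QuadraticMap.polar Q' w (π x : W) = 0 := (π x).2
      have e3 := hiso (π x)
      rw [QuadraticMap.comp_apply, QuadraticMap.comp_apply] at e3
      change Q (σ (π x) : V) = Q' (π x : W) at e3
      rw [e1, map_smul_add _ _ _ _ z1, hv, e3, ← map_smul_add _ _ _ _ z2, ← e2]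
    refine ⟨τ, ?_, hτ⟩
    rw [injective_iff_map_eq_zero]
    intro x hx
    by_contra hx0
    have h1 := hp' φ0 x hx0
    rw [← hτ, hx, QuadraticMap.map_zero, map_zero] at h1
    exact lt_irrefl _ h1
end
end QH

end

section
open scoped TensorProduct
open IsDedekindDomain
namespace QH
open IsDedekindDomain NumberField WithZero
open scoped Classical
set_option linter.unusedSectionVars false
universe u
section
variable {R : Type*} [CommRing R] [IsDedekindDomain R] {K : Type*} [Field K] [CharZero K] [Algebra R K] [IsFractionRing R K]
  (v : HeightOneSpectrum R) 

lemma exists_approx (k : ℕ) : ∀ {x : K}, v.valuation K x ≤ 1 → ∃ r : R, v.valuation K (x - algebraMap R K r) ≤ exp (-(k : ℤ)) := by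
  obtain ⟨π, hπ⟩ := v.intValuation_exists_uniformizer
  have hπ' : v.valuation K (algebraMap R K π) = exp (-1 : ℤ) := by rw [v.valuation_of_algebraMap, hπ]
  have h0 : algebraMap R K π ≠ 0 := by intro h; rw [h, map_zero] at hπ'; exact exp_ne_zero hπ'.symm
  induction k with
  | zero => 
    intro x hx
    exact ⟨0, by simpa using hx⟩
  | succ k ih =>
    intro x hx
    obtain ⟨r0, hr0⟩ := exists_residue v hx
    have h1 : v.valuation K (x - algebraMap R K r0) ≤ exp (-1 : ℤ) := by
      have := (lt_exp_iff v (x := x - algebraMap R K r0) (n := 0)).mp (by simpa using hr0)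
      simpa using this
    obtain ⟨r1, hr1⟩ := ih (x := (x - algebraMap R K r0) / algebraMap R K π) (by
      rw [map_div₀, hπ']
      exact div_le_one_of_le₀ h1 (zero_le))
    refine ⟨r0 + π * r1, ?_⟩
    have e : x - algebraMap R K (r0 + π * r1) = algebraMap R K π * ((x - algebraMap R K r0) / algebraMap R K π - algebraMap R K r1) := by
      rw [map_add, map_mul]; field_simp; ring
    rw [e, map_mul, hπ']
    refine (mul_le_mul_right hr1 _).trans ?_
    rw [← exp_add]
    apply le_of_eq
    congr 1
    push_cast; ring
end

section
variable {F : Type} [Field F] [NumberField F] (v : HeightOneSpectrum (𝓞 F))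

lemma val_le_exp_of {k : ℕ} {x y : v.adicCompletion F} : Valued.v (x) ≤ exp (-(k : ℤ)) → Valued.v y ≤ exp (-(k : ℤ)) → Valued.v (x + y) ≤ exp (-(k : ℤ)) := fun h1 h2 =>
  (Valuation.map_add _ _ _).trans (max_le h1 h2)

lemma exists_approx_v (k : ℕ) {x : v.adicCompletion F} (hx : Valued.v x ≤ 1) :
    ∃ r : 𝓞 F, Valued.v (x - algebraMap F (v.adicCompletion F) (algebraMap (𝓞 F) F r)) ≤ exp (-(k : ℤ)) := by
  have hopen : IsOpen {y : v.adicCompletion F | Valued.v (x - y) ≤ exp (-(k : ℤ))} := by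
    obtain ⟨c, hc⟩ := exists_lg v (K := F) (-(k : ℤ))
    have hcv : Valued.v (algebraMap F (v.adicCompletion F) (c : F)) = exp (-(k : ℤ)) := by
      rw [← hc, ← val_eq_exp]
      exact HeightOneSpectrum.valuedAdicCompletion_eq_valuation' v _
    generalize algebraMap F (v.adicCompletion F) (c : F) = c' at hcv
    have hcont : Continuous (fun y : v.adicCompletion F => (x - y) * c'⁻¹) := (continuous_const.sub continuous_id).mul continuous_const
    have e : {y : v.adicCompletion F | Valued.v (x - y) ≤ exp (-(k : ℤ))} =
        (fun y => (x - y) * c'⁻¹) ⁻¹' (Valued.integer (v.adicCompletion F) : Set (v.adicCompletion F)) := by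
      ext y
      change _ ↔ Valued.v ((x - y) * c'⁻¹) ≤ 1
      rw [map_mul, map_inv₀, hcv, ← div_eq_mul_inv, div_le_one₀ exp_pos]
      rfl
    rw [e]
    exact (Valued.isOpen_integer (v.adicCompletion F)).preimage hcont
  obtain ⟨y, hy⟩ := (HeightOneSpectrum.denseRange_algebraMap (R := 𝓞 F) F v).exists_mem_open hopen ⟨x, by simp⟩
  have hy1 : v.valuation F y ≤ 1 := by
    rw [← HeightOneSpectrum.valuedAdicCompletion_eq_valuation']
    have e : (y : v.adicCompletion F) = x - (x - algebraMap F (v.adicCompletion F) y) := by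
      rw [sub_sub_cancel]; rfl
    rw [e]
    refine (Valuation.map_sub _ _ _).trans (max_le hx (le_trans hy ?_))
    rw [← exp_zero, exp_le_exp]; simp
  obtain ⟨r, hr⟩ := exists_approx v k hy1
  refine ⟨r, ?_⟩
  have e : x - algebraMap F (v.adicCompletion F) (algebraMap (𝓞 F) F r) = (x - algebraMap F (v.adicCompletion F) y) + algebraMap F (v.adicCompletion F) (y - algebraMap (𝓞 F) F r) := by
    rw [map_sub]; ring
  rw [e]
  refine val_le_exp_of v hy ?_
  refine le_trans (le_of_eq ?_) hr
  exact HeightOneSpectrum.valuedAdicCompletion_eq_valuation' v _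

lemma tendsto_of_val {x : v.adicCompletion F} {y : ℕ → v.adicCompletion F} (h : ∀ k, Valued.v (x - y k) ≤ exp (-(k : ℤ))) :
    Filter.Tendsto y Filter.atTop (nhds x) := by
  rw [Filter.tendsto_def]
  intro s hs
  rw [Valued.mem_nhds] at hs
  obtain ⟨γ, hγ⟩ := hs
  obtain ⟨m, hm⟩ := exists_pow_val_lt (c := exp (-1 : ℤ)) (by rw [← exp_zero, exp_lt_exp]; norm_num)
    (g := MonoidWithZeroHom.ValueGroup₀.embedding γ.1) (by simp)
  refine Filter.mem_atTop_sets.mpr ⟨m, fun k hk => hγ ?_⟩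
  change Valued.v.restrict (y k - x) < γ.1
  rw [Valuation.restrict_lt_iff_lt_embedding, Valuation.map_sub_swap]
  refine lt_of_le_of_lt ((h k).trans ?_) hm
  rw [← exp_nsmul, exp_le_exp]
  simp; exact hk

instance : CompactSpace (Valued.integer (v.adicCompletion F)) := by
  rw [Valued.integer.compactSpace_iff_completeSpace_and_isDiscreteValuationRing_and_finite_residueField]
  refine ⟨?_, ?_, ?_⟩
  · exact (Valued.isClosed_integer (v.adicCompletion F)).completeSpace_coe
  · exact inferInstanceAs (IsDiscreteValuationRing (v.adicCompletionIntegers F))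
  · let f : 𝓞 F →+* IsLocalRing.ResidueField (Valued.integer (v.adicCompletion F)) :=
      (IsLocalRing.residue _).comp (algebraMap (𝓞 F) (v.adicCompletionIntegers F))
    have hf : ∀ a ∈ v.asIdeal, f a = 0 := by
      intro a ha
      refine (IsLocalRing.residue_eq_zero_iff _).mpr ?_
      rw [IsLocalRing.mem_maximalIdeal, mem_nonunits_iff]
      refine Valuation.Integer.not_isUnit_iff_valuation_lt_one.mpr ?_
      have h1 := (HeightOneSpectrum.valuedAdicCompletion_eq_valuation' v (algebraMap (𝓞 F) F a))
      exact lt_of_eq_of_lt h1 ((val_alg_lt_one v).mpr ha)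
    have hs : Function.Surjective (Ideal.Quotient.lift v.asIdeal f hf) := by
      intro x
      obtain ⟨x, rfl⟩ := IsLocalRing.residue_surjective x
      obtain ⟨r, hr⟩ := exists_approx_v v 1 x.2
      refine ⟨Ideal.Quotient.mk _ r, ?_⟩
      rw [Ideal.Quotient.lift_mk]
      symm
      refine sub_eq_zero.mp ?_
      change IsLocalRing.residue _ x - IsLocalRing.residue _ _ = 0
      rw [← map_sub]
      refine (IsLocalRing.residue_eq_zero_iff _).mpr ?_
      rw [IsLocalRing.mem_maximalIdeal, mem_nonunits_iff]
      refine Valuation.Integer.not_isUnit_iff_valuation_lt_one.mpr (lt_of_le_of_lt hr ?_)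
      rw [← exp_zero, exp_lt_exp]
      norm_num
    exact Finite.of_surjective _ hs
end
end QH

end

section
open scoped TensorProduct
open IsDedekindDomain
namespace QH
open IsDedekindDomain NumberField WithZero
open scoped Classical
set_option linter.unusedSectionVars false
universe u
section
lemma ospan_eq {K : Type} [Field K] (O : Subring K) {V : Type} [AddCommGroup V] [Module K V] (t : Set V) :
    ospan O t = (Submodule.span O t : Set V) := by
  ext x
  rw [SetLike.mem_coe, Submodule.mem_span_set']
  constructor
  · rintro ⟨m, c, g, hc, hg, rfl⟩
    exact ⟨m, fun i => ⟨c i, hc i⟩, fun i => ⟨g i, hg i⟩, rfl⟩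
  · rintro ⟨m, c, g, rfl⟩
    exact ⟨m, fun i => c i, fun i => g i, fun i => (c i).2, fun i => (g i).2, rfl⟩

variable {F : Type} [Field F] [NumberField F] (v : HeightOneSpectrum (𝓞 F))

lemma OF_iff {c : F} : c ∈ OF F ↔ ∃ r : 𝓞 F, algebraMap (𝓞 F) F r = c :=
  ⟨fun h => ⟨⟨c, h⟩, rfl⟩, fun ⟨r, hr⟩ => hr ▸ r.2⟩

lemma OF_Ov {c : F} (hc : c ∈ OF F) : algebraMap F (Fv F v) c ∈ Ov F v := by
  obtain ⟨r, rfl⟩ := OF_iff.mp hc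
  exact HeightOneSpectrum.coe_algebraMap_mem (𝓞 F) F v r

variable {V : Type} [AddCommGroup V] [Module F V]

lemma toVv_add (x y : V) : toVv F v (x + y) = toVv F v x + toVv F v y := TensorProduct.tmul_add _ _ _
lemma toVv_zero : toVv F v (0 : V) = 0 := TensorProduct.tmul_zero _ _
lemma toVv_smul (c : F) (x : V) : toVv F v (c • x) = algebraMap F (Fv F v) c • toVv F v x := by
  rw [toVv, toVv, TensorProduct.tmul_smul, algebraMap_smul]

lemma Lv_ospan (t : Set V) : Lv F (ospan (OF F) t) v = ospan (Ov F v) (toVv F v '' t) := by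
  rw [Lv, ospan_eq, ospan_eq, ospan_eq]
  congr 1
  apply le_antisymm
  · rw [Submodule.span_le]
    rintro _ ⟨x, hx, rfl⟩
    rw [SetLike.mem_coe] at hx ⊢
    induction hx using Submodule.span_induction with
    | mem x h => exact Submodule.subset_span ⟨x, h, rfl⟩
    | zero => rw [toVv_zero]; exact Submodule.zero_mem _
    | add x y _ _ h1 h2 => rw [toVv_add]; exact Submodule.add_mem _ h1 h2
    | smul c x _ h =>
      have e : toVv F v (c • x) = (⟨algebraMap F (Fv F v) c, OF_Ov v c.2⟩ : Ov F v) • toVv F v x := toVv_smul v (c : F) x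
      rw [e]
      exact Submodule.smul_mem _ _ h
  · exact Submodule.span_mono (Set.image_mono Submodule.subset_span)

lemma span_toVv {N : Set V} (h : Submodule.span F N = ⊤) : Submodule.span (Fv F v) (toVv F v '' N) = ⊤ := by
  rw [eq_top_iff]
  rintro x -
  have key : ∀ y : V, toVv F v y ∈ Submodule.span (Fv F v) (toVv F v '' N) := by
    intro y
    have hy : y ∈ Submodule.span F N := by rw [h]; trivial
    induction hy using Submodule.span_induction with
    | mem x h => exact Submodule.subset_span ⟨x, h, rfl⟩
    | zero => rw [toVv_zero]; exact Submodule.zero_mem _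
    | add x y _ _ h1 h2 => rw [toVv_add]; exact Submodule.add_mem _ h1 h2
    | smul c x _ h =>
      rw [toVv_smul]
      exact Submodule.smul_mem _ _ h
  induction x using TensorProduct.induction_on with
  | zero => exact Submodule.zero_mem _
  | add x y h1 h2 => exact Submodule.add_mem _ h1 h2
  | tmul a y =>
    have e : a ⊗ₜ[F] y = a • toVv F v y := by rw [toVv, TensorProduct.smul_tmul', smul_eq_mul, mul_one]
    rw [e]
    exact Submodule.smul_mem _ _ (key y)

lemma Lv_lattice {N : Set V} (hN : IsLatticeOn (OF F) N) : IsLatticeOn (Ov F v) (Lv F N v) := by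
  obtain ⟨⟨t, ht⟩, hs⟩ := hN
  refine ⟨⟨t.image (toVv F v), ?_⟩, ?_⟩
  · rw [ht, Lv_ospan, Finset.coe_image]
  · rw [eq_top_iff, ← span_toVv v hs]
    refine Submodule.span_mono ?_
    rw [Lv, ospan_eq]
    exact Submodule.subset_span

lemma Qv_toVv (Q : QuadraticForm F V) (x : V) : Qv F Q v (toVv F v x) = algebraMap F (Fv F v) (Q x) := by
  let _ : Invertible (2 : F) := invertibleOfNonzero two_ne_zero
  refine (QuadraticForm.baseChange_tmul Q (1 : Fv F v) x).trans ?_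
  rw [mul_one, Algebra.algebraMap_eq_smul_one]

lemma polar_toVv (Q : QuadraticForm F V) (x y : V) : QuadraticMap.polar (Qv F Q v) (toVv F v x) (toVv F v y) = algebraMap F (Fv F v) (QuadraticMap.polar Q x y) := by
  simp only [QuadraticMap.polar, ← toVv_add, Qv_toVv, map_sub]

lemma Lv_int {Q : QuadraticForm F V} {N : Set V} (hN : IsLatticeOn (OF F) N) (hi : IsIntegral (OF F) Q N) : IsIntegral (Ov F v) (Qv F Q v) (Lv F N v) := by
  intro x hx
  have hadd : ∀ x ∈ N, ∀ y ∈ N, x + y ∈ N := by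
    obtain ⟨⟨t, ht⟩, -⟩ := hN
    rw [ht, ospan_eq]
    exact fun x hx y hy => Submodule.add_mem _ hx hy
  rw [Lv, ospan_eq, SetLike.mem_coe] at hx
  have hp : ∀ x ∈ N, ∀ y ∈ N, QuadraticMap.polar Q x y ∈ OF F := fun x hx y hy =>
    Subring.sub_mem _ (Subring.sub_mem _ (hi _ (hadd x hx y hy)) (hi x hx)) (hi y hy)
  have hp2 : ∀ y ∈ N, ∀ x ∈ Submodule.span (Ov F v) (toVv F v '' N), QuadraticMap.polar (Qv F Q v) x (toVv F v y) ∈ Ov F v := by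
    intro y hy x hx
    induction hx using Submodule.span_induction with
    | mem x h => obtain ⟨x, hx, rfl⟩ := h; rw [polar_toVv]; exact OF_Ov v (hp _ hx _ hy)
    | zero => rw [QuadraticMap.polar_zero_left]; exact Subring.zero_mem _
    | add x y _ _ h1 h2 => rw [QuadraticMap.polar_add_left]; exact Subring.add_mem _ h1 h2
    | smul c x _ h =>
      have e : c • x = (c : Fv F v) • x := rfl
      rw [e, QuadraticMap.polar_smul_left, smul_eq_mul]
      exact Subring.mul_mem _ c.2 h
  have hp3 : ∀ z ∈ Submodule.span (Ov F v) (toVv F v '' N), ∀ x ∈ Submodule.span (Ov F v) (toVv F v '' N), QuadraticMap.polar (Qv F Q v) z x ∈ Ov F v := by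
    intro z hz x hx
    induction hx using Submodule.span_induction with
    | mem x h => obtain ⟨x, hx, rfl⟩ := h; exact hp2 x hx z hz
    | zero => rw [QuadraticMap.polar_zero_right]; exact Subring.zero_mem _
    | add x y _ _ h1 h2 => rw [QuadraticMap.polar_add_right]; exact Subring.add_mem _ h1 h2
    | smul c x _ h =>
      have e : c • x = (c : Fv F v) • x := rfl
      rw [e, QuadraticMap.polar_smul_right, smul_eq_mul]
      exact Subring.mul_mem _ c.2 h
  induction hx using Submodule.span_induction with
  | mem x h => obtain ⟨x, hx, rfl⟩ := h; rw [Qv_toVv]; exact OF_Ov v (hi _ hx)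
  | zero => rw [QuadraticMap.map_zero]; exact Subring.zero_mem _
  | add x y hx hy h1 h2 => rw [QuadraticMap.map_add (Qv F Q v)]; exact Subring.add_mem _ (Subring.add_mem _ h1 h2) (hp3 _ hx _ hy)
  | smul c x _ h =>
    change Qv F Q v ((c : Fv F v) • x) ∈ Ov F v
    rw [QuadraticMap.map_smul, smul_eq_mul]
    exact Subring.mul_mem _ (Subring.mul_mem _ c.2 c.2) h

lemma Qv_nondeg [FiniteDimensional F V] {Q : QuadraticForm F V} (h : Nondeg Q) : Nondeg (Qv F Q v) := by
  intro x hx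
  let b := Module.finBasis F V
  have hn : (Q.polarBilin : LinearMap.BilinForm F V).Nondegenerate := by
    refine (LinearMap.IsRefl.nondegenerate_iff_separatingLeft ?_).mpr ?_
    · intro x y hxy
      rw [QuadraticMap.polarBilin_apply_apply] at hxy ⊢
      rwa [QuadraticMap.polar_comm]
    · intro x hx
      exact h x hx
  let d := LinearMap.BilinForm.dualBasis Q.polarBilin hn b
  let B := b.baseChange (Fv F v)
  apply B.repr.map_eq_zero_iff.mp
  apply Finsupp.ext
  intro j
  have h1 := hx (toVv F v (d j))
  rw [← B.sum_repr x] at h1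
  have e : ∀ i, B i = toVv F v (b i) := fun i => Module.Basis.baseChange_apply _ _ i
  rw [← QuadraticMap.polarBilin_apply_apply, map_sum, LinearMap.sum_apply] at h1
  simp only [map_smul, LinearMap.smul_apply, QuadraticMap.polarBilin_apply_apply, e, polar_toVv, smul_eq_mul] at h1
  have e2 : ∀ i, QuadraticMap.polar Q (b i) (d j) = if i = j then 1 else 0 := by
    intro i
    rw [QuadraticMap.polar_comm]
    have := LinearMap.BilinForm.apply_dualBasis_left (B := Q.polarBilin) hn b j i
    convert this using 1
    rfl
  simp only [e2] at h1
  simpa using h1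
end
end QH

end

section
open scoped TensorProduct
open IsDedekindDomain
namespace QH
open IsDedekindDomain NumberField WithZero
open scoped Classical
set_option linter.unusedSectionVars false
universe u
section
variable {F : Type} [Field F] [NumberField F] (v : HeightOneSpectrum (𝓞 F))

lemma Ov_pir : IsPrincipalIdealRing (Ov F v) := inferInstanceAs (IsPrincipalIdealRing (v.adicCompletionIntegers F))
lemma Ov_frac : IsFractionRing (Ov F v) (Fv F v) := inferInstanceAs (IsFractionRing (v.adicCompletionIntegers F) (v.adicCompletion F))

lemma Ov_tf : Module.IsTorsionFree (Ov F v) (Fv F v) := by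
  have := Ov_frac v
  have : FaithfulSMul (Ov F v) (Fv F v) := IsFractionRing.instFaithfulSMul (Ov F v) (Fv F v)
  exact FaithfulSMul.to_isTorsionFree (Ov F v) (Fv F v)

lemma exists_latbasis {W : Type} [AddCommGroup W] [Module (Fv F v) W] {n : ℕ} (hn : Module.finrank (Fv F v) W = n) {N : Set W}
    (hN : IsLatticeOn (Ov F v) N) :
    ∃ e : Module.Basis (Fin n) (Fv F v) W, (∀ i, e i ∈ N) ∧ ∀ x ∈ N, ∀ i, e.repr x i ∈ Ov F v := by
  have := Ov_pir v
  have := Ov_frac v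
  have := Ov_tf v
  obtain ⟨⟨t, ht⟩, hs⟩ := hN
  rw [ospan_eq] at ht
  let M : Submodule (Ov F v) W := Submodule.span (Ov F v) (t : Set W)
  have hM : Submodule.IsLattice (Fv F v) M := ⟨⟨t, rfl⟩, by rw [← ht]; exact hs⟩
  have : Module.Free (Ov F v) M := Submodule.IsLattice.free (Fv F v) M
  let b := Module.Free.chooseBasis (Ov F v) M
  let e := b.extendOfIsLattice (Fv F v)
  have he : ∀ i, e i = (b i).val := fun i => Module.Basis.extendOfIsLattice_apply (Fv F v) b i
  have hc : Fintype.card (Module.Free.ChooseBasisIndex (Ov F v) M) = n := by rw [← hn, Module.finrank_eq_card_basis e]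
  let σ : Module.Free.ChooseBasisIndex (Ov F v) M ≃ Fin n := Fintype.equivFinOfCardEq hc
  refine ⟨e.reindex σ, fun i => ?_, fun x hx i => ?_⟩
  · rw [Module.Basis.reindex_apply, he, ht]
    exact (b _).2
  · rw [Module.Basis.repr_reindex_apply]
    rw [ht] at hx
    have h1 : x = ∑ k, ((b.repr ⟨x, hx⟩ k : Ov F v) : Fv F v) • e k := by
      have h2 := congrArg (fun y : M => (y : W)) (b.sum_repr ⟨x, hx⟩)
      simp only [Submodule.coe_sum, Submodule.coe_smul] at h2
      refine h2.symm.trans (Finset.sum_congr rfl fun k _ => ?_)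
      rw [he]; rfl
    rw [h1, e.repr_sum_self]
    exact (b.repr ⟨x, hx⟩ _).2

lemma glob_vecs (φ0 : F →+* ℝ) {V : Type} [AddCommGroup V] [Module F V] {Q : QuadraticForm F V} {L : Set V} {n : ℕ} 
    (hG : IsGlobUniversal F Q L n) (g : Fin n → Fin n → F) (hgi : ∀ i j, g i j ∈ OF F)
    (hpos : ∀ φ : F →+* ℝ, ∀ y : Fin n → ℝ, y ≠ 0 → 0 < ∑ i, ∑ j, φ (g i j) * (y i * y j)) :
    ∃ u : Fin n → V, (∀ i, u i ∈ L) ∧ ∀ i j, QuadraticMap.polar Q (u i) (u j) = g i j + g j i := by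
  let B : LinearMap.BilinMap F (Fin n → F) F := Matrix.toLinearMap₂' F (Matrix.of g)
  let q : QuadraticForm F (Fin n → F) := LinearMap.BilinMap.toQuadraticMap B
  have hB : ∀ x y, B x y = ∑ i, ∑ j, g i j * (x i * y j) := by
    intro x y
    rw [Matrix.toLinearMap₂'_apply]
    simp only [smul_eq_mul, Matrix.of_apply]
    refine Finset.sum_congr rfl fun i _ => Finset.sum_congr rfl fun j _ => ?_
    ring
  have hq : ∀ x, q x = ∑ i, ∑ j, g i j * (x i * x j) := fun x => hB x x
  have hpd : PosDef F q := by
    intro φ x hx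
    rw [hq]
    simp only [map_sum, map_mul]
    refine hpos φ (fun i => φ (x i)) (fun h => hx ?_)
    funext i
    exact (map_eq_zero φ).mp (congrFun h i)
  have hnd : Nondeg q := by
    intro x hx
    by_contra h0
    have h1 := hx x
    rw [QuadraticMap.polar_self] at h1
    have h2 := hpd φ0 x h0
    have h3 : q x = 0 := by simpa using h1
    rw [h3, map_zero] at h2
    exact lt_irrefl _ h2
  let b := Pi.basisFun F (Fin n)
  let t : Finset (Fin n → F) := Finset.univ.image b
  have hbN : ∀ i, b i ∈ ospan (OF F) (t : Set (Fin n → F)) := by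
    intro i
    rw [ospan_eq]
    exact Submodule.subset_span (by simp [t])
  have hN : IsLatticeOn (OF F) (ospan (OF F) (t : Set (Fin n → F))) := by
    refine ⟨⟨t, rfl⟩, ?_⟩
    rw [eq_top_iff, ← b.span_eq]
    refine Submodule.span_mono ?_
    rintro _ ⟨i, rfl⟩
    exact hbN i
  have hco : ∀ x ∈ ospan (OF F) (t : Set (Fin n → F)), ∀ i, x i ∈ OF F := by
    rintro x ⟨m, c, h, hc, hh, rfl⟩ i
    rw [Finset.sum_apply]
    refine Subring.sum_mem _ fun k _ => Subring.mul_mem _ (hc k) ?_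
    have := hh k
    simp only [t, Finset.coe_image, Finset.coe_univ, Set.image_univ, Set.mem_range] at this
    obtain ⟨j, hj⟩ := this
    rw [← hj, Pi.basisFun_apply, Pi.single_apply]
    split_ifs
    · exact Subring.one_mem _
    · exact Subring.zero_mem _
  have hintg : IsIntegral (OF F) q (ospan (OF F) (t : Set (Fin n → F))) := by
    intro x hx
    rw [hq]
    exact Subring.sum_mem _ fun i _ => Subring.sum_mem _ fun j _ => Subring.mul_mem _ (hgi i j) (Subring.mul_mem _ (hco x hx i) (hco x hx j))
  obtain ⟨σ, -, hiso, hσ⟩ := hG (Fin n → F) q hnd hpd (by simp) _ hN hintg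
  refine ⟨fun i => σ (b i), fun i => hσ ⟨_, hbN i, rfl⟩, fun i j => ?_⟩
  have e1 : QuadraticMap.polar Q (σ (b i)) (σ (b j)) = QuadraticMap.polar q (b i) (b j) := by
    simp only [QuadraticMap.polar, ← map_add, hiso]
  have e2 : ∀ i j, B (b i) (b j) = g i j := by
    intro i j
    rw [hB]
    simp [b, Pi.basisFun_apply, Pi.single_apply]
  rw [e1, LinearMap.BilinMap.polar_toQuadraticMap, e2, e2]

lemma exists_dom (k : ℕ) (C : ℝ) : ∃ M : ℕ, C < M ∧ v.valuation F (M : F) ≤ exp (-(k : ℤ)) := by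
  set a := Ideal.absNorm v.asIdeal with ha
  have h1 : 1 < a := NumberField.HeightOneSpectrum.one_lt_absNorm v
  have h2 : v.valuation F ((a : ℕ) : F) ≤ exp (-1 : ℤ) := by
    have h3 : ((a : ℕ) : 𝓞 F) ∈ v.asIdeal := Ideal.absNorm_mem _
    have h4 := (val_alg_lt_one v (K := F)).mpr h3
    rw [map_natCast] at h4
    have := (lt_exp_iff v (x := (a : F)) (n := 0)).mp (by simpa using h4)
    simpa using this
  obtain ⟨s, hs⟩ := pow_unbounded_of_one_lt C (y := (a : ℝ)) (by exact_mod_cast h1)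
  refine ⟨a ^ (k + s), ?_, ?_⟩
  · push_cast
    refine hs.trans_le (pow_le_pow_right₀ (by exact_mod_cast h1.le) (by omega))
  · push_cast
    rw [map_pow]
    refine (pow_le_pow_left₀ (zero_le) h2 _).trans ?_
    rw [← exp_nsmul, exp_le_exp]
    simp

lemma dom_pos {n : ℕ} {g : Fin n → Fin n → ℝ} {C M : ℝ} (hC : ∀ i j, |g i j| ≤ C) (hM : n * C < M) {y : Fin n → ℝ} (hy : y ≠ 0) :
    0 < ∑ i, ∑ j, (g i j + if i = j then M else 0) * (y i * y j) := by
  have e : ∑ i, ∑ j, (g i j + if i = j then M else 0) * (y i * y j) = ∑ i, ∑ j, g i j * (y i * y j) + M * ∑ i, y i ^ 2 := by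
    rw [Finset.mul_sum, ← Finset.sum_add_distrib]
    refine Finset.sum_congr rfl fun i _ => ?_
    simp only [add_mul, Finset.sum_add_distrib, ite_mul, zero_mul, Finset.sum_ite_eq, Finset.mem_univ, if_true]
    ring
  have h1 : ∑ i, ∑ j, -(C * ((y i ^ 2 + y j ^ 2) / 2)) ≤ ∑ i, ∑ j, g i j * (y i * y j) := by
    refine Finset.sum_le_sum fun i _ => Finset.sum_le_sum fun j _ => ?_
    have h2 : |g i j * (y i * y j)| ≤ C * ((y i ^ 2 + y j ^ 2) / 2) := by
      rw [abs_mul]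
      refine mul_le_mul (hC i j) ?_ (abs_nonneg _) ((abs_nonneg _).trans (hC i j))
      rw [abs_mul]
      nlinarith [sq_nonneg (|y i| - |y j|), sq_abs (y i), sq_abs (y j)]
    exact neg_le_of_abs_le h2
  have h3 : ∑ i : Fin n, ∑ j : Fin n, -(C * ((y i ^ 2 + y j ^ 2) / 2)) = -(n * C) * ∑ i, y i ^ 2 := by
    simp only [Finset.sum_neg_distrib, ← Finset.mul_sum, add_div, Finset.sum_add_distrib, ← Finset.sum_div, Finset.sum_const, Finset.card_univ, Fintype.card_fin, nsmul_eq_mul]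
    ring
  have h4 : 0 < ∑ i, y i ^ 2 := by
    obtain ⟨i, hi⟩ := Function.ne_iff.mp hy
    exact Finset.sum_pos' (fun j _ => sq_nonneg _) ⟨i, Finset.mem_univ _, by simp at hi; positivity⟩
  rw [e]
  nlinarith

/-- approximation of a local Gram matrix -/
lemma approx_vecs (φ0 : F →+* ℝ) {V : Type} [AddCommGroup V] [Module F V] {Q : QuadraticForm F V} {L : Set V} {n : ℕ} 
    (hG : IsGlobUniversal F Q L n) (T : Fin n → Fin n → Fv F v) (hT : ∀ i j, T i j ∈ Ov F v) (k : ℕ) :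
    ∃ u : Fin n → V, (∀ i, u i ∈ L) ∧ ∀ i j, Valued.v (T i j + T j i - QuadraticMap.polar (Qv F Q v) (toVv F v (u i)) (toVv F v (u j))) ≤ exp (-(k : ℤ)) := by
  have h0 : ∀ i j, ∃ r : 𝓞 F, Valued.v (T i j - algebraMap F (v.adicCompletion F) (algebraMap (𝓞 F) F r)) ≤ exp (-(k : ℤ)) :=
    fun i j => exists_approx_v v k (hT i j)
  choose r hr using h0
  obtain ⟨C, hC⟩ : ∃ C : ℝ, ∀ (φ : F →+* ℝ) (i j : Fin n), |φ (algebraMap (𝓞 F) F (r i j))| ≤ C := by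
    have hfin : Finite (F →+* ℝ) := by
      refine Finite.of_injective (fun φ : F →+* ℝ => (Complex.ofRealHom.comp φ : F →+* ℂ)) ?_
      intro φ ψ h
      ext x
      have := RingHom.congr_fun h x
      exact Complex.ofReal_injective this
    obtain ⟨C, hC⟩ := (Set.finite_range (fun p : (F →+* ℝ) × Fin n × Fin n => |p.1 (algebraMap (𝓞 F) F (r p.2.1 p.2.2))|)).bddAbove
    exact ⟨C, fun φ i j => hC ⟨(φ, i, j), rfl⟩⟩
  obtain ⟨M, hM, hMv⟩ := exists_dom v k (n * C)
  let g : Fin n → Fin n → F := fun i j => algebraMap (𝓞 F) F (r i j) + if i = j then (M : F) else 0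
  obtain ⟨u, hu, hug⟩ := glob_vecs φ0 hG g (fun i j => OF_iff.mpr ⟨r i j + if i = j then (M : 𝓞 F) else 0, by
      simp only [g, map_add]; split_ifs <;> simp⟩) (by
    intro φ y hy
    have := dom_pos (g := fun i j => φ (algebraMap (𝓞 F) F (r i j))) (fun i j => hC φ i j) hM hy
    convert this using 6
    simp only [g, map_add]
    split_ifs <;> simp)
  have hg : ∀ i j, Valued.v (T i j - algebraMap F (v.adicCompletion F) (g i j)) ≤ exp (-(k : ℤ)) := by
    intro i j
    have e : T i j - algebraMap F (v.adicCompletion F) (g i j) = (T i j - algebraMap F (v.adicCompletion F) (algebraMap (𝓞 F) F (r i j))) + -algebraMap F (v.adicCompletion F) (if i = j then (M : F) else 0) := by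
      simp only [g, map_add]; ring
    rw [e]
    refine val_le_exp_of v (hr i j) ?_
    rw [Valuation.map_neg]
    refine le_trans (le_of_eq (HeightOneSpectrum.valuedAdicCompletion_eq_valuation' v _)) ?_
    split_ifs
    · exact hMv
    · exact (Valuation.map_zero (v.valuation F)).trans_le zero_le
  refine ⟨u, hu, fun i j => ?_⟩
  rw [polar_toVv, hug, map_add]
  have e : T i j + T j i - (algebraMap F (Fv F v) (g i j) + algebraMap F (Fv F v) (g j i)) = (T i j - algebraMap F (Fv F v) (g i j)) + (T j i - algebraMap F (Fv F v) (g j i)) := by ring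
  rw [e]
  exact val_le_exp_of v (hg i j) (hg j i)
end
end QH

end

section
open scoped TensorProduct
open IsDedekindDomain
namespace QH
open IsDedekindDomain NumberField WithZero
open scoped Classical
set_option linter.unusedSectionVars false
universe u
section
lemma compact_gram {K : Type} [Field K] [TopologicalSpace K] [IsTopologicalRing K] [T2Space K] (O : Subring K) [CompactSpace O]
    {ι : Type} [Fintype ι] {n : ℕ} (G : ι → ι → K) (P : Fin n → Fin n → K) (c : ℕ → Fin n → ι → O)
    (h : ∀ i j, Filter.Tendsto (fun k => ∑ s, ∑ s', (c k i s : K) * (c k j s' : K) * G s s') Filter.atTop (nhds (P i j))) :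
    ∃ c : Fin n → ι → O, ∀ i j, ∑ s, ∑ s', (c i s : K) * (c j s' : K) * G s s' = P i j := by
  let Φ : (Fin n → ι → O) → Fin n → Fin n → K := fun c i j => ∑ s, ∑ s', (c i s : K) * (c j s' : K) * G s s'
  have hΦ : Continuous Φ := by
    refine continuous_pi fun i => continuous_pi fun j => continuous_finsetSum _ fun s _ => continuous_finsetSum _ fun s' _ => ?_
    have h1 : ∀ i s, Continuous fun c : Fin n → ι → O => (c i s : K) := fun i s =>
      continuous_subtype_val.comp ((continuous_apply s).comp (continuous_apply i))
    exact ((h1 i s).mul (h1 j s')).mul continuous_const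
  have hcl : IsClosed (Set.range Φ) := (isCompact_range hΦ).isClosed
  have hP : P ∈ Set.range Φ := by
    refine hcl.mem_of_tendsto (f := fun k => Φ (c k)) (b := Filter.atTop) ?_ (Filter.Eventually.of_forall fun k => ⟨_, rfl⟩)
    exact tendsto_pi_nhds.mpr fun i => tendsto_pi_nhds.mpr fun j => h i j
  obtain ⟨c, hc⟩ := hP
  exact ⟨c, fun i j => congrFun (congrFun hc i) j⟩

lemma polar_comb {K : Type} [Field K] {V : Type} [AddCommGroup V] [Module K V] (Q : QuadraticForm K V) {ι : Type} [Fintype ι]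
    (a b : ι → K) (x : ι → V) : QuadraticMap.polar Q (∑ s, a s • x s) (∑ s, b s • x s) = ∑ s, ∑ s', a s * b s' * QuadraticMap.polar Q (x s) (x s') := by
  rw [← QuadraticMap.polarBilin_apply_apply, map_sum Q.polarBilin, LinearMap.sum_apply]
  refine Finset.sum_congr rfl fun s _ => ?_
  rw [map_sum]
  refine Finset.sum_congr rfl fun s' _ => ?_
  simp only [map_smul, LinearMap.smul_apply, QuadraticMap.polarBilin_apply_apply, smul_eq_mul]
  ring

lemma isom_of_gram {K : Type} [Field K] [CharZero K] {V W : Type} [AddCommGroup V] [Module K V] [AddCommGroup W] [Module K W]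
    {Q : QuadraticForm K V} {Q' : QuadraticForm K W} (hnd : Nondeg Q') {n : ℕ} (e : Module.Basis (Fin n) K W) (u : Fin n → V)
    (h : ∀ i j, QuadraticMap.polar Q (u i) (u j) = QuadraticMap.polar Q' (e i) (e j)) :
    ∃ σ : W →ₗ[K] V, Function.Injective σ ∧ (∀ x, Q (σ x) = Q' x) ∧ ∀ x, σ x = ∑ i, e.repr x i • u i := by
  let σ : W →ₗ[K] V := e.constr K u
  have hσ : ∀ x, σ x = ∑ i, e.repr x i • u i := fun x => by
    rw [Module.Basis.constr_apply_fintype]; rfl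
  have hp : ∀ x y, QuadraticMap.polar Q (σ x) (σ y) = QuadraticMap.polar Q' x y := by
    intro x y
    rw [hσ, hσ, polar_comb]
    conv_rhs => rw [← e.sum_repr x, ← e.sum_repr y, polar_comb]
    simp only [h]
  refine ⟨σ, ?_, ?_, hσ⟩
  · rw [← LinearMap.ker_eq_bot, LinearMap.ker_eq_bot']
    intro x hx
    refine hnd x fun y => ?_
    rw [← hp, hx, QuadraticMap.polar_zero_left]
  · intro x
    have h1 := hp x x
    rw [QuadraticMap.polar_self, QuadraticMap.polar_self] at h1
    have h2 : (2 : K) ≠ 0 := two_ne_zero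
    simpa using h1

variable {F : Type} [Field F] [NumberField F]

lemma loc_of_glob (φ0 : F →+* ℝ) {V : Type} [AddCommGroup V] [Module F V] {Q : QuadraticForm F V} {L : Set V} {n : ℕ}
    (hL : IsLatticeOn (OF F) L) (hG : IsGlobUniversal F Q L n) : IsLocUniversal F Q L n := by
  intro v W _ _ Q' hnd hn N hN hintg
  obtain ⟨e, heN, heO⟩ := exists_latbasis v hn hN
  have hadd : ∀ x ∈ N, ∀ y ∈ N, x + y ∈ N := by
    obtain ⟨⟨t, ht⟩, -⟩ := hN
    rw [ht, ospan_eq]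
    exact fun x hx y hy => Submodule.add_mem _ hx hy
  have hp : ∀ x ∈ N, ∀ y ∈ N, QuadraticMap.polar Q' x y ∈ Ov F v := fun x hx y hy =>
    Subring.sub_mem _ (Subring.sub_mem _ (hintg _ (hadd x hx y hy)) (hintg x hx)) (hintg y hy)
  let T : Fin n → Fin n → Fv F v := fun i j => if i = j then Q' (e i) else if i < j then QuadraticMap.polar Q' (e i) (e j) else 0
  have hT : ∀ i j, T i j ∈ Ov F v := by
    intro i j
    simp only [T]
    split_ifs
    · exact hintg _ (heN i)
    · exact hp _ (heN i) _ (heN j)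
    · exact Subring.zero_mem _
  have hTP : ∀ i j, T i j + T j i = QuadraticMap.polar Q' (e i) (e j) := by
    intro i j
    rcases lt_trichotomy i j with h | h | h
    · simp only [T, h.ne, h.ne', h, h.not_gt, if_true, if_false, add_zero]
    · subst h
      simp only [T, if_true, QuadraticMap.polar_self, two_smul]
      try ring
    · simp only [T, h.ne, h.ne', h, h.not_gt, if_true, if_false, zero_add]
      exact QuadraticMap.polar_comm _ _ _
  choose w hwL hwv using approx_vecs v φ0 hG T hT
  obtain ⟨⟨t, ht⟩, -⟩ := hL
  have hLv : Lv F L v = (Submodule.span (Ov F v) (Set.range fun s : t => toVv F v (s : V)) : Set (Vv F V v)) := by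
    rw [ht, Lv_ospan, ospan_eq]
    congr 2
    ext x
    simp
  have hex : ∀ k i, ∃ c : t → Ov F v, ∑ s, (c s : Fv F v) • toVv F v (s : V) = toVv F v (w k i) := by
    intro k i
    have h1 : toVv F v (w k i) ∈ Lv F L v := by
      rw [Lv, ospan_eq]
      exact Submodule.subset_span ⟨_, hwL k i, rfl⟩
    rw [hLv, SetLike.mem_coe, Submodule.mem_span_range_iff_exists_fun] at h1
    exact h1
  choose c hc using hex
  have hcomp : CompactSpace (Ov F v) := inferInstanceAs (CompactSpace (Valued.integer (v.adicCompletion F)))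
  obtain ⟨d, hd⟩ := compact_gram (Ov F v) (fun s s' : t => QuadraticMap.polar (Qv F Q v) (toVv F v (s : V)) (toVv F v (s' : V)))
    (fun i j => QuadraticMap.polar Q' (e i) (e j)) c (by
      intro i j
      refine tendsto_of_val v fun k => ?_
      have h1 := hwv k i j
      rw [hTP, ← hc k i, ← hc k j, polar_comb] at h1
      exact h1)
  have hchar : CharZero (Fv F v) := charZero_of_injective_algebraMap (algebraMap F (Fv F v)).injective
  obtain ⟨σ, hσi, hσQ, hσ⟩ := isom_of_gram (Q := Qv F Q v) hnd e (fun i => ∑ s, (d i s : Fv F v) • toVv F v (s : V)) (by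
    intro i j
    rw [polar_comb]
    exact hd i j)
  refine ⟨σ, hσi, hσQ, ?_⟩
  rintro _ ⟨x, hx, rfl⟩
  rw [hσ, hLv, SetLike.mem_coe]
  refine Submodule.sum_mem _ fun i _ => ?_
  have h1 : ∑ s, (d i s : Fv F v) • toVv F v (s : V) ∈ Submodule.span (Ov F v) (Set.range fun s : t => toVv F v (s : V)) := by
    refine Submodule.sum_mem _ fun s _ => ?_
    exact Submodule.smul_mem _ (d i s) (Submodule.subset_span ⟨s, rfl⟩)
  exact Submodule.smul_mem _ (⟨e.repr x i, heO x hx i⟩ : Ov F v) h1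
end
end QH

end

/-- Let `F` be a totally real number field, `L` a positive definite
integral `O_F`-lattice and `n` a positive integer with `rank L ≥ n+3 ≥ 4`.  Then the
following are equivalent: (1) `L` is globally `n`-ADC; (2) `L` is `n`-regular and
locally `n`-universal; (3) `L` is globally `n`-universal. -/
theorem globADC_iff_nRegular_and_locUniversal_iff_globUniversal
    (F : Type) [Field F] [NumberField F] (hF : TotallyReal F)
    {V : Type} [AddCommGroup V] [Module F V]
    (Q : QuadraticForm F V) (hQ : Nondeg Q) (hQpos : PosDef F Q)
    (L : Set V) (hL : IsLatticeOn (OF F) L) (hLint : IsIntegral (OF F) Q L)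
    (n : ℕ) (hn : 1 ≤ n) (hrank : n + 3 ≤ Module.finrank F V) :
    (IsGlobADC F Q L n ↔ (IsNRegular F Q L n ∧ IsLocUniversal F Q L n)) ∧
    (IsGlobADC F Q L n ↔ IsGlobUniversal F Q L n) := by
  obtain ⟨w⟩ : Nonempty (NumberField.InfinitePlace F) := inferInstance
  let φ0 : F →+* ℝ := NumberField.InfinitePlace.embedding_of_isReal (hF w)
  have h13 : IsGlobADC F Q L n ↔ IsGlobUniversal F Q L n := by
    constructor
    · intro h W _ _ Q' hnd hpos hW N hN hintg
      have hfd : FiniteDimensional F W := Module.finite_of_finrank_pos (by omega)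
      exact h W Q' hnd hpos hW N hN hintg (QH.rep φ0 n _ _ _ _ hfd hpos hQpos hW hrank)
    · intro h W _ _ Q' hnd hpos hW N hN hintg _
      exact h W Q' hnd hpos hW N hN hintg
  refine ⟨h13.trans ⟨fun h => ⟨?_, QH.loc_of_glob φ0 hL h⟩, ?_⟩, h13⟩
  · intro W _ _ Q' hnd hpos hW N hN hintg _
    exact h W Q' hnd hpos hW N hN hintg
  · rintro ⟨hr, hl⟩ W _ _ Q' hnd hpos hW N hN hintg
    have hfd : FiniteDimensional F W := Module.finite_of_finrank_pos (by omega)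
    refine hr W Q' hnd hpos hW N hN hintg fun v => ?_
    exact hl v _ _ (QH.Qv_nondeg v hnd) ((Module.finrank_baseChange).trans hW) _ (QH.Lv_lattice v hN) (QH.Lv_int v hN hintg)
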